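/- Consider the triangular time-delay system (1.4) under the stated hypotheses. Then for every σ > 0 there exist functions μᵢ ∈ C^∞(ℝⁱ; (0,+∞)) (i = 1,…,n) such that, defining k₁(ξ₁) := −μ₁(ξ₁)·ξ₁ and kⱼ(ξ₁,…,ξⱼ) := −μⱼ(ξ₁,…,ξⱼ)·(ξⱼ − k_{j−1}(ξ₁,…,ξ_{j−1})) for j = 2,…,n, and defining V : C⁰([−r,0];ℝⁿ) → [0,∞) by V(x) := max_{θ∈[−r,0]} e^{2σθ}( x₁(θ)² + Σ_{j=2}^n |xⱼ(θ) − k_{j−1}(x₁(θ),…,x_{j−1}(θ))|² ), the following hold: (i) V⁰(x; v) ≤ −2σ·V(x) for all (t,x,d) ∈ [0,∞)×C⁰([−r,0];ℝⁿ)×D, where v := ( f₁(t,d,x₁) + g₁(t,d,x₁)·x₂(0), …, f_{n−1}(t,d,x₁,…,x_{n−1}) + g_{n−1}(t,d,x₁,…,x_{n−1})·xₙ(0), fₙ(t,d,x) + gₙ(t,d,x)·kₙ(x(0)) ) ∈ ℝⁿ; (ii) the closed-loop system (1.4) with the delay-free feedback u(t) = kₙ(x(t)) is URGAS; (iii) V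 is a State Robust Control Lyapunov Functional for (1.4) which satisfies the small-control property. -/

import Mathlib

open Filter Topology MeasureTheory Set RealInnerProductSpace

noncomputable section

/-- ℝⁿ with the Euclidean norm. -/
abbrev Euc (n : ℕ) := EuclideanSpace ℝ (Fin n)

/-- The state space C⁰([−r,0];ℝⁿ) with the sup norm. -/
abbrev Hist (n : ℕ) (r : ℝ) := C(Icc (-r) (0:ℝ), Euc n)

/-- Class K∞ functions (on [0,∞)). -/
def IsKinf (a : ℝ → ℝ) : Prop :=
  ContinuousOn a (Ici 0) ∧ StrictMonoOn a (Ici 0) ∧ a 0 = 0 ∧ Tendsto a atTop atTop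

/-- Class K⁺: positive continuous functions on [0,∞). -/
def IsKplus (b : ℝ → ℝ) : Prop := ContinuousOn b (Ici 0) ∧ ∀ t, 0 ≤ t → 0 < b t

/-- Class ℰ: continuous nonnegative integrable functions on [0,∞) tending to 0. -/
def IsClassE (q : ℝ → ℝ) : Prop :=
  ContinuousOn q (Ici 0) ∧ (∀ t, 0 ≤ t → 0 ≤ q t) ∧
    IntegrableOn q (Ici 0) ∧ Tendsto q atTop (𝓝 0)

/-- Continuous positive definite functions on [0,∞). -/
def IsPosDef (ρ : ℝ → ℝ) : Prop :=
  ContinuousOn ρ (Ici 0) ∧ ρ 0 = 0 ∧ (∀ s, 0 < s → 0 < ρ s) ∧ ∀ s, 0 ≤ s → 0 ≤ ρ s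

/-- Membership in M_D : measurable selections of values in D. -/
def InMD {l : ℕ} (D : Set (Euc l)) (d : ℝ → Euc l) : Prop :=
  Measurable d ∧ ∀ t, d t ∈ D

/-- The operator E_h(x;v) of Section 4.II: E_h(x;v)(θ) = x(0)+(θ+h)v for −h < θ ≤ 0 and
E_h(x;v)(θ) = x(θ+h) for −r ≤ θ ≤ −h. -/
def Ehist {n : ℕ} {r : ℝ} (h : ℝ) (x : Hist n r) (v : Euc n) : Hist n r :=
  if hr : -r ≤ 0 then
    { toFun := fun θ => if (θ : ℝ) ≤ -h then x (projIcc (-r) 0 hr ((θ : ℝ) + h))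
        else x (projIcc (-r) 0 hr 0) + ((θ : ℝ) + h) • v
      continuous_toFun := by
        apply Continuous.if_le
        · exact x.continuous.comp (continuous_projIcc.comp (by fun_prop))
        · exact continuous_const.add ((continuous_subtype_val.add continuous_const).smul
            continuous_const)
        · exact continuous_subtype_val
        · exact continuous_const
        · intro θ hθ
          rw [hθ]
          simp }
  else x

/-- The Dini derivative V⁰(t,x;v) of a functional V : [0,∞)×C⁰([−r,0];ℝⁿ) → ℝ:
V⁰(t,x;v) := limsup_{h→0⁺, y→0} (V(t+h, E_h(x;v)+h·y) − V(t,x))/h. -/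
def diniH {n : ℕ} {r : ℝ} (V : ℝ → Hist n r → ℝ) (t : ℝ) (x : Hist n r) (v : Euc n) :
    EReal :=
  Filter.limsup
    (fun p : ℝ × Hist n r =>
      (((V (t + p.1) (Ehist p.1 x v + p.1 • p.2) - V t x) / p.1 : ℝ) : EReal))
    ((𝓝[>] (0:ℝ)) ×ˢ 𝓝 0)

/-- The simplified Dini derivative V⁰(x;v) := limsup_{h→0⁺} (V(E_h(x;v)) − V(x))/h of a
time-independent functional. -/
def diniH0 {n : ℕ} {r : ℝ} (V : Hist n r → ℝ) (x : Hist n r) (v : Euc n) : EReal :=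
  Filter.limsup (fun h : ℝ => (((V (Ehist h x v) - V x) / h : ℝ) : EReal)) (𝓝[>] (0:ℝ))

/-- x : [t₀−r, tmax) → ℝⁿ (with history map φ) is a solution of the RFDE
ẋ(t) = F(t,d(t),T_r(t)x) with initial condition T_r(t₀)x = x₀, in integral form. -/
def IsSolutionRFDE {n l : ℕ} {r : ℝ} (F : ℝ → Euc l → Hist n r → Euc n)
    (d : ℝ → Euc l) (t₀ : ℝ) (x₀ : Hist n r) (tmax : EReal) (x : ℝ → Euc n)
    (φ : ℝ → Hist n r) : Prop :=
  (t₀ : EReal) < tmax ∧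
  φ t₀ = x₀ ∧
  (∀ t : ℝ, t₀ ≤ t → (t : EReal) < tmax → ∀ θ : Icc (-r) (0:ℝ), φ t θ = x (t + θ)) ∧
  ContinuousOn x {s : ℝ | t₀ - r ≤ s ∧ (s : EReal) < tmax} ∧
  (∀ t : ℝ, t₀ ≤ t → (t : EReal) < tmax → x t = x t₀ + ∫ s in t₀..t, F s (d s) (φ s))

/-- A functional V : [0,∞)×C⁰([−r,0];ℝⁿ) → [0,∞) which is
"almost Lipschitz on bounded sets" (Definition 4.5). -/
def AlmostLipschitzOn {n : ℕ} (r : ℝ) (V : ℝ → Hist n r → ℝ) : Prop :=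
  ContinuousOn (fun p : ℝ × Hist n r => V p.1 p.2) (Ici 0 ×ˢ univ) ∧
  ∃ LV P G : ℝ → ℝ, Monotone LV ∧ Monotone P ∧ Monotone G ∧ (∀ s, 1 ≤ G s) ∧
    (∀ R, 0 ≤ R → ∀ t ∈ Icc (0:ℝ) R, ∀ x y : Hist n r, ‖x‖ ≤ R → ‖y‖ ≤ R →
      |V t y - V t x| ≤ LV R * ‖y - x‖) ∧
    (∀ R, 0 ≤ R → ∀ M : ℝ, 0 ≤ M → ∀ x : Hist n r, ‖x‖ ≤ R →
      LipschitzWith (Real.toNNReal M) (fun θ : Icc (-r) (0:ℝ) => x θ) →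
      ∀ t ∈ Icc (0:ℝ) R, ∀ h : ℝ, 0 ≤ h → h ≤ 1 / G (R + M) →
        |V (t + h) x - V t x| ≤ h * P R * (1 + M))

/-- RGAOS (Definition 4.2) of the system ẋ(t) = F(t,d(t),T_r(t)x), Y(t) = H(t,T_r(t)x),
phrased via the existence of a family of unique maximal solutions satisfying robust
forward completeness and properties P1, P2. -/
def RGAOSrfde {n l : ℕ} {Y : Type*} [NormedAddCommGroup Y] [NormedSpace ℝ Y] (r : ℝ)
    (D : Set (Euc l)) (F : ℝ → Euc l → Hist n r → Euc n) (H : ℝ → Hist n r → Y) : Prop :=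
  ∃ (X : ℝ → Hist n r → (ℝ → Euc l) → ℝ → Euc n)
    (Φ : ℝ → Hist n r → (ℝ → Euc l) → ℝ → Hist n r)
    (tmax : ℝ → Hist n r → (ℝ → Euc l) → EReal),
    (∀ t₀ : ℝ, 0 ≤ t₀ → ∀ x₀ d, InMD D d →
      IsSolutionRFDE F d t₀ x₀ (tmax t₀ x₀ d) (X t₀ x₀ d) (Φ t₀ x₀ d) ∧
      ∀ tm y ψ, IsSolutionRFDE F d t₀ x₀ tm y ψ → tm ≤ tmax t₀ x₀ d ∧
        ∀ t : ℝ, t₀ ≤ t → (t : EReal) < tm → ψ t = Φ t₀ x₀ d t) ∧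
    -- robust forward completeness
    (∀ T, 0 ≤ T → ∀ s, 0 ≤ s → ∃ M, ∀ t₀ ∈ Icc (0:ℝ) T, ∀ ξ ∈ Icc (0:ℝ) T,
      ∀ x₀ : Hist n r, ‖x₀‖ ≤ s → ∀ d, InMD D d →
        ((t₀ + ξ : ℝ) : EReal) < tmax t₀ x₀ d ∧ ‖Φ t₀ x₀ d (t₀ + ξ)‖ ≤ M) ∧
    -- P1 (output stability)
    (∀ ε, 0 < ε → ∀ T, 0 ≤ T →
      (∃ M, ∀ t₀ ∈ Icc (0:ℝ) T, ∀ x₀ : Hist n r, ‖x₀‖ ≤ ε → ∀ d, InMD D d →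
        ∀ t : ℝ, t₀ ≤ t → (t : EReal) < tmax t₀ x₀ d → ‖H t (Φ t₀ x₀ d t)‖ ≤ M) ∧
      (∃ δ, 0 < δ ∧ ∀ t₀ ∈ Icc (0:ℝ) T, ∀ x₀ : Hist n r, ‖x₀‖ ≤ δ → ∀ d, InMD D d →
        ∀ t : ℝ, t₀ ≤ t → (t : EReal) < tmax t₀ x₀ d → ‖H t (Φ t₀ x₀ d t)‖ ≤ ε)) ∧
    -- P2 (uniform output attractivity on bounded sets of initial data)
    (∀ ε, 0 < ε → ∀ T, 0 ≤ T → ∀ R, 0 ≤ R → ∃ τ, 0 ≤ τ ∧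
      ∀ t₀ ∈ Icc (0:ℝ) T, ∀ x₀ : Hist n r, ‖x₀‖ ≤ R → ∀ d, InMD D d →
        ∀ t : ℝ, t₀ + τ ≤ t → (t : EReal) < tmax t₀ x₀ d → ‖H t (Φ t₀ x₀ d t)‖ ≤ ε)

/-- URGAOS (Definition 4.3) of the system ẋ(t) = F(t,d(t),T_r(t)x), Y(t) = H(t,T_r(t)x). -/
def URGAOSrfde {n l : ℕ} {Y : Type*} [NormedAddCommGroup Y] [NormedSpace ℝ Y] (r : ℝ)
    (D : Set (Euc l)) (F : ℝ → Euc l → Hist n r → Euc n) (H : ℝ → Hist n r → Y) : Prop :=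
  ∃ (X : ℝ → Hist n r → (ℝ → Euc l) → ℝ → Euc n)
    (Φ : ℝ → Hist n r → (ℝ → Euc l) → ℝ → Hist n r)
    (tmax : ℝ → Hist n r → (ℝ → Euc l) → EReal),
    (∀ t₀ : ℝ, 0 ≤ t₀ → ∀ x₀ d, InMD D d →
      IsSolutionRFDE F d t₀ x₀ (tmax t₀ x₀ d) (X t₀ x₀ d) (Φ t₀ x₀ d) ∧
      ∀ tm y ψ, IsSolutionRFDE F d t₀ x₀ tm y ψ → tm ≤ tmax t₀ x₀ d ∧
        ∀ t : ℝ, t₀ ≤ t → (t : EReal) < tm → ψ t = Φ t₀ x₀ d t) ∧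
    (∀ T, 0 ≤ T → ∀ s, 0 ≤ s → ∃ M, ∀ t₀ ∈ Icc (0:ℝ) T, ∀ ξ ∈ Icc (0:ℝ) T,
      ∀ x₀ : Hist n r, ‖x₀‖ ≤ s → ∀ d, InMD D d →
        ((t₀ + ξ : ℝ) : EReal) < tmax t₀ x₀ d ∧ ‖Φ t₀ x₀ d (t₀ + ξ)‖ ≤ M) ∧
    (∀ ε, 0 < ε →
      (∃ M, ∀ t₀ : ℝ, 0 ≤ t₀ → ∀ x₀ : Hist n r, ‖x₀‖ ≤ ε → ∀ d, InMD D d →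
        ∀ t : ℝ, t₀ ≤ t → (t : EReal) < tmax t₀ x₀ d → ‖H t (Φ t₀ x₀ d t)‖ ≤ M) ∧
      (∃ δ, 0 < δ ∧ ∀ t₀ : ℝ, 0 ≤ t₀ → ∀ x₀ : Hist n r, ‖x₀‖ ≤ δ → ∀ d, InMD D d →
        ∀ t : ℝ, t₀ ≤ t → (t : EReal) < tmax t₀ x₀ d → ‖H t (Φ t₀ x₀ d t)‖ ≤ ε)) ∧
    (∀ ε, 0 < ε → ∀ R, 0 ≤ R → ∃ τ, 0 ≤ τ ∧
      ∀ t₀ : ℝ, 0 ≤ t₀ → ∀ x₀ : Hist n r, ‖x₀‖ ≤ R → ∀ d, InMD D d →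
        ∀ t : ℝ, t₀ + τ ≤ t → (t : EReal) < tmax t₀ x₀ d → ‖H t (Φ t₀ x₀ d t)‖ ≤ ε)

/-- Hypotheses (S1)-(S7) for the control system (1.3). -/
def HypS {n l m : ℕ} {Y : Type*} [NormedAddCommGroup Y] [NormedSpace ℝ Y]
    (r : ℝ) (hr : 0 < r) (D : Set (Euc l)) (U : Set (Euc m))
    (f : ℝ → Euc l → Hist n r → Euc m → Euc n) (H : ℝ → Hist n r → Y) : Prop :=
  -- f(t,d,0,0) = 0, H(t,0) = 0
  (∀ t : ℝ, 0 ≤ t → ∀ d ∈ D, f t d 0 0 = 0) ∧ (∀ t : ℝ, 0 ≤ t → H t 0 = 0) ∧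
  -- (S1)
  (∀ t : ℝ, 0 ≤ t → ContinuousOn
    (fun p : Hist n r × Euc m × Euc l => f t p.2.2 p.1 p.2.1) (univ ×ˢ U ×ˢ D)) ∧
  (∃ L : ℝ → ℝ, ContinuousOn L (Ici 0) ∧ MonotoneOn L (Ici 0) ∧ (∀ s, 0 ≤ s → 0 ≤ L s) ∧
    ∀ t : ℝ, 0 ≤ t → ∀ x y : Hist n r, ∀ d ∈ D, ∀ u ∈ U,
      ⟪x ⟨0, ⟨by linarith, le_rfl⟩⟩ - y ⟨0, ⟨by linarith, le_rfl⟩⟩,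
        f t d x u - f t d y u⟫ ≤ L (t + ‖x‖ + ‖y‖ + ‖u‖) * ‖x - y‖ ^ 2) ∧
  -- (S2)
  (∀ T, 0 ≤ T → ∀ R, 0 ≤ R → ∀ Ru, 0 ≤ Ru → ∃ M, ∀ t ∈ Icc (0:ℝ) T, ∀ d ∈ D,
    ∀ x : Hist n r, ‖x‖ ≤ R → ∀ u ∈ U, ‖u‖ ≤ Ru → ‖f t d x u‖ ≤ M) ∧
  -- (S3)
  (∃ A : Set ℝ, A.Countable ∧ (∀ K : Set ℝ, IsCompact K → (A ∩ K).Finite) ∧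
    ContinuousOn (fun p : ℝ × Hist n r × Euc m × Euc l => f p.1 p.2.2.2 p.2.1 p.2.2.1)
      ((Ici 0 \ A) ×ˢ univ ×ˢ U ×ˢ D) ∧
    ∀ t₀ : ℝ, 0 ≤ t₀ → ∀ x : Hist n r, ∀ u ∈ U, ∀ d ∈ D,
      Tendsto (fun t => f t d x u) (𝓝[>] t₀) (𝓝 (f t₀ d x u))) ∧
  -- (S4)
  (∀ ε, 0 < ε → ∀ t : ℝ, 0 ≤ t → ∃ δ, 0 < δ ∧ ∀ τ : ℝ, 0 ≤ τ → ∀ d ∈ D, ∀ u ∈ U,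
    ∀ x : Hist n r, |τ - t| + ‖x‖ + ‖u‖ < δ → ‖f τ d x u‖ < ε) ∧
  -- (S5)
  (∃ LU : ℝ → ℝ, ContinuousOn LU (Ici 0) ∧ MonotoneOn LU (Ici 0) ∧
    (∀ s, 0 ≤ s → 0 ≤ LU s) ∧
    ∀ t : ℝ, 0 ≤ t → ∀ x : Hist n r, ∀ d ∈ D, ∀ u ∈ U, ∀ v ∈ U,
      ‖f t d x u - f t d x v‖ ≤ LU (t + ‖x‖ + ‖u‖ + ‖v‖) * ‖u - v‖) ∧
  -- (S6)
  IsCompact D ∧ D.Nonempty ∧ IsClosed U ∧ Convex ℝ U ∧ (0 : Euc m) ∈ U ∧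
  -- (S7)
  (∀ T, 0 ≤ T → ∀ R, 0 ≤ R → ∃ LH, 0 ≤ LH ∧ ∀ t ∈ Icc (0:ℝ) T, ∀ τ ∈ Icc (0:ℝ) T,
    ∀ x y : Hist n r, ‖x‖ ≤ R → ‖y‖ ≤ R →
      ‖H t x - H τ y‖ ≤ LH * (|t - τ| + ‖x - y‖))

/-- The conjunction of all requirements of Definition 4.7 for an ORCLF of system (1.3),
with all the data given explicitly. -/
def ORCLFrfde {n l m p : ℕ} {Y : Type*} [NormedAddCommGroup Y] [NormedSpace ℝ Y]
    (r : ℝ) (D : Set (Euc l)) (U : Set (Euc m))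
    (f : ℝ → Euc l → Hist n r → Euc m → Euc n) (H : ℝ → Hist n r → Y)
    (V : ℝ → Hist n r → ℝ) (a₁ a₂ β μ : ℝ → ℝ)
    (Ψ : ℝ → Euc p → Euc m → EReal) (Φ : ℝ → Hist n r → Euc p) (q ρ : ℝ → ℝ) : Prop :=
  AlmostLipschitzOn r V ∧ (∀ t x, 0 ≤ V t x) ∧
  -- property (i)
  IsKinf a₁ ∧ IsKinf a₂ ∧ IsKplus β ∧ IsKplus μ ∧
  (∀ t : ℝ, 0 ≤ t → ∀ x : Hist n r,
    max (a₁ ‖H t x‖) (a₁ (μ t * ‖x‖)) ≤ V t x ∧ V t x ≤ a₂ (β t * ‖x‖)) ∧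
  -- property (ii)
  IsClassE q ∧ IsPosDef ρ ∧
  (∀ t φ u, Ψ t φ u ≠ ⊥) ∧
  (∀ t : ℝ, 0 ≤ t → Ψ t 0 0 = 0) ∧
  (∀ u ∈ U, UpperSemicontinuousOn (fun pr : ℝ × Euc p => Ψ pr.1 pr.2 u)
    (Ici 0 ×ˢ univ)) ∧
  ContinuousOn (fun pr : ℝ × Hist n r => Φ pr.1 pr.2) (Ici 0 ×ˢ univ) ∧
  (∀ T, 0 ≤ T → ∀ R, 0 ≤ R → ∃ L, ∀ t ∈ Icc (0:ℝ) T, ∀ x y : Hist n r,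
    ‖x‖ ≤ R → ‖y‖ ≤ R → ‖Φ t x - Φ t y‖ ≤ L * ‖x - y‖) ∧
  (∀ t : ℝ, 0 ≤ t → Φ t 0 = 0) ∧
  (∀ t : ℝ, 0 ≤ t → ∀ φv : Euc p, (⨅ u : U, Ψ t φv u.1) ≤ ((q t : ℝ) : EReal)) ∧
  (∀ t : ℝ, 0 ≤ t → ∀ x : Hist n r, ∀ (N : ℕ) (u : Fin N → Euc m), (∀ i, u i ∈ U) →
    ∀ lam : Fin N → ℝ, (∀ i, 0 ≤ lam i) → (∑ i, lam i) = 1 → ∀ d ∈ D,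
      diniH V t x (f t d x (∑ i, lam i • u i)) ≤
        ((-ρ (V t x) : ℝ) : EReal) + ⨆ i, Ψ t (Φ t x) (u i))

/-- The "small-control" property of Definition 4.7. -/
def SmallControlRFDE {m p : ℕ} (U : Set (Euc m))
    (Ψ : ℝ → Euc p → Euc m → EReal) (q : ℝ → ℝ) (a γ : ℝ → ℝ) : Prop :=
  IsKinf a ∧ IsKplus γ ∧
  ∀ t : ℝ, 0 ≤ t → ∀ φv : Euc p, ∃ u ∈ U, ‖u‖ ≤ a (γ t * ‖φv‖) ∧
    Ψ t φv u ≤ ((q t : ℝ) : EReal)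

/-- A feedback k : [0,∞)×C⁰([−r,0];ℝⁿ) → U which is continuous, completely locally
Lipschitz with respect to x, and vanishes at 0. -/
def GoodFeedback {n m : ℕ} (r : ℝ) (U : Set (Euc m))
    (kf : ℝ → Hist n r → Euc m) : Prop :=
  (∀ t x, kf t x ∈ U) ∧
  ContinuousOn (fun pr : ℝ × Hist n r => kf pr.1 pr.2) (Ici 0 ×ˢ univ) ∧
  (∀ T, 0 ≤ T → ∀ R, 0 ≤ R → ∃ L, ∀ t ∈ Icc (0:ℝ) T, ∀ x y : Hist n r,
    ‖x‖ ≤ R → ‖y‖ ≤ R → ‖kf t x - kf t y‖ ≤ L * ‖x - y‖) ∧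
  (∀ t : ℝ, 0 ≤ t → kf t 0 = 0)

/-- The point θ = 0 of the interval [−r,0]. -/
def zeroIcc {r : ℝ} (hr : 0 < r) : Icc (-r) (0:ℝ) := ⟨0, ⟨by linarith, le_rfl⟩⟩

/-- Restriction of ξ ∈ ℝᴺ to its first i coordinates. -/
def prefixEuc {N : ℕ} (i : ℕ) (h : i ≤ N) (ξ : Euc N) : Euc i :=
  WithLp.toLp 2 fun j : Fin i => ξ (Fin.castLE h j)

/-- The linear map of restriction to the first i coordinates. -/
def prefixL {N i : ℕ} (h : i ≤ N) : Euc N →ₗ[ℝ] Euc i where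
  toFun := prefixEuc i h
  map_add' _ _ := rfl
  map_smul' _ _ := rfl

/-- Restriction of a history in C⁰([−r,0];ℝᴺ) to its first i coordinates. -/
def prefixHist {N : ℕ} {r : ℝ} (i : ℕ) (h : i ≤ N) (x : Hist N r) : Hist i r where
  toFun := fun θ => prefixEuc i h (x θ)
  continuous_toFun := (prefixL h).continuous_of_finiteDimensional.comp x.continuous

/-- The Lyapunov–Krasovskii functional (5.4):
V(x) = max_{θ∈[−r,0]} e^{2σθ}( x₁(θ)² + Σ_{j=2}^{n+1} |x_j(θ) − k_{j−1}(x₁(θ),…)|² ). -/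
def Vtri (n : ℕ) {r : ℝ} (σ : ℝ) (k : (i : ℕ) → Euc (i + 1) → ℝ)
    (x : Hist (n + 1) r) : ℝ :=
  ⨆ θ : Icc (-r) (0:ℝ), Real.exp (2 * σ * (θ : ℝ)) *
    ((x θ 0) ^ 2 + ∑ j : Fin n,
      (x θ j.succ - k j.val (prefixEuc (j.val + 1)
        (Nat.succ_le_succ (le_of_lt j.isLt)) (x θ))) ^ 2)

/-- The right-hand side of the triangular system (1.4) (components 1,…,n use
x_{i+1}(t) as the "control"; the last component uses u). -/
def triVec (n : ℕ) {l : ℕ} {r : ℝ} (hr : 0 < r)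
    (f g : (i : ℕ) → ℝ → Euc l → Hist (i + 1) r → ℝ)
    (t : ℝ) (d : Euc l) (x : Hist (n + 1) r) (u : ℝ) : Euc (n + 1) :=
  WithLp.toLp 2 fun i : Fin (n + 1) =>
    f i.val t d (prefixHist (i.val + 1) (Nat.succ_le_succ i.is_le) x) +
      g i.val t d (prefixHist (i.val + 1) (Nat.succ_le_succ i.is_le) x) *
        (if h : i.val + 1 < n + 1 then x (zeroIcc hr) ⟨i.val + 1, h⟩ else u)


theorem aux_exists_mono_bound {P : ℝ → ℝ → Prop} (hP : ∀ R, 0 ≤ R → ∃ C, P R C)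
    (mono : ∀ R R' C C', 0 ≤ R' → R' ≤ R → C ≤ C' → P R C → P R' C') :
    ∃ Γ : ℝ → ℝ, Monotone Γ ∧ (∀ s, 1 ≤ Γ s) ∧ ∀ R, 0 ≤ R → P R (Γ R) := by
  have h : ∀ i : ℕ, ∃ C, P (i : ℝ) C := fun i => hP i (Nat.cast_nonneg i)
  choose C hC using h
  refine ⟨fun R => 1 + ∑ i ∈ Finset.range (⌈R⌉₊ + 1), |C i|, ?_, ?_, ?_⟩
  · intro a b hab
    have : ⌈a⌉₊ ≤ ⌈b⌉₊ := Nat.ceil_mono hab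
    have := Finset.sum_le_sum_of_subset_of_nonneg (f := fun i => |C i|)
      (Finset.range_mono (show ⌈a⌉₊ + 1 ≤ ⌈b⌉₊ + 1 by omega)) (fun i _ _ => abs_nonneg _)
    simpa using this
  · intro s
    have : 0 ≤ ∑ i ∈ Finset.range (⌈s⌉₊ + 1), |C i| := Finset.sum_nonneg fun _ _ => abs_nonneg _
    simpa using this
  · intro R hR
    refine mono _ R _ _ hR (Nat.le_ceil R) ?_ (hC ⌈R⌉₊)
    have := Finset.single_le_sum (f := fun i => |C i|) (fun i _ => abs_nonneg _)
      (Finset.mem_range.2 (Nat.lt_succ_self ⌈R⌉₊))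
    have h2 := le_abs_self (C ⌈R⌉₊)
    linarith

theorem aux_smooth_majorant {N : ℕ} (Q : Euc N → ℝ)
    (hQ : ∀ x, ∃ c, ∀ᶠ y in 𝓝 x, Q y ≤ c) :
    ∃ μ : Euc N → ℝ, ContDiff ℝ (⊤ : ℕ∞) μ ∧ ∀ x, Q x < μ x := by
  obtain ⟨g, hg⟩ := exists_contMDiffMap_forall_mem_convex_of_local_const (n := (⊤ : ℕ∞))
    (modelWithCornersSelf ℝ (Euc N)) (M := Euc N) (F := ℝ) (t := fun x => Ioi (Q x))
    (fun x => convex_Ioi _) (fun x => by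
      obtain ⟨c, hc⟩ := hQ x
      exact ⟨c + 1, hc.mono fun y hy => by simp only [mem_Ioi]; linarith⟩)
  exact ⟨g, g.contMDiff.contDiff, fun x => hg x⟩

theorem aux_ball_bound {E F : Type*} [NormedAddCommGroup E] [ProperSpace E]
    [NormedAddCommGroup F] (h : E → F) (hc : Continuous h) (R : ℝ) :
    ∃ C, 0 ≤ C ∧ ∀ ξ, ‖ξ‖ ≤ R → ‖h ξ‖ ≤ C := by
  obtain ⟨C, hC⟩ := (isCompact_closedBall (0 : E) R).exists_bound_of_continuousOn hc.continuousOn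
  exact ⟨max C 0, le_max_right _ _, fun ξ hξ =>
    (hC ξ (by simpa using hξ)).trans (le_max_left _ _)⟩

theorem aux_lip_ball {N : ℕ} {F : Type*} [NormedAddCommGroup F] [NormedSpace ℝ F]
    (W : Euc N → F) (hW : ContDiff ℝ (⊤ : ℕ∞) W) (R : ℝ) :
    ∃ L, 0 ≤ L ∧ ∀ x y, ‖x‖ ≤ R → ‖y‖ ≤ R → ‖W x - W y‖ ≤ L * ‖x - y‖ := by
  obtain ⟨C, hC0, hC⟩ := aux_ball_bound (fderiv ℝ W) (hW.continuous_fderiv (by simp)) R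
  refine ⟨C, hC0, fun x y hx hy => ?_⟩
  exact Convex.norm_image_sub_le_of_norm_fderiv_le (𝕜 := ℝ) (s := Metric.closedBall (0 : Euc N) R)
    (fun z _ => (hW.differentiable (by simp)) z) (fun z hz => hC z (by simpa using hz))
    (convex_closedBall _ _) (by simpa using hy) (by simpa using hx)

theorem aux_Kup {N : ℕ} (h : Euc N → ℝ) (hc : Continuous h) (h0 : h 0 = 0) :
    ∃ a, IsKinf a ∧ ∀ ξ, h ξ ≤ a ‖ξ‖ := by
  let S : ℝ → ℝ := fun s => sSup ((fun ξ => |h (s • ξ)|) '' Metric.closedBall (0 : Euc N) 1)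
  have hjc : Continuous (fun p : ℝ × Euc N => |h (p.1 • p.2)|) :=
    (hc.comp (continuous_fst.smul continuous_snd)).abs
  have hS : Continuous S := (isCompact_closedBall (0 : Euc N) 1).continuous_sSup hjc
  have hb : ∀ s, BddAbove ((fun ξ => |h (s • ξ)|) '' Metric.closedBall (0 : Euc N) 1) := fun s =>
    ((isCompact_closedBall (0 : Euc N) 1).image
      (hjc.comp (by fun_prop : Continuous fun ξ : Euc N => (s, ξ)))).bddAbove
  have hne : ∀ s : ℝ, ((fun ξ => |h (s • ξ)|) '' Metric.closedBall (0 : Euc N) 1).Nonempty :=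
    fun s => ⟨_, 0, by simp, rfl⟩
  have hSle : ∀ s, 0 ≤ s → ∀ ξ, ‖ξ‖ ≤ s → |h ξ| ≤ S s := by
    intro s hs ξ hξ
    apply le_csSup (hb s)
    rcases hs.eq_or_lt with rfl | hs
    · have : ξ = 0 := by simpa using hξ
      exact ⟨0, by simp, by simp [this]⟩
    · refine ⟨s⁻¹ • ξ, ?_, ?_⟩
      · simp only [mem_closedBall_zero_iff, norm_smul, norm_inv, Real.norm_eq_abs, abs_of_pos hs]
        rw [inv_mul_le_iff₀ hs]; simpa using hξ
      · simp only [smul_smul, mul_inv_cancel₀ hs.ne', one_smul]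
  have hSm : MonotoneOn S (Ici 0) := by
    intro a ha b hb' hab
    apply csSup_le (hne a)
    rintro _ ⟨ξ, hξ, rfl⟩
    refine hSle b hb' _ ?_
    simp only [mem_closedBall_zero_iff] at hξ
    rw [norm_smul, Real.norm_eq_abs, abs_of_nonneg ha]
    have ha' : 0 ≤ a := ha
    nlinarith [norm_nonneg ξ]
  have hS0 : S 0 = 0 := by
    have : (fun ξ : Euc N => |h ((0:ℝ) • ξ)|) = fun _ => 0 := by ext ξ; simp [h0]
    simp only [S, this]
    apply le_antisymm
    · refine csSup_le (Set.Nonempty.image _ ⟨0, by simp⟩) ?_; rintro _ ⟨_, _, rfl⟩; exact le_rfl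
    · refine le_csSup ⟨0, ?_⟩ ⟨0, by simp, rfl⟩; rintro _ ⟨_, _, rfl⟩; exact le_rfl
  refine ⟨fun s => s + S s, ⟨(continuous_id.add hS).continuousOn, ?_, by simp [hS0], ?_⟩, ?_⟩
  · intro a ha b hb' hab
    have := hSm ha hb' hab.le
    simp only; linarith
  · refine tendsto_atTop_mono' atTop ?_ tendsto_id
    filter_upwards [eventually_ge_atTop 0] with s hs
    have := hSm (self_mem_Ici (a := (0:ℝ))) hs hs
    simp only [id]; linarith
  · intro ξ
    have := hSle ‖ξ‖ (norm_nonneg _) ξ le_rfl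
    have := le_abs_self (h ξ)
    have := norm_nonneg ξ
    linarith

theorem aux_Klow {N : ℕ} (W : Euc N → ℝ) (hc : Continuous W) (h0 : W 0 = 0)
    (hn : ∀ ξ, 0 ≤ W ξ) (hpos : ∀ ξ, W ξ = 0 → ξ = 0)
    (hprop : ∀ R, ∃ B, ∀ ξ, W ξ ≤ R → ‖ξ‖ ≤ B) :
    ∃ a, IsKinf a ∧ ∀ ξ, a ‖ξ‖ ≤ W ξ := by
  let A : ℝ → ℝ := fun s => ⨅ ξ : Euc N, (W ξ + max 0 (s - ‖ξ‖))
  have hbd : ∀ s, BddBelow (range fun ξ : Euc N => W ξ + max 0 (s - ‖ξ‖)) := fun s =>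
    ⟨0, by rintro _ ⟨ξ, rfl⟩; exact add_nonneg (hn ξ) (le_max_left _ _)⟩
  have hA0 : ∀ s, 0 ≤ A s := fun s => le_ciInf fun ξ => add_nonneg (hn ξ) (le_max_left _ _)
  have hAle : ∀ ξ : Euc N, A ‖ξ‖ ≤ W ξ := fun ξ => (ciInf_le (hbd _) ξ).trans (by simp)
  have hAm : Monotone A := by
    intro a b hab
    apply le_ciInf
    intro ξ
    refine (ciInf_le (hbd _) ξ).trans ?_
    gcongr
  have hAlip : ∀ a b, A a ≤ A b + |a - b| := by
    intro a b
    rw [← sub_le_iff_le_add]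
    apply le_ciInf
    intro ξ
    have h1 := ciInf_le (hbd a) ξ
    have h2 : max 0 (a - ‖ξ‖) ≤ max 0 (b - ‖ξ‖) + |a - b| := by
      apply max_le
      · positivity
      · have := le_abs_self (a - b)
        have := le_max_right 0 (b - ‖ξ‖)
        linarith
    show A a - _ ≤ _
    have h3 : A a ≤ W ξ + max 0 (a - ‖ξ‖) := h1
    linarith
  have hAc : Continuous A := by
    have : LipschitzWith 1 A := by
      apply LipschitzWith.of_le_add
      intro a b
      simpa [Real.dist_eq] using hAlip a b
    exact this.continuous
  have hApos : ∀ s, 0 < s → 0 < A s := by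
    intro s hs
    -- on a compact ball of radius s, use a minimizer
    have hcont : Continuous fun ξ : Euc N => W ξ + max 0 (s - ‖ξ‖) := by fun_prop
    obtain ⟨B, hB⟩ := hprop s
    obtain ⟨ξ₀, -, hmin⟩ := (isCompact_closedBall (0 : Euc N) (max B 0)).exists_isMinOn
      ⟨0, by simp⟩ hcont.continuousOn
    have hv : 0 < W ξ₀ + max 0 (s - ‖ξ₀‖) := by
      rcases (hn ξ₀).eq_or_lt with h | h
      · have := hpos _ h.symm
        subst this
        simp [h0, hs]
      · have := le_max_left 0 (s - ‖ξ₀‖)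
        linarith
    refine lt_of_lt_of_le (lt_min hv hs) (le_ciInf fun ξ => ?_)
    by_cases hξ : ‖ξ‖ ≤ max B 0
    · exact (min_le_left _ _).trans (hmin (by simpa using hξ))
    · have : s < W ξ := by
        by_contra hcon
        exact hξ ((hB ξ (not_lt.1 hcon)).trans (le_max_left _ _))
      have := le_max_left 0 (s - ‖ξ‖)
      exact (min_le_right _ _).trans (by linarith)
  have hAtop : Tendsto A atTop atTop := by
    rw [tendsto_atTop]
    intro M
    obtain ⟨B, hB⟩ := hprop M
    filter_upwards [eventually_ge_atTop (B + M)] with s hs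
    apply le_ciInf
    intro ξ
    by_cases hξ : W ξ ≤ M
    · have := hB ξ hξ
      have := le_max_right 0 (s - ‖ξ‖)
      have := hn ξ
      linarith
    · have := le_max_left 0 (s - ‖ξ‖)
      linarith
  have hfrac : ∀ s : ℝ, 0 ≤ s → s / (1 + s) ≤ 1 := fun s hs => by
    rw [div_le_one (by linarith)]; linarith
  refine ⟨fun s => A s * (s / (1 + s)), ⟨?_, ?_, by simp, ?_⟩, ?_⟩
  · apply hAc.continuousOn.mul
    apply ContinuousOn.div continuousOn_id (by fun_prop)
    intro s hs
    have : (0:ℝ) ≤ s := hs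
    positivity
  · intro a ha b hb hab
    have ha' : (0:ℝ) ≤ a := ha
    have hb' : 0 < b := lt_of_le_of_lt ha' hab
    have h1 : a / (1 + a) < b / (1 + b) := by
      rw [div_lt_div_iff₀ (by linarith) (by linarith)]; nlinarith
    have h2 : 0 ≤ a / (1 + a) := by positivity
    have h3 := hAm hab.le
    have h4 := hApos b hb'
    show A a * (a / (1 + a)) < A b * (b / (1 + b))
    nlinarith [hA0 a]
  · have : Tendsto (fun s => A s * (1 / 2)) atTop atTop :=
      hAtop.atTop_mul_const (by norm_num)
    refine tendsto_atTop_mono' atTop ?_ this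
    filter_upwards [eventually_ge_atTop 1] with s hs
    apply mul_le_mul_of_nonneg_left _ (hA0 s)
    rw [div_le_div_iff₀ (by norm_num) (by linarith)]; linarith
  · intro ξ
    calc A ‖ξ‖ * (‖ξ‖ / (1 + ‖ξ‖)) ≤ A ‖ξ‖ * 1 :=
          mul_le_mul_of_nonneg_left (hfrac _ (norm_nonneg _)) (hA0 _)
      _ ≤ W ξ := by simpa using hAle ξ


/-- The generic functional V(x) = max e^{2σθ} W(x(θ)). -/
def Vw {N : ℕ} {r : ℝ} (σ : ℝ) (W : Euc N → ℝ) (x : Hist N r) : ℝ :=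
  ⨆ θ : Icc (-r) (0:ℝ), Real.exp (2 * σ * (θ : ℝ)) * W (x θ)

theorem Vw_bdd {N : ℕ} {r : ℝ} (σ : ℝ) (W : Euc N → ℝ) (hW : Continuous W) (x : Hist N r) :
    BddAbove (range fun θ : Icc (-r) (0:ℝ) => Real.exp (2 * σ * (θ : ℝ)) * W (x θ)) := by
  apply IsCompact.bddAbove
  apply isCompact_range
  have := x.continuous
  fun_prop

theorem Vw_le_apply {N : ℕ} {r : ℝ} (σ : ℝ) (W : Euc N → ℝ) (hW : Continuous W) (x : Hist N r)
    (θ : Icc (-r) (0:ℝ)) : Real.exp (2 * σ * (θ : ℝ)) * W (x θ) ≤ Vw σ W x :=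
  le_ciSup (Vw_bdd σ W hW x) θ

theorem Vw_le {N : ℕ} {r : ℝ} (hr : 0 < r) (σ : ℝ) (W : Euc N → ℝ) (x : Hist N r) (c : ℝ)
    (h : ∀ θ : Icc (-r) (0:ℝ), Real.exp (2 * σ * (θ : ℝ)) * W (x θ) ≤ c) : Vw σ W x ≤ c :=
  haveI : Nonempty (Icc (-r) (0:ℝ)) := ⟨zeroIcc hr⟩
  ciSup_le h

theorem Vw_zero_le {N : ℕ} {r : ℝ} (hr : 0 < r) (σ : ℝ) (W : Euc N → ℝ) (hW : Continuous W)
    (x : Hist N r) : W (x (zeroIcc hr)) ≤ Vw σ W x := by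
  have := Vw_le_apply σ W hW x (zeroIcc hr)
  simpa [zeroIcc] using this

theorem Vw_nonneg {N : ℕ} {r : ℝ} (hr : 0 < r) (σ : ℝ) (W : Euc N → ℝ) (hW : Continuous W)
    (hn : ∀ ξ, 0 ≤ W ξ) (x : Hist N r) : 0 ≤ Vw σ W x :=
  (hn _).trans (Vw_zero_le hr σ W hW x)

theorem aux_exp_le_one {r σ : ℝ} (hσ : 0 < σ) (θ : Icc (-r) (0:ℝ)) :
    Real.exp (2 * σ * (θ : ℝ)) ≤ 1 := by
  rw [Real.exp_le_one_iff]
  have := θ.2.2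
  nlinarith

theorem Vw_lip {N : ℕ} {r : ℝ} (hr : 0 < r) {σ : ℝ} (hσ : 0 < σ) (W : Euc N → ℝ)
    (hW : Continuous W) (R L : ℝ) (hL0 : 0 ≤ L)
    (hL : ∀ x y, ‖x‖ ≤ R → ‖y‖ ≤ R → ‖W x - W y‖ ≤ L * ‖x - y‖) (x y : Hist N r)
    (hx : ‖x‖ ≤ R) (hy : ‖y‖ ≤ R) : Vw σ W y ≤ Vw σ W x + L * ‖y - x‖ := by
  apply Vw_le hr
  intro θ
  have h1 := Vw_le_apply σ W hW x θ
  have h2 := hL (y θ) (x θ) ((y.norm_coe_le_norm θ).trans hy) ((x.norm_coe_le_norm θ).trans hx)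
  have h3 : ‖y θ - x θ‖ ≤ ‖y - x‖ := (y - x).norm_coe_le_norm θ
  have h4 := aux_exp_le_one hσ θ
  have h5 := Real.exp_pos (2 * σ * (θ : ℝ))
  have h6 : W (y θ) ≤ W (x θ) + L * ‖y - x‖ := by
    have := (le_abs_self _).trans h2
    have := mul_le_mul_of_nonneg_left h3 hL0
    linarith
  have h7 : 0 ≤ L * ‖y - x‖ := by positivity
  calc Real.exp (2 * σ * (θ : ℝ)) * W (y θ)
      ≤ Real.exp (2 * σ * (θ : ℝ)) * (W (x θ) + L * ‖y - x‖) := by gcongr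
    _ ≤ _ := by nlinarith

theorem Vw_almostLipschitz {N : ℕ} {r : ℝ} (hr : 0 < r) {σ : ℝ} (hσ : 0 < σ) (W : Euc N → ℝ)
    (hW : ContDiff ℝ (⊤ : ℕ∞) W) : AlmostLipschitzOn r (fun _ (x : Hist N r) => Vw σ W x) := by
  have key : ∀ R, 0 ≤ R → ∃ L, 0 ≤ L ∧ ∀ x y : Hist N r, ‖x‖ ≤ R → ‖y‖ ≤ R →
      |Vw σ W y - Vw σ W x| ≤ L * ‖y - x‖ := by
    intro R _
    obtain ⟨L, hL0, hL⟩ := aux_lip_ball W hW R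
    refine ⟨L, hL0, fun x y hx hy => ?_⟩
    have h1 := Vw_lip hr hσ W hW.continuous R L hL0 hL x y hx hy
    have h2 := Vw_lip hr hσ W hW.continuous R L hL0 hL y x hy hx
    rw [norm_sub_rev] at h2
    rw [abs_le]; constructor <;> linarith
  have hcont : Continuous (fun x : Hist N r => Vw σ W x) := by
    rw [continuous_iff_continuousAt]
    intro x
    obtain ⟨L, hL0, hL⟩ := key (‖x‖ + 1) (by positivity)
    rw [ContinuousAt, tendsto_iff_norm_sub_tendsto_zero]
    have ht : Tendsto (fun y : Hist N r => L * ‖y - x‖) (𝓝 x) (𝓝 0) := by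
      have : Continuous (fun y : Hist N r => L * ‖y - x‖) := by fun_prop
      simpa using this.tendsto x
    refine squeeze_zero' (Eventually.of_forall fun _ => norm_nonneg _) ?_ ht
    filter_upwards [Metric.ball_mem_nhds x one_pos] with y hy
    apply hL x y (by linarith)
    have : ‖y - x‖ < 1 := by simpa [dist_eq_norm] using hy
    have := norm_le_norm_add_norm_sub' y x
    linarith
  refine ⟨(hcont.comp continuous_snd).continuousOn, ?_⟩
  obtain ⟨Γ, hΓm, hΓ1, hΓ⟩ := aux_exists_mono_bound
    (P := fun R L => ∀ x y : Hist N r, ‖x‖ ≤ R → ‖y‖ ≤ R →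
      |Vw σ W y - Vw σ W x| ≤ L * ‖y - x‖)
    (fun R hR => let ⟨L, _, h⟩ := key R hR; ⟨L, h⟩)
    (fun R R' C C' _ hR hC h x y hx hy => (h x y (hx.trans hR) (hy.trans hR)).trans (by gcongr))
  refine ⟨Γ, fun _ => 0, fun _ => 1, hΓm, monotone_const, monotone_const, fun _ => le_rfl, ?_, ?_⟩
  · intro R hR t _ x y hx hy
    exact hΓ R hR x y hx hy
  · intro R _ M _ x _ _ t _ h _ _
    simp

/-- The main Dini derivative estimate. -/
theorem Vw_dini {N : ℕ} {r : ℝ} (hr : 0 < r) {σ : ℝ} (hσ : 0 < σ) (W : Euc N → ℝ)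
    (hW : ContDiff ℝ (⊤ : ℕ∞) W) (hn : ∀ ξ, 0 ≤ W ξ) (x : Hist N r) (v : Euc N) (c : ℝ)
    (hc : 0 ≤ c)
    (hmax : W (x (zeroIcc hr)) = Vw σ W x →
      fderiv ℝ W (x (zeroIcc hr)) v ≤ -(2 * σ) * W (x (zeroIcc hr)) + c) (t : ℝ) :
    diniH (fun _ (x : Hist N r) => Vw σ W x) t x v ≤ ((-(2 * σ) * Vw σ W x + c : ℝ) : EReal) := by
  set x0 := x (zeroIcc hr) with hx0
  set Vx := Vw σ W x with hVx
  have hV0 : W x0 ≤ Vx := Vw_zero_le hr σ W hW.continuous x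
  have hVn : 0 ≤ Vx := (hn _).trans hV0
  -- claim on the segment
  have hder : HasDerivAt (fun s : ℝ => Real.exp (2 * σ * s) * W (x0 + s • v))
      (2 * σ * W x0 + fderiv ℝ W x0 v) 0 := by
    have h1 : HasDerivAt (fun s : ℝ => Real.exp (2 * σ * s)) (2 * σ) 0 := by
      have := ((hasDerivAt_id (0:ℝ)).const_mul (2 * σ)).exp
      simpa using this
    have h2 : HasDerivAt (fun s : ℝ => x0 + s • v) v 0 := by
      simpa using ((hasDerivAt_id (0:ℝ)).smul_const v).const_add x0
    have h3 : HasFDerivAt W (fderiv ℝ W x0) (x0 + (0:ℝ) • v) := by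
      simpa using ((hW.differentiable (by simp)) x0).hasFDerivAt
    have h4 := h3.comp_hasDerivAt (0:ℝ) h2
    have h5 := h1.mul h4
    refine (h5.congr_deriv ?_)
    simp
  have hseg : ∀ ε, 0 < ε → ∃ h₀, 0 < h₀ ∧ ∀ s, 0 < s → s ≤ h₀ →
      Real.exp (2 * σ * s) * W (x0 + s • v) ≤ Vx + s * (c + ε) := by
    intro ε hε
    have hev : ∀ᶠ s in 𝓝[>] (0:ℝ),
        Real.exp (2 * σ * s) * W (x0 + s • v) ≤ Vx + s * (c + ε) := by
      rcases hV0.eq_or_lt with heq | hlt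
      · have hm := hmax heq
        have hlim := hder.hasDerivWithinAt (s := Ioi 0)
        rw [hasDerivWithinAt_iff_tendsto_slope' (by simp)] at hlim
        have hev := hlim.eventually (eventually_lt_nhds
          (show 2 * σ * W x0 + fderiv ℝ W x0 v < c + ε by linarith))
        filter_upwards [hev, self_mem_nhdsWithin] with s hs hs0
        have hs0' : (0:ℝ) < s := hs0
        rw [slope_def_field, div_lt_iff₀ (by simpa using hs0')] at hs
        simp at hs
        linarith
      · have hcn : Tendsto (fun s : ℝ => Real.exp (2 * σ * s) * W (x0 + s • v)) (𝓝[>] 0)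
            (𝓝 (W x0)) := by
          have := hder.continuousAt.tendsto
          simp at this
          exact this.mono_left nhdsWithin_le_nhds
        filter_upwards [hcn.eventually (eventually_lt_nhds hlt), self_mem_nhdsWithin] with s hs hs0
        have hs0' : (0:ℝ) < s := hs0
        have : 0 ≤ s * (c + ε) := by positivity
        linarith
    rw [eventually_nhdsWithin_iff, Metric.eventually_nhds_iff] at hev
    obtain ⟨δ, hδ, h⟩ := hev
    refine ⟨δ / 2, by positivity, fun s hs hs2 => h ?_ hs⟩
    rw [Real.dist_eq, sub_zero, abs_of_pos hs]; linarith
  obtain ⟨L, hL0, hL⟩ := aux_lip_ball W hW (‖x‖ + ‖v‖ + 1)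
  have hup : ∀ ε, 0 < ε → ∃ h₀, 0 < h₀ ∧ ∀ h, 0 < h → h ≤ h₀ → ∀ y : Hist N r, ‖y‖ ≤ 1 →
      Vw σ W (Ehist h x v + h • y) ≤
        Real.exp (-(2 * σ * h)) * (Vx + h * (c + ε)) + L * (h * ‖y‖) := by
    intro ε hε
    obtain ⟨h₀, hh₀, hs⟩ := hseg ε hε
    refine ⟨min h₀ 1, by positivity, fun h hh hh1 y hy => ?_⟩
    have hh1' : h ≤ 1 := hh1.trans (min_le_right _ _)
    have hh0' : h ≤ h₀ := hh1.trans (min_le_left _ _)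
    have hr' : -r ≤ 0 := by linarith
    have hEapp : ∀ θ : Icc (-r) (0:ℝ), Ehist h x v θ =
        if (θ : ℝ) ≤ -h then x (projIcc (-r) 0 hr' ((θ : ℝ) + h))
        else x (projIcc (-r) 0 hr' 0) + ((θ : ℝ) + h) • v := by
      intro θ
      simp only [Ehist, hr', dite_true]
      rfl
    have hp0 : projIcc (-r) 0 hr' 0 = zeroIcc hr := by
      apply Subtype.ext; simp [zeroIcc, projIcc, hr.le]
    have hEn : ∀ θ, ‖Ehist h x v θ‖ ≤ ‖x‖ + ‖v‖ := by
      intro θ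
      rw [hEapp]
      split_ifs with hθ
      · have := x.norm_coe_le_norm (projIcc (-r) 0 hr' ((θ : ℝ) + h))
        have := norm_nonneg v
        linarith
      · have h1 := x.norm_coe_le_norm (projIcc (-r) 0 hr' 0)
        refine (norm_add_le _ _).trans (add_le_add h1 ?_)
        rw [norm_smul, Real.norm_eq_abs, abs_of_pos (by push Not at hθ; linarith)]
        have := θ.2.2
        have := norm_nonneg v
        nlinarith
    apply Vw_le hr
    intro θ
    have hyθ : ‖y θ‖ ≤ ‖y‖ := y.norm_coe_le_norm θ
    have h1 : ‖h • y θ‖ ≤ h * ‖y‖ := by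
      rw [norm_smul, Real.norm_eq_abs, abs_of_pos hh]; gcongr
    have h2 : W (Ehist h x v θ + h • y θ) ≤ W (Ehist h x v θ) + L * (h * ‖y‖) := by
      have := hL (Ehist h x v θ + h • y θ) (Ehist h x v θ) (by
        refine (norm_add_le _ _).trans (add_le_add (hEn θ) (h1.trans ?_))
        nlinarith [norm_nonneg y]) (by linarith [hEn θ])
      rw [add_sub_cancel_left] at this
      have := (le_abs_self _).trans this
      have := mul_le_mul_of_nonneg_left h1 hL0
      linarith
    have h3 : Real.exp (2 * σ * (θ : ℝ)) * W (Ehist h x v θ) ≤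
        Real.exp (-(2 * σ * h)) * (Vx + h * (c + ε)) := by
      rw [hEapp]
      have hexp : Real.exp (2 * σ * (θ : ℝ)) =
          Real.exp (-(2 * σ * h)) * Real.exp (2 * σ * ((θ : ℝ) + h)) := by
        rw [← Real.exp_add]; congr 1; ring
      rw [hexp, mul_assoc]
      apply mul_le_mul_of_nonneg_left _ (Real.exp_pos _).le
      split_ifs with hθ
      · have hmem : (θ : ℝ) + h ∈ Icc (-r) (0:ℝ) := ⟨by linarith [θ.2.1], by linarith⟩
        rw [projIcc_of_mem hr' hmem]
        have := Vw_le_apply σ W hW.continuous x ⟨(θ : ℝ) + h, hmem⟩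
        have h5 : 0 ≤ h * (c + ε) := by positivity
        simp only at this
        linarith
      · push Not at hθ
        rw [hp0]
        have := hs ((θ : ℝ) + h) (by linarith) (by linarith [θ.2.2])
        refine this.trans ?_
        have h5 : 0 ≤ c + ε := by positivity
        have := θ.2.2
        nlinarith
    have h4 := aux_exp_le_one hσ θ
    have h5 := Real.exp_pos (2 * σ * (θ : ℝ))
    have h7 : 0 ≤ L * (h * ‖y‖) := by positivity
    show Real.exp (2 * σ * (θ : ℝ)) * W (Ehist h x v θ + h • y θ) ≤ _
    calc Real.exp (2 * σ * (θ : ℝ)) * W (Ehist h x v θ + h • y θ)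
        ≤ Real.exp (2 * σ * (θ : ℝ)) * (W (Ehist h x v θ) + L * (h * ‖y‖)) := by gcongr
      _ ≤ _ := by nlinarith
  -- conclude
  apply EReal.le_of_forall_lt_iff_le.1
  intro z hz
  have hz' : -(2 * σ) * Vx + c < z := by exact_mod_cast hz
  set ε := (z - (-(2 * σ) * Vx + c)) / 4 with hε
  have hεp : 0 < ε := by rw [hε]; linarith
  obtain ⟨h₀, hh₀, hh⟩ := hup ε hεp
  have hder2 : HasDerivAt (fun h : ℝ => Real.exp (-(2 * σ * h)) * (Vx + h * (c + ε)))
      (-(2 * σ) * Vx + (c + ε)) 0 := by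
    have h1 : HasDerivAt (fun s : ℝ => Real.exp (-(2 * σ * s))) (-(2 * σ)) 0 := by
      have := (((hasDerivAt_id (0:ℝ)).const_mul (2 * σ)).neg).exp
      simpa using this
    have h2 : HasDerivAt (fun s : ℝ => Vx + s * (c + ε)) (c + ε) 0 := by
      simpa using ((hasDerivAt_id (0:ℝ)).mul_const (c + ε)).const_add Vx
    refine ((h1.mul h2).congr_deriv ?_)
    simp
  have hlim := hder2.hasDerivWithinAt (s := Ioi 0)
  rw [hasDerivWithinAt_iff_tendsto_slope' (by simp)] at hlim
  have hev := hlim.eventually (eventually_lt_nhds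
    (show -(2 * σ) * Vx + (c + ε) < -(2 * σ) * Vx + (c + 2 * ε) by linarith))
  refine Filter.limsup_le_of_le (by isBoundedDefault) ?_
  have hy : ∀ᶠ y : Hist N r in 𝓝 0, ‖y‖ < min 1 (ε / (L + 1)) := by
    have : Metric.ball (0 : Hist N r) (min 1 (ε / (L + 1))) ∈ 𝓝 0 :=
      Metric.ball_mem_nhds _ (by positivity)
    filter_upwards [this] with y hy
    simpa using hy
  have hh0ev : ∀ᶠ h in 𝓝[>] (0:ℝ), h ≤ h₀ :=
    nhdsWithin_le_nhds (eventually_le_nhds hh₀)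
  filter_upwards [((hev.and self_mem_nhdsWithin).and hh0ev).prod_mk hy] with p hp
  obtain ⟨⟨⟨hp1, hp2⟩, hp3⟩, hp4⟩ := hp
  have hp2' : 0 < p.1 := hp2
  have hy1 : ‖p.2‖ < 1 := hp4.trans_le (min_le_left _ _)
  have hy2 : ‖p.2‖ < ε / (L + 1) := hp4.trans_le (min_le_right _ _)
  have hmain := hh p.1 hp2' hp3 p.2 hy1.le
  rw [slope_def_field, div_lt_iff₀ (by simpa using hp2')] at hp1
  simp at hp1
  have hLy : L * ‖p.2‖ ≤ ε := by
    rw [lt_div_iff₀ (by positivity)] at hy2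
    nlinarith [norm_nonneg p.2]
  have hle : (Vw σ W (Ehist p.1 x v + p.1 • p.2) - Vx) / p.1 ≤ z := by
    rw [div_le_iff₀ hp2']
    have e1 : z = -(2 * σ) * Vx + c + 4 * ε := by rw [hε]; ring
    rw [e1]
    nlinarith
  exact_mod_cast hle

theorem Vw_dini0 {N : ℕ} {r : ℝ} (hr : 0 < r) {σ : ℝ} (hσ : 0 < σ) (W : Euc N → ℝ)
    (hW : ContDiff ℝ (⊤ : ℕ∞) W) (hn : ∀ ξ, 0 ≤ W ξ) (x : Hist N r) (v : Euc N)
    (hmax : W (x (zeroIcc hr)) = Vw σ W x →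
      fderiv ℝ W (x (zeroIcc hr)) v ≤ -(2 * σ) * W (x (zeroIcc hr))) :
    diniH0 (fun (x : Hist N r) => Vw σ W x) x v ≤ ((-(2 * σ) * Vw σ W x : ℝ) : EReal) := by
  have h := Vw_dini hr hσ W hW hn x v 0 le_rfl (by simpa using hmax) 0
  rw [add_zero] at h
  refine le_trans ?_ h
  unfold diniH0 diniH
  have htend : Tendsto (fun h : ℝ => (h, (0 : Hist N r))) (𝓝[>] (0:ℝ)) ((𝓝[>] (0:ℝ)) ×ˢ 𝓝 0) :=
    tendsto_id.prodMk tendsto_const_nhds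
  have hl := Filter.limsup_le_limsup_of_le htend (u := fun p : ℝ × Hist N r =>
      (((Vw σ W (Ehist p.1 x v + p.1 • p.2) - Vw σ W x) / p.1 : ℝ) : EReal))
      (by isBoundedDefault) (by isBoundedDefault)
  refine le_trans (le_of_eq ?_) hl
  rw [Filter.limsup, Filter.limsup, Filter.map_map]
  congr 2
  funext h
  have : h • (0 : Hist N r) = 0 :=
    ContinuousMap.ext fun θ => by
      rw [ContinuousMap.smul_apply, ContinuousMap.zero_apply, smul_zero]
  simp only [Function.comp, this, add_zero]


/-- The history map T_r(t)x of a continuous curve. -/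
def histOf {N : ℕ} {r : ℝ} (x : C(ℝ, Euc N)) (t : ℝ) : Hist N r :=
  ⟨fun θ => x (t + θ), by fun_prop⟩

theorem histOf_apply {N : ℕ} {r : ℝ} (x : C(ℝ, Euc N)) (t : ℝ) (θ : Icc (-r) (0:ℝ)) :
    (histOf x t : Hist N r) θ = x (t + θ) := rfl

theorem histOf_continuous {N : ℕ} {r : ℝ} (x : C(ℝ, Euc N)) :
    Continuous (fun t => (histOf x t : Hist N r)) :=
  (ContinuousMap.curry (⟨fun p : ℝ × Icc (-r) (0:ℝ) => x (p.1 + p.2), by fun_prop⟩ :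
    C(ℝ × Icc (-r) (0:ℝ), Euc N))).continuous

theorem aux_rhs_integrable {N l : ℕ} {r : ℝ} {D : Set (Euc l)} (hD : IsCompact D)
    (F : ℝ → Euc l → Hist N r → Euc N)
    (hF : ContinuousOn (fun p : ℝ × Euc l × Hist N r => F p.1 p.2.1 p.2.2) (Ici 0 ×ˢ D ×ˢ univ))
    (d : ℝ → Euc l) (hd : InMD D d) (x : C(ℝ, Euc N)) {a b : ℝ} (ha : 0 ≤ a) :
    IntegrableOn (fun s => F s (d s) (histOf x s)) (Icc a b) := by
  letI : MeasurableSpace (Hist N r) := borel _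
  haveI : BorelSpace (Hist N r) := ⟨rfl⟩
  have hmeas : Measurable (fun s => F (max s 0) (d s) (histOf x s)) := by
    have h1 : Continuous ((Ici (0:ℝ) ×ˢ D ×ˢ (univ : Set (Hist N r))).restrict
      (fun p : ℝ × Euc l × Hist N r => F p.1 p.2.1 p.2.2)) := hF.restrict
    have h2 : Measurable (fun s : ℝ => ((max s 0, d s, histOf x s) : ℝ × Euc l × Hist N r)) :=
      (measurable_id.max measurable_const).prodMk
        (hd.1.prodMk (histOf_continuous x).measurable)
    have h3 : Measurable (fun s : ℝ => (⟨(max s 0, d s, histOf x s),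
        ⟨mem_Ici.2 (le_max_right _ _), hd.2 s, mem_univ _⟩⟩ : (Ici (0:ℝ) ×ˢ D ×ˢ (univ : Set (Hist N r))))) :=
      h2.subtype_mk
    exact h1.measurable.comp h3
  have hK : IsCompact ((Icc a b) ×ˢ D ×ˢ ((fun t => (histOf x t : Hist N r)) '' Icc a b)) :=
    isCompact_Icc.prod (hD.prod (isCompact_Icc.image (histOf_continuous x)))
  obtain ⟨C, hC⟩ := hK.exists_bound_of_continuousOn (hF.mono (by
    rintro ⟨t, e, y⟩ ⟨ht, he, _⟩
    exact ⟨ha.trans ht.1, he, mem_univ _⟩))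
  have hbd : IntegrableOn (fun s => F (max s 0) (d s) (histOf x s)) (Icc a b) := by
    apply Measure.integrableOn_of_bounded (M := C) (by simp) hmeas.aestronglyMeasurable
    filter_upwards [ae_restrict_mem measurableSet_Icc] with s hs
    have : max s 0 = s := max_eq_left (ha.trans hs.1)
    rw [this]
    exact hC (s, d s, histOf x s) ⟨hs, hd.2 s, ⟨s, hs, rfl⟩⟩
  refine hbd.congr_fun (fun s hs => ?_) measurableSet_Icc
  have : max s 0 = s := max_eq_left (ha.trans hs.1)
  simp only [this]

theorem aux_rhs_ii {N l : ℕ} {r : ℝ} {D : Set (Euc l)} (hD : IsCompact D)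
    (F : ℝ → Euc l → Hist N r → Euc N)
    (hF : ContinuousOn (fun p : ℝ × Euc l × Hist N r => F p.1 p.2.1 p.2.2) (Ici 0 ×ˢ D ×ˢ univ))
    (d : ℝ → Euc l) (hd : InMD D d) (x : C(ℝ, Euc N)) {a b : ℝ} (ha : 0 ≤ a) (hab : a ≤ b) :
    IntervalIntegrable (fun s => F s (d s) (histOf x s)) volume a b := by
  rw [intervalIntegrable_iff_integrableOn_Icc_of_le hab]
  exact aux_rhs_integrable hD F hF d hd x ha

theorem aux_step_integral (K M a t : ℝ) (j : ℕ) :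
    ∫ s in a..t, K * (M * (K * (s - a)) ^ j / (j.factorial : ℝ)) =
      M * (K * (t - a)) ^ (j + 1) / ((j + 1).factorial : ℝ) := by
  have h1 : ∀ s ∈ uIcc a t, HasDerivAt
      (fun s => M * (K * (s - a)) ^ (j + 1) / ((j + 1).factorial : ℝ))
      (K * (M * (K * (s - a)) ^ j / (j.factorial : ℝ))) s := by
    intro s _
    have h := ((((hasDerivAt_id s).sub_const a).const_mul K).pow (j + 1)).const_mul M |>.div_const
      ((j + 1).factorial : ℝ)
    refine h.congr_deriv ?_
    have : ((j.factorial : ℕ) : ℝ) ≠ 0 := by exact_mod_cast j.factorial_ne_zero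
    have h2 : ((j : ℝ) + 1) ≠ 0 := by positivity
    rw [Nat.factorial_succ]
    push_cast
    simp only [id, Nat.add_sub_cancel]
    field_simp
  rw [intervalIntegral.integral_eq_sub_of_hasDerivAt h1]
  · simp
  · apply Continuous.intervalIntegrable; fun_prop

theorem aux_step {N : ℕ} (F1 F2 : ℝ → Euc N) (K M a t : ℝ) (hat : a ≤ t) (j : ℕ)
    (h1 : IntervalIntegrable F1 volume a t) (h2 : IntervalIntegrable F2 volume a t)
    (h : ∀ s ∈ Icc a t, ‖F1 s - F2 s‖ ≤ K * (M * (K * (s - a)) ^ j / (j.factorial : ℝ))) :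
    ‖(∫ s in a..t, F1 s) - ∫ s in a..t, F2 s‖ ≤
      M * (K * (t - a)) ^ (j + 1) / ((j + 1).factorial : ℝ) := by
  rw [← intervalIntegral.integral_sub h1 h2, ← aux_step_integral]
  apply intervalIntegral.norm_integral_le_of_norm_le hat
  · exact Eventually.of_forall fun s hs => h s ⟨hs.1.le, hs.2⟩
  · apply Continuous.intervalIntegrable; fun_prop

theorem aux_step_mono {K M a s s' : ℝ} (hK : 0 ≤ K) (hM : 0 ≤ M) (j : ℕ) (h0 : a ≤ s)
    (h : s ≤ s') : M * (K * (s - a)) ^ j / (j.factorial : ℝ) ≤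
      M * (K * (s' - a)) ^ j / (j.factorial : ℝ) := by
  have : 0 ≤ s - a := by linarith
  gcongr

theorem aux_step_tendsto (K M a t : ℝ) :
    Tendsto (fun j : ℕ => M * (K * (t - a)) ^ j / (j.factorial : ℝ)) atTop (𝓝 0) := by
  have := (FloorSemiring.tendsto_pow_div_factorial_atTop (K * (t - a))).const_mul M
  simpa [mul_div_assoc] using this

/-- Uniqueness of solutions. -/
theorem aux_unique {N l : ℕ} {r : ℝ} {D : Set (Euc l)} (hD : IsCompact D)
    (F : ℝ → Euc l → Hist N r → Euc N)
    (hF : ContinuousOn (fun p : ℝ × Euc l × Hist N r => F p.1 p.2.1 p.2.2) (Ici 0 ×ˢ D ×ˢ univ))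
    (hlip : ∀ T, 0 ≤ T → ∀ R, 0 ≤ R → ∃ L, ∀ t ∈ Icc (0:ℝ) T, ∀ d ∈ D, ∀ x y : Hist N r,
      ‖x‖ ≤ R → ‖y‖ ≤ R → ‖F t d x - F t d y‖ ≤ L * ‖x - y‖)
    (d : ℝ → Euc l) (hd : InMD D d) (t₀ T : ℝ) (ht₀ : 0 ≤ t₀) (hT : t₀ ≤ T)
    (x y : C(ℝ, Euc N))
    (hxy : ∀ s ∈ Icc (t₀ - r) t₀, x s = y s)
    (hx : ∀ t ∈ Icc t₀ T, x t = x t₀ + ∫ s in t₀..t, F s (d s) (histOf x s))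
    (hy : ∀ t ∈ Icc t₀ T, y t = y t₀ + ∫ s in t₀..t, F s (d s) (histOf y s)) (hr : 0 < r) :
    ∀ s ∈ Icc (t₀ - r) T, x s = y s := by
  obtain ⟨Rx, hRx⟩ := (isCompact_Icc (a := t₀ - r) (b := T)).exists_bound_of_continuousOn
    x.continuous.continuousOn
  obtain ⟨Ry, hRy⟩ := (isCompact_Icc (a := t₀ - r) (b := T)).exists_bound_of_continuousOn
    y.continuous.continuousOn
  set R := max (max Rx Ry) 0 with hR
  have hR0 : 0 ≤ R := le_max_right _ _
  have hx' : ∀ s ∈ Icc (t₀ - r) T, ‖x s‖ ≤ R := fun s hs =>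
    (hRx s hs).trans ((le_max_left _ _).trans (le_max_left _ _))
  have hy' : ∀ s ∈ Icc (t₀ - r) T, ‖y s‖ ≤ R := fun s hs =>
    (hRy s hs).trans ((le_max_right _ _).trans (le_max_left _ _))
  obtain ⟨L, hL⟩ := hlip T (ht₀.trans hT) R hR0
  set K := max L 0 with hK
  have hK0 : 0 ≤ K := le_max_right _ _
  have hx0 : x t₀ = y t₀ := hxy t₀ ⟨by linarith, le_rfl⟩
  have hmem : ∀ s ∈ Icc t₀ T, ∀ θ : Icc (-r) (0:ℝ), s + (θ : ℝ) ∈ Icc (t₀ - r) T := fun s hs θ =>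
    ⟨by linarith [hs.1, θ.2.1], by linarith [hs.2, θ.2.2]⟩
  have key : ∀ j : ℕ, ∀ s ∈ Icc t₀ T,
      ‖x s - y s‖ ≤ (2 * R) * (K * (s - t₀)) ^ j / (j.factorial : ℝ) := by
    intro j
    induction j with
    | zero =>
      intro s hs
      have hs' : s ∈ Icc (t₀ - r) T := ⟨by linarith [hs.1], hs.2⟩
      have := norm_sub_le (x s) (y s)
      have := hx' s hs'
      have := hy' s hs'
      simp; linarith
    | succ j ih =>
      intro t ht
      rw [hx t ht, hy t ht, hx0, add_sub_add_left_eq_sub]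
      apply aux_step _ _ K (2 * R) t₀ t ht.1 j
      · exact aux_rhs_ii hD F hF d hd x ht₀ ht.1
      · exact aux_rhs_ii hD F hF d hd y ht₀ ht.1
      intro s hs
      have hsT : s ∈ Icc t₀ T := ⟨hs.1, hs.2.trans ht.2⟩
      have hpos : 0 ≤ 2 * R * (K * (s - t₀)) ^ j / (j.factorial : ℝ) := by
        have : 0 ≤ s - t₀ := by linarith [hs.1]
        positivity
      have h1 : ‖(histOf x s : Hist N r) - histOf y s‖ ≤
          2 * R * (K * (s - t₀)) ^ j / (j.factorial : ℝ) := by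
        rw [ContinuousMap.norm_le _ hpos]
        intro θ
        show ‖x (s + θ) - y (s + θ)‖ ≤ _
        by_cases hc : s + (θ : ℝ) ≤ t₀
        · rw [hxy _ ⟨(hmem s hsT θ).1, hc⟩]; simpa using hpos
        · push Not at hc
          exact (ih _ ⟨hc.le, (hmem s hsT θ).2⟩).trans
            (aux_step_mono hK0 (by positivity) j hc.le (by linarith [θ.2.2]))
      have h2 := hL s ⟨ht₀.trans hs.1, hsT.2⟩ (d s) (hd.2 s) (histOf x s) (histOf y s)
        ((ContinuousMap.norm_le _ hR0).2 fun θ => hx' _ (hmem s hsT θ))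
        ((ContinuousMap.norm_le _ hR0).2 fun θ => hy' _ (hmem s hsT θ))
      calc _ ≤ L * ‖(histOf x s : Hist N r) - histOf y s‖ := h2
        _ ≤ K * ‖(histOf x s : Hist N r) - histOf y s‖ := by
          gcongr; exact le_max_left _ _
        _ ≤ _ := by gcongr
  intro s hs
  by_cases hc : s ≤ t₀
  · exact hxy s ⟨hs.1, hc⟩
  · push Not at hc
    have := ge_of_tendsto' (aux_step_tendsto K (2 * R) t₀ s) (fun j => key j s ⟨hc.le, hs.2⟩)
    rw [norm_le_zero_iff, sub_eq_zero] at this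
    exact this

/-- Existence on a compact interval for globally Lipschitz right-hand sides. -/
theorem aux_exists_local {N l : ℕ} {r : ℝ} (hr : 0 < r) {D : Set (Euc l)} (hD : IsCompact D)
    (F : ℝ → Euc l → Hist N r → Euc N)
    (hF : ContinuousOn (fun p : ℝ × Euc l × Hist N r => F p.1 p.2.1 p.2.2) (Ici 0 ×ˢ D ×ˢ univ))
    (d : ℝ → Euc l) (hd : InMD D d) (t₀ T : ℝ) (ht₀ : 0 ≤ t₀) (hT : t₀ ≤ T)
    (K : ℝ) (hK0 : 0 ≤ K)
    (hlip : ∀ t ∈ Icc (0:ℝ) T, ∀ d ∈ D, ∀ x y : Hist N r, ‖F t d x - F t d y‖ ≤ K * ‖x - y‖)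
    (x₀ : Hist N r) :
    ∃ x : C(ℝ, Euc N), (∀ θ : Icc (-r) (0:ℝ), x (t₀ + θ) = x₀ θ) ∧
      ∀ t ∈ Icc t₀ T, x t = x t₀ + ∫ s in t₀..t, F s (d s) (histOf x s) := by
  have hr' : -r ≤ 0 := by linarith
  let xh : C(Icc t₀ T, Euc N) → C(ℝ, Euc N) := fun y =>
    ⟨fun s => x₀ (projIcc (-r) 0 hr' (s - t₀)) + y (projIcc t₀ T hT s), by
      apply Continuous.add
      · exact x₀.continuous.comp (continuous_projIcc.comp (by fun_prop))
      · exact y.continuous.comp continuous_projIcc⟩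
  have hxh : ∀ y s, xh y s = x₀ (projIcc (-r) 0 hr' (s - t₀)) + y (projIcc t₀ T hT s) :=
    fun _ _ => rfl
  let P : C(Icc t₀ T, Euc N) → C(Icc t₀ T, Euc N) := fun y =>
    ⟨fun t => ∫ s in t₀..(t : ℝ), F s (d s) (histOf (xh y) s), by
      have h := intervalIntegral.continuousOn_primitive_interval (μ := volume) (a := t₀) (b := T)
        (f := fun s => F s (d s) (histOf (xh y) s)) (by
          rw [uIcc_of_le hT]
          exact aux_rhs_integrable hD F hF d hd (xh y) ht₀)
      rw [uIcc_of_le hT] at h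
      exact h.restrict⟩
  have hP : ∀ y t, P y t = ∫ s in t₀..(t : ℝ), F s (d s) (histOf (xh y) s) := fun _ _ => rfl
  have key : ∀ (y y' : C(Icc t₀ T, Euc N)) (j : ℕ), ∀ t : Icc t₀ T,
      ‖(P^[j] y) t - (P^[j] y') t‖ ≤ ‖y - y'‖ * (K * ((t : ℝ) - t₀)) ^ j / (j.factorial : ℝ) := by
    intro y y' j
    induction j with
    | zero =>
      intro t
      simpa using (y - y').norm_coe_le_norm t
    | succ j ih =>
      intro t
      rw [Function.iterate_succ_apply', Function.iterate_succ_apply', hP, hP]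
      apply aux_step _ _ K _ t₀ t t.2.1 j
      · exact aux_rhs_ii hD F hF d hd _ ht₀ t.2.1
      · exact aux_rhs_ii hD F hF d hd _ ht₀ t.2.1
      intro s hs
      have hpos : 0 ≤ ‖y - y'‖ * (K * (s - t₀)) ^ j / (j.factorial : ℝ) := by
        have : 0 ≤ s - t₀ := by linarith [hs.1]
        positivity
      refine (hlip s ⟨ht₀.trans hs.1, hs.2.trans t.2.2⟩ (d s) (hd.2 s) _ _).trans ?_
      refine mul_le_mul_of_nonneg_left ?_ hK0
      rw [ContinuousMap.norm_le _ hpos]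
      intro θ
      show ‖xh (P^[j] y) (s + θ) - xh (P^[j] y') (s + θ)‖ ≤ _
      rw [hxh, hxh, add_sub_add_left_eq_sub]
      refine (ih _).trans (aux_step_mono hK0 (norm_nonneg _) j (projIcc t₀ T hT _).2.1 ?_)
      rw [coe_projIcc]
      exact max_le hs.1 ((min_le_right _ _).trans (by linarith [θ.2.2]))
  obtain ⟨j, hj⟩ := ((aux_step_tendsto K 1 t₀ T).eventually
    (eventually_lt_nhds (show (0:ℝ) < 1 by norm_num))).exists
  have hTpos : 0 ≤ T - t₀ := by linarith
  have hC0 : 0 ≤ 1 * (K * (T - t₀)) ^ j / (j.factorial : ℝ) := by positivity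
  have hcon : ContractingWith (Real.toNNReal (1 * (K * (T - t₀)) ^ j / (j.factorial : ℝ)))
      (P^[j]) := by
    constructor
    · rw [← NNReal.coe_lt_coe, Real.coe_toNNReal _ hC0]; exact_mod_cast hj
    · apply LipschitzWith.of_dist_le_mul
      intro y y'
      rw [Real.coe_toNNReal _ hC0, dist_eq_norm, dist_eq_norm,
        ContinuousMap.norm_le _ (by positivity)]
      intro t
      refine (key y y' j t).trans ((aux_step_mono hK0 (norm_nonneg _) j t.2.1 t.2.2).trans
        (le_of_eq (by ring)))
  haveI : Nonempty C(Icc t₀ T, Euc N) := ⟨0⟩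
  have hfix := hcon.isFixedPt_fixedPoint_iterate
  set y := ContractingWith.fixedPoint (P^[j]) hcon with hy
  have hfix' : P y = y := hfix
  have hyt : ∀ t : Icc t₀ T, y t = ∫ s in t₀..(t : ℝ), F s (d s) (histOf (xh y) s) := by
    intro t
    conv_lhs => rw [← hfix']
    rfl
  have hy0 : y ⟨t₀, le_rfl, hT⟩ = 0 := by rw [hyt]; simp
  have hpr : ∀ s, s ≤ t₀ → projIcc t₀ T hT s = ⟨t₀, le_rfl, hT⟩ := fun s hs =>
    projIcc_of_le_left hT hs
  have hpr2 : ∀ s, t₀ ≤ s → projIcc (-r) 0 hr' (s - t₀) = ⟨0, hr', le_rfl⟩ := fun s hs =>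
    projIcc_of_right_le hr' (by linarith)
  refine ⟨xh y, fun θ => ?_, fun t ht => ?_⟩
  · rw [hxh, hpr _ (by linarith [θ.2.2]), hy0, add_zero, add_sub_cancel_left, projIcc_val]
  · rw [hxh, hxh y t₀, hpr t₀ le_rfl, hy0, hpr2 t ht.1, hpr2 t₀ le_rfl, add_zero,
      projIcc_of_mem hT ht, hyt]

/-- Global existence. -/
theorem aux_exists_global {N l : ℕ} {r : ℝ} (hr : 0 < r) {D : Set (Euc l)} (hD : IsCompact D)
    (F : ℝ → Euc l → Hist N r → Euc N)
    (hF : ContinuousOn (fun p : ℝ × Euc l × Hist N r => F p.1 p.2.1 p.2.2) (Ici 0 ×ˢ D ×ˢ univ))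
    (d : ℝ → Euc l) (hd : InMD D d) (t₀ : ℝ) (ht₀ : 0 ≤ t₀)
    (hlip : ∀ T, 0 ≤ T → ∃ K, 0 ≤ K ∧ ∀ t ∈ Icc (0:ℝ) T, ∀ d ∈ D, ∀ x y : Hist N r,
      ‖F t d x - F t d y‖ ≤ K * ‖x - y‖)
    (x₀ : Hist N r) :
    ∃ x : C(ℝ, Euc N), (∀ θ : Icc (-r) (0:ℝ), x (t₀ + θ) = x₀ θ) ∧
      ∀ t, t₀ ≤ t → x t = x t₀ + ∫ s in t₀..t, F s (d s) (histOf x s) := by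
  have hr' : -r ≤ 0 := by linarith
  have hex : ∀ m : ℕ, ∃ x : C(ℝ, Euc N), (∀ θ : Icc (-r) (0:ℝ), x (t₀ + θ) = x₀ θ) ∧
      ∀ t ∈ Icc t₀ (t₀ + m), x t = x t₀ + ∫ s in t₀..t, F s (d s) (histOf x s) := by
    intro m
    have hm : (0:ℝ) ≤ m := Nat.cast_nonneg m
    obtain ⟨K, hK0, hK⟩ := hlip (t₀ + m) (by positivity)
    exact aux_exists_local hr hD F hF d hd t₀ (t₀ + m) ht₀ (by linarith) K hK0 hK x₀
  choose X hX0 hX using hex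
  have hagree : ∀ m m' : ℕ, m ≤ m' → ∀ s ∈ Icc (t₀ - r) (t₀ + m), X m s = X m' s := by
    intro m m' hm
    have hm0 : (0:ℝ) ≤ m := Nat.cast_nonneg m
    have hmm : (m : ℝ) ≤ m' := by exact_mod_cast hm
    apply aux_unique hD F hF (fun T hT R _ => by
      obtain ⟨K, _, hK⟩ := hlip T hT
      exact ⟨K, fun t ht e he x y _ _ => hK t ht e he x y⟩) d hd t₀ (t₀ + m) ht₀
      (by linarith) (X m) (X m') _ (hX m) _ hr
    · intro s hs
      have h1 := hX0 m ⟨s - t₀, by linarith [hs.1], by linarith [hs.2]⟩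
      have h2 := hX0 m' ⟨s - t₀, by linarith [hs.1], by linarith [hs.2]⟩
      simp only [add_sub_cancel] at h1 h2
      rw [h1, h2]
    · intro t ht
      exact hX m' t ⟨ht.1, ht.2.trans (by linarith)⟩
  -- glue
  let xg : ℝ → Euc N := fun s => X ⌈max s t₀ - t₀⌉₊ (max s (t₀ - r))
  have hxg : ∀ m : ℕ, ∀ s, s ≤ t₀ + m → xg s = X m (max s (t₀ - r)) := by
    intro m s hs
    have hm0 : (0:ℝ) ≤ m := Nat.cast_nonneg m
    apply hagree
    · apply Nat.ceil_le.2
      have : max s t₀ ≤ t₀ + m := max_le hs (by linarith)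
      linarith
    · have h1 := Nat.le_ceil (max s t₀ - t₀)
      refine ⟨le_max_right _ _, max_le ?_ ?_⟩
      · linarith [le_max_left s t₀]
      · linarith [le_max_right s t₀]
  have hcont : Continuous xg := by
    rw [continuous_iff_continuousAt]
    intro s
    have h1 : Continuous fun u => X (⌈max s t₀ - t₀⌉₊ + 1) (max u (t₀ - r)) := by fun_prop
    refine h1.continuousAt.congr ?_
    have h2 : ∀ᶠ u in 𝓝 s, u < s + 1 := eventually_lt_nhds (by linarith)
    filter_upwards [h2] with u hu
    refine (hxg _ u ?_).symm
    have := Nat.le_ceil (max s t₀ - t₀)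
    push_cast
    linarith [le_max_left s t₀]
  refine ⟨⟨xg, hcont⟩, fun θ => ?_, fun t ht => ?_⟩
  · show xg (t₀ + θ) = _
    rw [hxg 0 _ (by simpa using θ.2.2), max_eq_left (by linarith [θ.2.1])]
    exact hX0 0 θ
  · obtain ⟨m, hm⟩ := exists_nat_ge (t - t₀)
    have hm0 : (0:ℝ) ≤ m := Nat.cast_nonneg m
    show xg t = xg t₀ + _
    rw [hxg m t (by linarith), hxg m t₀ (by linarith), max_eq_left (by linarith),
      max_eq_left (by linarith), hX m t ⟨ht, by linarith⟩]
    congr 1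
    apply intervalIntegral.integral_congr
    intro s hs
    rw [uIcc_of_le ht] at hs
    have : (histOf (X m) s : Hist N r) = histOf ⟨xg, hcont⟩ s := by
      ext1 θ
      show X m (s + θ) = xg (s + θ)
      rw [hxg m _ (by linarith [θ.2.2, hs.2]), max_eq_left (by linarith [θ.2.1, hs.1])]
    simp only [this]


/-- Right upper Dini estimate for W along a solution. -/
theorem aux_right_dini {N l : ℕ} {r : ℝ} {D : Set (Euc l)} (hD : IsCompact D)
    (F : ℝ → Euc l → Hist N r → Euc N)
    (hF : ContinuousOn (fun p : ℝ × Euc l × Hist N r => F p.1 p.2.1 p.2.2) (Ici 0 ×ˢ D ×ˢ univ))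
    (d : ℝ → Euc l) (hd : InMD D d) (t₀ t₁ : ℝ) (ht₀ : 0 ≤ t₀) (ht₁ : t₀ ≤ t₁)
    (x : C(ℝ, Euc N))
    (hx : ∀ t, t₀ ≤ t → x t = x t₀ + ∫ s in t₀..t, F s (d s) (histOf x s))
    (W : Euc N → ℝ) (hW : DifferentiableAt ℝ W (x t₁)) (q : ℝ)
    (hq : ∀ e ∈ D, fderiv ℝ W (x t₁) (F t₁ e (histOf x t₁)) ≤ q) (η : ℝ) (hη : 0 < η) :
    ∀ᶠ z in 𝓝[>] t₁, W (x z) ≤ W (x t₁) + (z - t₁) * (q + η) := by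
  have h01 : 0 ≤ t₁ := ht₀.trans ht₁
  have hK : IsCompact ((Icc t₁ (t₁ + 1)) ×ˢ D ×ˢ
      ((fun t => (histOf x t : Hist N r)) '' Icc t₁ (t₁ + 1))) :=
    isCompact_Icc.prod (hD.prod (isCompact_Icc.image (histOf_continuous x)))
  obtain ⟨C, hC⟩ := hK.exists_bound_of_continuousOn (hF.mono (by
    rintro ⟨t, e, y⟩ ⟨ht, he, _⟩
    exact ⟨h01.trans ht.1, he, mem_univ _⟩))
  set C' := max C 0 + 1 with hC'
  have hC'pos : 0 < C' := by have := le_max_right C 0; linarith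
  have hdiff : ∀ z, t₁ ≤ z → x z - x t₁ = ∫ s in t₁..z, F s (d s) (histOf x s) := by
    intro z hz
    rw [hx z (ht₁.trans hz), hx t₁ ht₁, add_sub_add_left_eq_sub,
      intervalIntegral.integral_interval_sub_left
        (aux_rhs_ii hD F hF d hd x ht₀ (ht₁.trans hz)) (aux_rhs_ii hD F hF d hd x ht₀ ht₁)]
  have hΔ : ∀ z ∈ Icc t₁ (t₁ + 1), ‖x z - x t₁‖ ≤ C' * (z - t₁) := by
    intro z hz
    rw [hdiff z hz.1]
    refine (intervalIntegral.norm_integral_le_of_norm_le_const (C := C') ?_).trans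
      (by rw [abs_of_nonneg (by linarith [hz.1])])
    intro s hs
    rw [uIoc_of_le hz.1] at hs
    have hs' : s ∈ Icc t₁ (t₁ + 1) := ⟨hs.1.le, hs.2.trans hz.2⟩
    have := hC (s, d s, histOf x s) ⟨hs', hd.2 s, ⟨s, hs', rfl⟩⟩
    have h2 := le_max_left C 0
    simp only at this
    linarith
  -- the linear part
  have htube : ∀ᶠ s in 𝓝 t₁, ∀ e ∈ D, t₁ ≤ s → e ∈ D →
      fderiv ℝ W (x t₁) (F s e (histOf x s)) < q + η / 2 := by
    apply hD.eventually_forall_of_forall_eventually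
    intro e he
    have hc : ContinuousWithinAt
        (fun p : ℝ × Euc l => fderiv ℝ W (x t₁) (F p.1 p.2 (histOf x p.1)))
        (Ici 0 ×ˢ D) (t₁, e) := by
      have h1 : ContinuousWithinAt (fun p : ℝ × Euc l => F p.1 p.2 (histOf x p.1))
          (Ici 0 ×ˢ D) (t₁, e) := by
        have h2 := hF (t₁, e, histOf x t₁) ⟨h01, he, mem_univ _⟩
        have h3 : ContinuousWithinAt
            (fun p : ℝ × Euc l => ((p.1, p.2, histOf x p.1) : ℝ × Euc l × Hist N r))
            (Ici 0 ×ˢ D) (t₁, e) := by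
          apply Continuous.continuousWithinAt
          exact continuous_fst.prodMk (continuous_snd.prodMk
            ((histOf_continuous x).comp continuous_fst))
        exact ContinuousWithinAt.comp (x := (t₁, e)) (s := Ici 0 ×ˢ D)
          (f := fun p : ℝ × Euc l => ((p.1, p.2, histOf x p.1) : ℝ × Euc l × Hist N r))
          (g := fun p : ℝ × Euc l × Hist N r => F p.1 p.2.1 p.2.2)
          (t := Ici 0 ×ˢ D ×ˢ univ) h2 h3
          (fun p hp => ⟨hp.1, hp.2, mem_univ _⟩)
      exact (fderiv ℝ W (x t₁)).continuous.continuousAt.comp_continuousWithinAt h1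
    have h4 := hc.eventually_lt_const (u := q + η / 2) (by
      have := hq e he
      simp only
      linarith)
    rw [eventually_nhdsWithin_iff] at h4
    filter_upwards [h4] with p hp h5 h6
    exact hp ⟨h01.trans h5, h6⟩
  have hlin : ∀ᶠ z in 𝓝[>] t₁, fderiv ℝ W (x t₁) (x z - x t₁) ≤ (z - t₁) * (q + η / 2) := by
    obtain ⟨ε, hε, hball⟩ := Metric.eventually_nhds_iff.1 htube
    have : Ioo t₁ (t₁ + ε) ∈ 𝓝[>] t₁ := Ioo_mem_nhdsGT (by linarith)
    filter_upwards [this] with z hz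
    have hii := aux_rhs_ii hD F hF d hd x h01 hz.1.le
    rw [hdiff z hz.1.le, ← ContinuousLinearMap.intervalIntegral_comp_comm _ hii]
    have hii2 : IntervalIntegrable
        (fun s => fderiv ℝ W (x t₁) (F s (d s) (histOf x s))) volume t₁ z := by
      rw [intervalIntegrable_iff] at hii ⊢
      exact (fderiv ℝ W (x t₁)).integrable_comp hii
    have := intervalIntegral.integral_mono_on hz.1.le hii2
      (intervalIntegrable_const (c := q + η / 2)) (fun s hs => by
        refine (hball (y := s) ?_ (d s) (hd.2 s) hs.1 (hd.2 s)).le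
        rw [Real.dist_eq, abs_of_nonneg (by linarith [hs.1])]
        linarith [hs.2, hz.2])
    rw [intervalIntegral.integral_const, smul_eq_mul] at this
    exact this
  -- the remainder
  have hrem : ∀ᶠ z in 𝓝[>] t₁, ‖W (x z) - W (x t₁) - fderiv ℝ W (x t₁) (x z - x t₁)‖ ≤
      η / (2 * C') * ‖x z - x t₁‖ := by
    have h1 := hW.hasFDerivAt.isLittleO
    have h2 := h1.def (show 0 < η / (2 * C') by positivity)
    have h3 : Tendsto x (𝓝[>] t₁) (𝓝 (x t₁)) := x.continuous.continuousAt.continuousWithinAt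
    exact h3.eventually h2
  have hIoo : Ioo t₁ (t₁ + 1) ∈ 𝓝[>] t₁ := Ioo_mem_nhdsGT (by linarith)
  filter_upwards [hlin, hrem, hIoo] with z h1 h2 h3
  have h4 := hΔ z ⟨h3.1.le, h3.2.le⟩
  have h5 : η / (2 * C') * ‖x z - x t₁‖ ≤ η / 2 * (z - t₁) := by
    calc _ ≤ η / (2 * C') * (C' * (z - t₁)) := by gcongr
      _ = _ := by field_simp
  have h6 := (abs_le.1 (h2.trans h5)).2
  nlinarith

/-- The Lyapunov-Krasovskii estimate. -/
theorem aux_lyap {N l : ℕ} {r σ : ℝ} (hr : 0 < r) (hσ : 0 < σ) {D : Set (Euc l)} (hD : IsCompact D)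
    (F : ℝ → Euc l → Hist N r → Euc N)
    (hF : ContinuousOn (fun p : ℝ × Euc l × Hist N r => F p.1 p.2.1 p.2.2) (Ici 0 ×ˢ D ×ˢ univ))
    (d : ℝ → Euc l) (hd : InMD D d) (t₀ : ℝ) (ht₀ : 0 ≤ t₀)
    (x : C(ℝ, Euc N))
    (hx : ∀ t, t₀ ≤ t → x t = x t₀ + ∫ s in t₀..t, F s (d s) (histOf x s))
    (W : Euc N → ℝ) (hW : Differentiable ℝ W) (hn : ∀ ξ, 0 ≤ W ξ) (V0 : ℝ)
    (hV0 : Vw σ W (histOf x t₀ : Hist N r) ≤ V0)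
    (hstar : ∀ t, 0 ≤ t → ∀ e ∈ D, ∀ y : Hist N r, Vw σ W y ≤ V0 + 1 →
      W (y (zeroIcc hr)) = Vw σ W y →
      fderiv ℝ W (y (zeroIcc hr)) (F t e y) ≤ -(2 * σ) * W (y (zeroIcc hr))) :
    ∀ t, t₀ ≤ t → Vw σ W (histOf x t : Hist N r) ≤ Real.exp (-(2 * σ) * (t - t₀)) * V0 := by
  have hV0n : 0 ≤ V0 := (Vw_nonneg hr σ W hW.continuous hn _).trans hV0
  set u : ℝ → ℝ := fun t => Real.exp (2 * σ * (t - t₀)) * W (x t) with hu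
  have hucont : Continuous u := by
    have := hW.continuous
    fun_prop
  have hupast : ∀ s, t₀ - r ≤ s → s ≤ t₀ → u s ≤ V0 := by
    intro s h1 h2
    have := Vw_le_apply σ W hW.continuous (histOf x t₀ : Hist N r)
      ⟨s - t₀, ⟨by linarith, by linarith⟩⟩
    rw [histOf_apply] at this
    simp only [add_sub_cancel] at this
    exact this.trans hV0
  -- from bounds on u to bounds on Vw
  have hVu : ∀ t b, t₀ ≤ t → V0 ≤ b → (∀ s, t₀ ≤ s → s ≤ t → u s ≤ b) →
      Vw σ W (histOf x t : Hist N r) ≤ Real.exp (-(2 * σ) * (t - t₀)) * b := by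
    intro t b ht hb h
    apply Vw_le hr
    intro θ
    rw [histOf_apply]
    have h1 : u (t + θ) ≤ b := by
      by_cases hc : t₀ ≤ t + θ
      · exact h _ hc (by linarith [θ.2.2])
      · exact (hupast _ (by linarith [θ.2.1]) (by linarith)).trans hb
    have h2 : Real.exp (2 * σ * (θ : ℝ)) * W (x (t + θ)) =
        Real.exp (-(2 * σ) * (t - t₀)) * u (t + θ) := by
      simp only [hu]
      rw [← mul_assoc, ← Real.exp_add]
      congr 2; ring
    rw [h2]
    gcongr
  have main : ∀ T, t₀ ≤ T → ∀ δ, 0 < δ → δ * (1 + (T - t₀)) ≤ 1 → ∀ s ∈ Icc t₀ T,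
      u s ≤ V0 + δ * (1 + (s - t₀)) := by
    intro T hT δ hδ hδ1
    set B : ℝ → ℝ := fun s => V0 + δ * (1 + (s - t₀)) with hB
    have hBcont : Continuous B := by fun_prop
    set S : Set ℝ := {t | ∀ τ ∈ Icc (0:ℝ) 1, u (t₀ + τ * (t - t₀)) ≤ B (t₀ + τ * (t - t₀))} with hS
    have hScl : IsClosed S := by
      have : S = ⋂ τ ∈ Icc (0:ℝ) 1, {t | u (t₀ + τ * (t - t₀)) ≤ B (t₀ + τ * (t - t₀))} := by
        ext t; simp [hS]
      rw [this]
      exact isClosed_biInter fun τ _ => isClosed_le (by fun_prop) (by fun_prop)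
    have hSmem : ∀ t, t₀ ≤ t → (t ∈ S ↔ ∀ s, t₀ ≤ s → s ≤ t → u s ≤ B s) := by
      intro t ht
      constructor
      · intro h s h1 h2
        rcases ht.eq_or_lt with h3 | h3
        · have := h 0 ⟨le_rfl, by norm_num⟩
          have h4 : s = t₀ := by linarith
          simpa [h4] using this
        · have h5 : 0 < t - t₀ := by linarith
          have := h ((s - t₀) / (t - t₀)) ⟨div_nonneg (by linarith) h5.le,
            (div_le_one h5).2 (by linarith)⟩
          rw [div_mul_cancel₀ _ h5.ne', add_sub_cancel] at this
          exact this
      · intro h τ hτ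
        have h5 : 0 ≤ t - t₀ := by linarith
        apply h
        · have := mul_nonneg hτ.1 h5; linarith
        · have := mul_le_mul_of_nonneg_right hτ.2 h5; linarith
    have hsub : Icc t₀ T ⊆ S := by
      apply IsClosed.Icc_subset_of_forall_exists_gt (hScl.inter isClosed_Icc)
      · rw [hSmem t₀ le_rfl]
        intro s h1 h2
        have h4 : s = t₀ := by linarith
        have := hupast t₀ (by linarith) le_rfl
        rw [h4]
        simp only [hB]
        nlinarith
      · rintro t₁ ⟨h1S, h1⟩ y hy
        have hpre := (hSmem t₁ h1.1).1 h1S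
        have hev : ∀ᶠ z in 𝓝[>] t₁, u z ≤ B z := by
          rcases (hpre t₁ h1.1 le_rfl).eq_or_lt with heq | hlt
          · have hBV : V0 ≤ B t₁ := by
              simp only [hB]
              have : 0 ≤ δ * (1 + (t₁ - t₀)) := mul_nonneg hδ.le (by linarith [h1.1])
              linarith
            have hVle := hVu t₁ (B t₁) h1.1 hBV (fun s hs1 hs2 => (hpre s hs1 hs2).trans (by
              simp only [hB]; gcongr))
            have hWu : W (x t₁) = Real.exp (-(2 * σ) * (t₁ - t₀)) * B t₁ := by
              rw [← heq]; simp only [hu]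
              rw [← mul_assoc, ← Real.exp_add]
              ring_nf; simp
            have hz0 : (histOf x t₁ : Hist N r) (zeroIcc hr) = x t₁ := by
              rw [histOf_apply]; simp [zeroIcc]
            have hVeq : W (x t₁) = Vw σ W (histOf x t₁ : Hist N r) := by
              apply le_antisymm
              · have := Vw_zero_le hr σ W hW.continuous (histOf x t₁ : Hist N r)
                rwa [hz0] at this
              · rw [hWu]; exact hVle
            have hV1 : Vw σ W (histOf x t₁ : Hist N r) ≤ V0 + 1 := by
              refine hVle.trans ?_
              have e1 : Real.exp (-(2 * σ) * (t₁ - t₀)) ≤ 1 := by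
                rw [Real.exp_le_one_iff]
                nlinarith [h1.1]
              have e2 : B t₁ ≤ V0 + 1 := by
                simp only [hB]
                have : δ * (1 + (t₁ - t₀)) ≤ δ * (1 + (T - t₀)) := by
                  gcongr; exact h1.2.le
                linarith
              have := mul_le_mul_of_nonneg_right e1 (hV0n.trans hBV)
              linarith
            set κ := Real.exp (-(2 * σ) * (T - t₀)) with hκ
            have hκpos : 0 < κ := Real.exp_pos _
            have := aux_right_dini hD F hF d hd t₀ t₁ ht₀ h1.1 x hx W (hW _) (-(2 * σ) * W (x t₁))
              (fun e he => by
                have := hstar t₁ (ht₀.trans h1.1) e he (histOf x t₁) hV1 (by rw [hz0]; exact hVeq)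
                rwa [hz0] at this) (δ * κ) (by positivity)
            have hIoo : Ioo t₁ T ∈ 𝓝[>] t₁ := Ioo_mem_nhdsGT h1.2
            filter_upwards [this, hIoo] with z hz hzT
            set h := z - t₁ with hh
            have hhpos : 0 < h := by simp only [hh]; linarith [hzT.1]
            -- suffices to compare after multiplying with the exponential
            have k1 : 1 - 2 * σ * h ≤ Real.exp (-(2 * σ) * h) := by
              have := Real.add_one_le_exp (-(2 * σ) * h); linarith
            have k2 : κ ≤ Real.exp (-(2 * σ) * (z - t₀)) := by
              rw [hκ, Real.exp_le_exp]
              nlinarith [hzT.2]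
            have k3 : Real.exp (-(2 * σ) * (z - t₀)) * B z =
                Real.exp (-(2 * σ) * h) * W (x t₁) +
                  δ * h * Real.exp (-(2 * σ) * (z - t₀)) := by
              rw [hWu, ← mul_assoc, ← Real.exp_add]
              have : -(2 * σ) * h + -(2 * σ) * (t₁ - t₀) = -(2 * σ) * (z - t₀) := by
                simp only [hh]; ring
              rw [this]; simp only [hB, hh]; ring
            have k4 : W (x z) ≤ Real.exp (-(2 * σ) * (z - t₀)) * B z := by
              rw [k3]
              have a1 := mul_le_mul_of_nonneg_right k1 (hn (x t₁))
              have a2 := mul_le_mul_of_nonneg_left k2 (mul_pos hδ hhpos).le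
              nlinarith
            calc u z = Real.exp (2 * σ * (z - t₀)) * W (x z) := rfl
              _ ≤ Real.exp (2 * σ * (z - t₀)) * (Real.exp (-(2 * σ) * (z - t₀)) * B z) := by
                gcongr
              _ = B z := by
                rw [← mul_assoc, ← Real.exp_add]; ring_nf; simp
          · have := (hucont.continuousAt (x := t₁)).eventually_lt hBcont.continuousAt hlt
            exact (this.filter_mono nhdsWithin_le_nhds).mono fun z hz => hz.le
        obtain ⟨c, hc, hcsub⟩ := (mem_nhdsGT_iff_exists_Ioo_subset (a := t₁)).1 hev
        rw [mem_Ioi] at hc hy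
        obtain ⟨z, hz1, hz2⟩ := exists_between (lt_min hc hy)
        refine ⟨z, ?_, hz1, (hz2.le.trans (min_le_right _ _))⟩
        rw [hSmem z (h1.1.trans hz1.le)]
        intro s hs1 hs2
        by_cases hs : s ≤ t₁
        · exact hpre s hs1 hs
        · exact hcsub ⟨not_le.1 hs, hs2.trans_lt (hz2.trans_le (min_le_left _ _))⟩
    intro s hs
    exact (hSmem s hs.1).1 (hsub hs) s hs.1 le_rfl
  intro t ht
  apply hVu t V0 ht le_rfl
  intro s hs1 hs2
  apply le_of_forall_pos_le_add
  intro ε hε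
  have hp : 0 < 1 + (t - t₀) := by linarith
  set δ := min 1 ε / (1 + (t - t₀)) with hδ
  have hδpos : 0 < δ := div_pos (lt_min one_pos hε) hp
  have e1 : δ * (1 + (t - t₀)) = min 1 ε := div_mul_cancel₀ _ hp.ne'
  have := main t ht δ hδpos (by rw [e1]; exact min_le_left _ _) s ⟨hs1, hs2⟩
  have e2 : δ * (1 + (s - t₀)) ≤ δ * (1 + (t - t₀)) := by gcongr
  have := min_le_right 1 ε
  linarith


/-- Coordinatewise truncation. -/
def clipE {N : ℕ} (R : ℝ) (ξ : Euc N) : Euc N := WithLp.toLp 2 fun i => max (-R) (min R (ξ i))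

theorem clipE_lip {N : ℕ} (R : ℝ) (ξ η : Euc N) : ‖clipE R ξ - clipE R η‖ ≤ ‖ξ - η‖ := by
  rw [EuclideanSpace.norm_eq, EuclideanSpace.norm_eq]
  apply Real.sqrt_le_sqrt
  apply Finset.sum_le_sum
  intro i _
  have : ‖(clipE R ξ - clipE R η) i‖ ≤ ‖(ξ - η) i‖ := by
    simp only [clipE, PiLp.sub_apply, Real.norm_eq_abs]
    refine (abs_max_sub_max_le_max _ _ _ _).trans ?_
    rw [sub_self, abs_zero]
    refine max_le (abs_nonneg _) ?_
    refine (abs_min_sub_min_le_max _ _ _ _).trans ?_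
    rw [sub_self, abs_zero]
    exact max_le (abs_nonneg _) le_rfl
  gcongr

theorem clipE_bound {N : ℕ} (R : ℝ) (hR : 0 ≤ R) (ξ : Euc N) : ‖clipE R ξ‖ ≤ N * R := by
  have hNR : 0 ≤ (N : ℝ) * R := by positivity
  apply (sq_le_sq₀ (norm_nonneg _) hNR).1
  rw [EuclideanSpace.norm_sq_eq]
  have : ∀ i ∈ Finset.univ, ‖(clipE R ξ) i‖ ^ 2 ≤ R ^ 2 := by
    intro i _
    have : ‖(clipE R ξ) i‖ ≤ R := by
      simp only [clipE, Real.norm_eq_abs]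
      rw [abs_le]
      exact ⟨le_max_left _ _, max_le (by linarith) (min_le_left _ _)⟩
    gcongr
  refine (Finset.sum_le_sum this).trans ?_
  rw [Finset.sum_const, Finset.card_univ, Fintype.card_fin, nsmul_eq_mul, mul_pow]
  gcongr
  have : N ≤ N ^ 2 := Nat.le_self_pow (by norm_num) N
  exact_mod_cast this

theorem clipE_eq {N : ℕ} (R : ℝ) (ξ : Euc N) (h : ‖ξ‖ ≤ R) : clipE R ξ = ξ := by
  ext i
  have := abs_le.1 ((PiLp.norm_apply_le ξ i).trans h)
  simp only [clipE]
  rw [min_eq_right this.2, max_eq_right this.1]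

/-- Truncation of histories. -/
def clipH {N : ℕ} {r : ℝ} (R : ℝ) (x : Hist N r) : Hist N r :=
  ⟨fun θ => clipE R (x θ),
    (LipschitzWith.of_dist_le_mul (K := 1) (f := clipE (N := N) R) (fun a b => by
      rw [dist_eq_norm, dist_eq_norm]; simpa using clipE_lip R a b)).continuous.comp x.continuous⟩

theorem clipH_lip {N : ℕ} {r : ℝ} (R : ℝ) (x y : Hist N r) :
    ‖clipH R x - clipH R y‖ ≤ ‖x - y‖ := by
  rw [ContinuousMap.norm_le _ (norm_nonneg _)]
  intro θ
  exact (clipE_lip R (x θ) (y θ)).trans ((x - y).norm_coe_le_norm θ)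

theorem clipH_bound {N : ℕ} {r : ℝ} (R : ℝ) (hR : 0 ≤ R) (x : Hist N r) :
    ‖clipH R x‖ ≤ N * R := by
  rw [ContinuousMap.norm_le _ (by positivity)]
  exact fun θ => clipE_bound R hR (x θ)

theorem clipH_eq {N : ℕ} {r : ℝ} (R : ℝ) (x : Hist N r) (h : ‖x‖ ≤ R) : clipH R x = x :=
  ContinuousMap.ext fun θ => clipE_eq R (x θ) ((x.norm_coe_le_norm θ).trans h)

theorem clipH_continuous {N : ℕ} {r : ℝ} (R : ℝ) :
    Continuous (fun x : Hist N r => clipH R x) :=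
  (LipschitzWith.of_dist_le_mul (K := 1) (fun a b => by
      rw [dist_eq_norm, dist_eq_norm]; simpa using clipH_lip R a b)).continuous

theorem aux_kinf_ge {a : ℝ → ℝ} (ha : IsKinf a) (M : ℝ) :
    ∃ R, 0 ≤ R ∧ ∀ s, 0 ≤ s → a s ≤ M → s ≤ R := by
  obtain ⟨R, hR1, hR2⟩ := ((ha.2.2.2.eventually_gt_atTop M).and (eventually_ge_atTop 0)).exists
  refine ⟨R, hR2, fun s hs h => ?_⟩
  by_contra hc
  push Not at hc
  have := ha.2.1 (mem_Ici.2 hR2) (mem_Ici.2 hs) hc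
  linarith

theorem aux_kinf_pos {a : ℝ → ℝ} (ha : IsKinf a) {s : ℝ} (hs : 0 < s) : 0 < a s := by
  have := ha.2.1 (mem_Ici.2 le_rfl) (mem_Ici.2 hs.le) hs
  rwa [ha.2.2.1] at this

theorem aux_kinf_mono {a : ℝ → ℝ} (ha : IsKinf a) {s t : ℝ} (hs : 0 ≤ s) (h : s ≤ t) :
    a s ≤ a t :=
  ha.2.1.monotoneOn (mem_Ici.2 hs) (mem_Ici.2 (hs.trans h)) h

theorem aux_kinf_le {a : ℝ → ℝ} (ha : IsKinf a) {s t : ℝ} (hs : 0 ≤ s) (ht : 0 ≤ t)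
    (h : a s ≤ a t) : s ≤ t :=
  (ha.2.1.le_iff_le (mem_Ici.2 hs) (mem_Ici.2 ht)).1 h

/-- Global existence with exponential decrease of the functional. -/
theorem aux_exists_decay {N l : ℕ} {r σ : ℝ} (hr : 0 < r) (hσ : 0 < σ) {D : Set (Euc l)}
    (hD : IsCompact D) (F : ℝ → Euc l → Hist N r → Euc N)
    (hF : ContinuousOn (fun p : ℝ × Euc l × Hist N r => F p.1 p.2.1 p.2.2) (Ici 0 ×ˢ D ×ˢ univ))
    (hlip : ∀ T, 0 ≤ T → ∀ R, 0 ≤ R → ∃ L, ∀ t ∈ Icc (0:ℝ) T, ∀ d ∈ D, ∀ x y : Hist N r,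
      ‖x‖ ≤ R → ‖y‖ ≤ R → ‖F t d x - F t d y‖ ≤ L * ‖x - y‖)
    (W : Euc N → ℝ) (hW : Differentiable ℝ W) (hn : ∀ ξ, 0 ≤ W ξ)
    (a₁ : ℝ → ℝ) (ha₁ : IsKinf a₁) (hV₁ : ∀ y : Hist N r, a₁ ‖y‖ ≤ Vw σ W y)
    (hstar : ∀ t, 0 ≤ t → ∀ e ∈ D, ∀ y : Hist N r, W (y (zeroIcc hr)) = Vw σ W y →
      fderiv ℝ W (y (zeroIcc hr)) (F t e y) ≤ -(2 * σ) * W (y (zeroIcc hr)))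
    (t₀ : ℝ) (ht₀ : 0 ≤ t₀) (x₀ : Hist N r) (d : ℝ → Euc l) (hd : InMD D d) :
    ∃ x : C(ℝ, Euc N), (∀ θ : Icc (-r) (0:ℝ), x (t₀ + θ) = x₀ θ) ∧
      (∀ t, t₀ ≤ t → x t = x t₀ + ∫ s in t₀..t, F s (d s) (histOf x s)) ∧
      ∀ t, t₀ ≤ t → Vw σ W (histOf x t : Hist N r) ≤
        Real.exp (-(2 * σ) * (t - t₀)) * Vw σ W x₀ := by
  obtain ⟨R, hR0, hR⟩ := aux_kinf_ge ha₁ (Vw σ W x₀ + 1)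
  have hR' : ∀ y : Hist N r, Vw σ W y ≤ Vw σ W x₀ + 1 → clipH R y = y := fun y hy =>
    clipH_eq R y (hR _ (norm_nonneg _) ((hV₁ y).trans hy))
  have hF' : ContinuousOn (fun p : ℝ × Euc l × Hist N r => F p.1 p.2.1 (clipH R p.2.2))
      (Ici 0 ×ˢ D ×ˢ univ) := by
    have hc : ContinuousOn
        (fun p : ℝ × Euc l × Hist N r => ((p.1, p.2.1, clipH R p.2.2) : ℝ × Euc l × Hist N r))
        (Ici 0 ×ˢ D ×ˢ univ) :=
      (continuous_fst.prodMk ((continuous_fst.comp continuous_snd).prodMk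
        ((clipH_continuous R).comp (continuous_snd.comp continuous_snd)))).continuousOn
    exact ContinuousOn.comp (g := fun p : ℝ × Euc l × Hist N r => F p.1 p.2.1 p.2.2) hF hc
      (fun p hp => ⟨hp.1, hp.2.1, mem_univ _⟩)
  obtain ⟨x, hx0, hx⟩ := aux_exists_global hr hD (fun t e y => F t e (clipH R y)) hF' d hd t₀ ht₀
    (fun T hT => by
      obtain ⟨L, hL⟩ := hlip T hT (N * R) (by positivity)
      refine ⟨max L 0, le_max_right _ _, fun t ht e he y z => ?_⟩
      refine (hL t ht e he _ _ (clipH_bound R hR0 y) (clipH_bound R hR0 z)).trans ?_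
      calc _ ≤ max L 0 * ‖clipH R y - clipH R z‖ := by gcongr; exact le_max_left _ _
        _ ≤ _ := by gcongr; exact clipH_lip R y z) x₀
  have hh0 : (histOf x t₀ : Hist N r) = x₀ := ContinuousMap.ext fun θ => hx0 θ
  have hdec := aux_lyap hr hσ hD (fun t e y => F t e (clipH R y)) hF' d hd t₀ ht₀ x hx W hW hn
    (Vw σ W x₀) (by rw [hh0]) (fun t ht e he y hy1 hy2 => by
      rw [hR' y hy1]; exact hstar t ht e he y hy2)
  refine ⟨x, hx0, fun t ht => ?_, hdec⟩
  rw [hx t ht]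
  congr 1
  apply intervalIntegral.integral_congr
  intro s hs
  rw [uIcc_of_le ht] at hs
  simp only
  rw [hR']
  refine (hdec s hs.1).trans ?_
  have e1 : Real.exp (-(2 * σ) * (s - t₀)) ≤ 1 := by
    rw [Real.exp_le_one_iff]
    nlinarith [hs.1]
  have h0 := Vw_nonneg hr σ W hW.continuous hn x₀
  nlinarith

theorem aux_urgas {N l : ℕ} {r σ : ℝ} (hr : 0 < r) (hσ : 0 < σ) {D : Set (Euc l)}
    (hD : IsCompact D) (F : ℝ → Euc l → Hist N r → Euc N)
    (hF : ContinuousOn (fun p : ℝ × Euc l × Hist N r => F p.1 p.2.1 p.2.2) (Ici 0 ×ˢ D ×ˢ univ))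
    (hlip : ∀ T, 0 ≤ T → ∀ R, 0 ≤ R → ∃ L, ∀ t ∈ Icc (0:ℝ) T, ∀ d ∈ D, ∀ x y : Hist N r,
      ‖x‖ ≤ R → ‖y‖ ≤ R → ‖F t d x - F t d y‖ ≤ L * ‖x - y‖)
    (W : Euc N → ℝ) (hW : Differentiable ℝ W) (hn : ∀ ξ, 0 ≤ W ξ)
    (a₁ a₂ : ℝ → ℝ) (ha₁ : IsKinf a₁) (ha₂ : IsKinf a₂)
    (hV₁ : ∀ y : Hist N r, a₁ ‖y‖ ≤ Vw σ W y) (hV₂ : ∀ y : Hist N r, Vw σ W y ≤ a₂ ‖y‖)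
    (hstar : ∀ t, 0 ≤ t → ∀ e ∈ D, ∀ y : Hist N r, W (y (zeroIcc hr)) = Vw σ W y →
      fderiv ℝ W (y (zeroIcc hr)) (F t e y) ≤ -(2 * σ) * W (y (zeroIcc hr))) :
    URGAOSrfde r D F (fun _ x => x) := by
  have ex : ∀ (t₀ : ℝ) (x₀ : Hist N r) (d : ℝ → Euc l), ∃ x : C(ℝ, Euc N), 0 ≤ t₀ → InMD D d →
      (∀ θ : Icc (-r) (0:ℝ), x (t₀ + θ) = x₀ θ) ∧
      (∀ t, t₀ ≤ t → x t = x t₀ + ∫ s in t₀..t, F s (d s) (histOf x s)) ∧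
      ∀ t, t₀ ≤ t → Vw σ W (histOf x t : Hist N r) ≤
        Real.exp (-(2 * σ) * (t - t₀)) * Vw σ W x₀ := by
    intro t₀ x₀ d
    by_cases h : 0 ≤ t₀ ∧ InMD D d
    · obtain ⟨x, hx⟩ := aux_exists_decay hr hσ hD F hF hlip W hW hn a₁ ha₁ hV₁ hstar t₀ h.1 x₀ d h.2
      exact ⟨x, fun _ _ => hx⟩
    · exact ⟨0, fun h1 h2 => absurd ⟨h1, h2⟩ h⟩
  choose X hX using ex
  have hest : ∀ t₀, 0 ≤ t₀ → ∀ x₀ d, InMD D d → ∀ t, t₀ ≤ t →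
      a₁ ‖(histOf (X t₀ x₀ d) t : Hist N r)‖ ≤
        Real.exp (-(2 * σ) * (t - t₀)) * a₂ ‖x₀‖ := by
    intro t₀ h0 x₀ d hd t ht
    refine (hV₁ _).trans (((hX t₀ x₀ d h0 hd).2.2 t ht).trans ?_)
    gcongr
    exact hV₂ x₀
  have ha₂n : ∀ s, 0 ≤ s → 0 ≤ a₂ s := fun s hs => by
    have := aux_kinf_mono ha₂ le_rfl hs
    rwa [ha₂.2.2.1] at this
  have hest' : ∀ t₀, 0 ≤ t₀ → ∀ x₀ d, InMD D d → ∀ t, t₀ ≤ t →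
      a₁ ‖(histOf (X t₀ x₀ d) t : Hist N r)‖ ≤ a₂ ‖x₀‖ := by
    intro t₀ h0 x₀ d hd t ht
    refine (hest t₀ h0 x₀ d hd t ht).trans ?_
    have e1 : Real.exp (-(2 * σ) * (t - t₀)) ≤ 1 := by
      rw [Real.exp_le_one_iff]
      nlinarith
    have := ha₂n ‖x₀‖ (norm_nonneg _)
    nlinarith
  have hbd : ∀ s, 0 ≤ s → ∃ M, ∀ t₀ : ℝ, 0 ≤ t₀ → ∀ x₀ : Hist N r, ‖x₀‖ ≤ s → ∀ d, InMD D d →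
      ∀ t, t₀ ≤ t → ‖(histOf (X t₀ x₀ d) t : Hist N r)‖ ≤ M := by
    intro s hs
    obtain ⟨M, _, hM⟩ := aux_kinf_ge ha₁ (a₂ s)
    refine ⟨M, fun t₀ h0 x₀ hx₀ d hd t ht => hM _ (norm_nonneg _) ?_⟩
    exact (hest' t₀ h0 x₀ d hd t ht).trans (aux_kinf_mono ha₂ (norm_nonneg _) hx₀)
  refine ⟨fun t₀ x₀ d => X t₀ x₀ d, fun t₀ x₀ d t => histOf (X t₀ x₀ d) t, fun _ _ _ => ⊤,
    ?_, ?_, ?_, ?_⟩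
  · intro t₀ h0 x₀ d hd
    obtain ⟨hi, hs, _⟩ := hX t₀ x₀ d h0 hd
    refine ⟨⟨EReal.coe_lt_top _, ContinuousMap.ext fun θ => hi θ, fun _ _ _ _ => rfl,
      (X t₀ x₀ d).continuous.continuousOn, fun t ht _ => hs t ht⟩, ?_⟩
    rintro tm y ψ ⟨_, hy0, hyψ, hyc, hyi⟩
    refine ⟨le_top, fun t ht htm => ?_⟩
    have hle : t₀ - r ≤ t := by linarith
    have hlt : ∀ s : ℝ, s ≤ t → (s : EReal) < tm := fun s hs =>
      lt_of_le_of_lt (EReal.coe_le_coe_iff.2 hs) htm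
    -- continuous extension of y
    let Y : C(ℝ, Euc N) := ⟨fun s => y (projIcc (t₀ - r) t hle s),
      hyc.comp_continuous (continuous_subtype_val.comp continuous_projIcc)
        (fun s => ⟨(projIcc (t₀ - r) t hle s).2.1, hlt _ (projIcc (t₀ - r) t hle s).2.2⟩)⟩
    have hYy : ∀ s ∈ Icc (t₀ - r) t, Y s = y s := by
      intro s hs
      show y (projIcc (t₀ - r) t hle s) = y s
      rw [projIcc_of_mem hle hs]
    have hYψ : ∀ s ∈ Icc t₀ t, (histOf Y s : Hist N r) = ψ s := by
      intro s hs
      apply ContinuousMap.ext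
      intro θ
      rw [histOf_apply, hyψ s hs.1 (hlt s hs.2) θ]
      exact hYy _ ⟨by linarith [hs.1, θ.2.1], by linarith [hs.2, θ.2.2]⟩
    have huniq := aux_unique hD F hF hlip d hd t₀ t h0 ht (X t₀ x₀ d) Y (fun s hs => by
        have h1 := hi ⟨s - t₀, ⟨by linarith [hs.1], by linarith [hs.2]⟩⟩
        have h2 := hyψ t₀ le_rfl (hlt t₀ ht) ⟨s - t₀, ⟨by linarith [hs.1], by linarith [hs.2]⟩⟩
        simp only [add_sub_cancel] at h1 h2
        rw [h1, hYy s ⟨hs.1, hs.2.trans ht⟩, ← h2, hy0])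
      (fun z hz => hs z hz.1) (fun s hs => by
        rw [hYy s ⟨by linarith [hs.1], hs.2⟩, hYy t₀ ⟨by linarith, ht⟩, hyi s hs.1 (hlt s hs.2)]
        congr 1
        apply intervalIntegral.integral_congr
        intro z hz
        rw [uIcc_of_le hs.1] at hz
        simp only
        rw [hYψ z ⟨hz.1, hz.2.trans hs.2⟩]) hr
    rw [← hYψ t ⟨ht, le_rfl⟩]
    apply ContinuousMap.ext
    intro θ
    rw [histOf_apply, histOf_apply, huniq]
    exact ⟨by linarith [θ.2.1], by linarith [θ.2.2]⟩
  · intro T hT s hs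
    obtain ⟨M, hM⟩ := hbd s hs
    exact ⟨M, fun t₀ h0 ξ hξ x₀ hx₀ d hd => ⟨EReal.coe_lt_top _,
      hM t₀ h0.1 x₀ hx₀ d hd _ (by linarith [hξ.1])⟩⟩
  · intro ε hε
    constructor
    · obtain ⟨M, hM⟩ := hbd ε hε.le
      exact ⟨M, fun t₀ h0 x₀ hx₀ d hd t ht _ => hM t₀ h0 x₀ hx₀ d hd t ht⟩
    · have h1 : ∀ᶠ s in 𝓝[Ici 0] (0:ℝ), a₂ s < a₁ ε :=
        (ha₂.1 0 (mem_Ici.2 le_rfl)).eventually_lt_const (by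
          rw [ha₂.2.2.1]; exact aux_kinf_pos ha₁ hε)
      obtain ⟨δ, hδ, hball⟩ := Metric.eventually_nhds_iff.1 (eventually_nhdsWithin_iff.1 h1)
      refine ⟨δ / 2, by positivity, fun t₀ h0 x₀ hx₀ d hd t ht _ => ?_⟩
      apply aux_kinf_le ha₁ (norm_nonneg _) hε.le
      refine (hest' t₀ h0 x₀ d hd t ht).trans (hball ?_ (mem_Ici.2 (norm_nonneg _))).le
      rw [Real.dist_eq, sub_zero, abs_of_nonneg (norm_nonneg _)]
      linarith
  · intro ε hε R hR
    have h1 : Tendsto (fun τ : ℝ => Real.exp (-(2 * σ) * τ) * a₂ R) atTop (𝓝 0) := by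
      have : Tendsto (fun τ : ℝ => Real.exp (-(2 * σ) * τ)) atTop (𝓝 0) :=
        Real.tendsto_exp_atBot.comp (tendsto_id.const_mul_atTop_of_neg (by linarith))
      simpa using this.mul_const (a₂ R)
    obtain ⟨τ, h2, h3⟩ := ((h1.eventually_lt_const (aux_kinf_pos ha₁ hε)).and
      (eventually_ge_atTop 0)).exists
    refine ⟨τ, h3, fun t₀ h0 x₀ hx₀ d hd t ht _ => ?_⟩
    apply aux_kinf_le ha₁ (norm_nonneg _) hε.le
    refine (hest t₀ h0 x₀ d hd t (by linarith)).trans (le_trans ?_ h2.le)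
    have e1 : Real.exp (-(2 * σ) * (t - t₀)) ≤ Real.exp (-(2 * σ) * τ) := by
      rw [Real.exp_le_exp]
      nlinarith
    exact mul_le_mul e1 (aux_kinf_mono ha₂ (norm_nonneg _) hx₀) (ha₂n _ (norm_nonneg _))
      (Real.exp_pos _).le


theorem aux_norm_le_card {N : ℕ} (ξ : Euc N) (B : ℝ) (hB : 0 ≤ B) (h : ∀ i, |ξ i| ≤ B) :
    ‖ξ‖ ≤ N * B := by
  have hNR : 0 ≤ (N : ℝ) * B := by positivity
  apply (sq_le_sq₀ (norm_nonneg _) hNR).1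
  rw [EuclideanSpace.norm_sq_eq]
  have : ∀ i ∈ Finset.univ, ‖ξ i‖ ^ 2 ≤ B ^ 2 := by
    intro i _
    have := h i
    rw [Real.norm_eq_abs]
    gcongr
  refine (Finset.sum_le_sum this).trans ?_
  rw [Finset.sum_const, Finset.card_univ, Fintype.card_fin, nsmul_eq_mul, mul_pow]
  gcongr
  have : N ≤ N ^ 2 := Nat.le_self_pow (by norm_num) N
  exact_mod_cast this

theorem aux_coord_le {N : ℕ} (ξ : Euc N) (i : Fin N) : |ξ i| ≤ ‖ξ‖ := PiLp.norm_apply_le ξ i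

theorem prefixEuc_norm {N i : ℕ} (h : i ≤ N) (ξ : Euc N) : ‖prefixEuc i h ξ‖ ≤ ‖ξ‖ := by
  apply (sq_le_sq₀ (norm_nonneg _) (norm_nonneg _)).1
  rw [EuclideanSpace.norm_sq_eq, EuclideanSpace.norm_sq_eq]
  have h1 : ∑ j : Fin i, ‖(prefixEuc i h ξ) j‖ ^ 2 =
      ∑ j ∈ Finset.univ.map (Fin.castLEEmb h), ‖ξ j‖ ^ 2 := by
    rw [Finset.sum_map]; rfl
  rw [h1]
  exact Finset.sum_le_sum_of_subset_of_nonneg (Finset.subset_univ _) (fun _ _ _ => by positivity)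

/-- prefixL as a continuous linear map -/
def prefixC {N i : ℕ} (h : i ≤ N) : Euc N →L[ℝ] Euc i :=
  ⟨prefixL h, (prefixL h).continuous_of_finiteDimensional⟩

theorem prefixC_apply {N i : ℕ} (h : i ≤ N) (ξ : Euc N) : prefixC h ξ = prefixEuc i h ξ := rfl

theorem prefixHist_norm {N i : ℕ} {r : ℝ} (h : i ≤ N) (x : Hist N r) :
    ‖prefixHist i h x‖ ≤ ‖x‖ := by
  rw [ContinuousMap.norm_le _ (norm_nonneg _)]
  exact fun θ => (prefixEuc_norm h (x θ)).trans (x.norm_coe_le_norm θ)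

theorem prefixHist_sub {N i : ℕ} {r : ℝ} (h : i ≤ N) (x y : Hist N r) :
    prefixHist i h x - prefixHist i h y = prefixHist i h (x - y) := rfl

theorem prefixHist_continuous {N i : ℕ} {r : ℝ} (h : i ≤ N) :
    Continuous (fun x : Hist N r => prefixHist i h x) :=
  (LipschitzWith.of_dist_le_mul (K := 1) (fun a b => by
      rw [dist_eq_norm, dist_eq_norm, prefixHist_sub]
      simpa using prefixHist_norm h (a - b))).continuous

/-- The error variables of the backstepping procedure. -/
def zf (μ : (i : ℕ) → Euc (i + 1) → ℝ) : (i : ℕ) → Euc (i + 1) → ℝ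
  | 0, ξ => ξ 0
  | i + 1, ξ => ξ (Fin.last (i + 1)) +
      μ i (prefixEuc (i + 1) (Nat.le_succ _) ξ) * zf μ i (prefixEuc (i + 1) (Nat.le_succ _) ξ)

/-- All the error variables. -/
def Zv (μ : (i : ℕ) → Euc (i + 1) → ℝ) (n : ℕ) (ξ : Euc (n + 1)) (j : Fin (n + 1)) : ℝ :=
  zf μ j.val (prefixEuc (j.val + 1) (Nat.succ_le_succ j.is_le) ξ)

theorem zf_congr (μ μ' : (i : ℕ) → Euc (i + 1) → ℝ) (i : ℕ) (h : ∀ j, j < i → μ j = μ' j) :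
    zf μ i = zf μ' i := by
  induction i with
  | zero => rfl
  | succ i ih =>
    funext ξ
    simp only [zf]
    rw [ih (fun j hj => h j (by omega)), h i (by omega)]

theorem Zv_congr (μ μ' : (i : ℕ) → Euc (i + 1) → ℝ) (i : ℕ) (h : ∀ j, j < i → μ j = μ' j) :
    Zv μ i = Zv μ' i := by
  funext ξ j
  simp only [Zv]
  rw [zf_congr μ μ' j.val (fun k hk => h k (by have := j.is_le; omega))]

theorem zf_contDiff (μ : (i : ℕ) → Euc (i + 1) → ℝ) (hμ : ∀ j, ContDiff ℝ (⊤ : ℕ∞) (μ j)) (i : ℕ) :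
    ContDiff ℝ (⊤ : ℕ∞) (zf μ i) := by
  induction i with
  | zero =>
    show ContDiff ℝ (⊤ : ℕ∞) (fun ξ : Euc 1 => ξ 0)
    fun_prop
  | succ i ih =>
    show ContDiff ℝ (⊤ : ℕ∞) (fun ξ : Euc (i + 1 + 1) => ξ (Fin.last (i + 1)) +
      μ i (prefixC (Nat.le_succ _) ξ) * zf μ i (prefixC (Nat.le_succ _) ξ))
    have := hμ i
    fun_prop

theorem zf_zero (μ : (i : ℕ) → Euc (i + 1) → ℝ) (i : ℕ) : zf μ i 0 = 0 := by
  induction i with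
  | zero => rfl
  | succ i ih =>
    show (0 : ℝ) + μ i 0 * zf μ i 0 = 0
    rw [ih]; simp

theorem zf_fderiv_diff (μ : (i : ℕ) → Euc (i + 1) → ℝ) (hμ : ∀ j, ContDiff ℝ (⊤ : ℕ∞) (μ j))
    (i : ℕ) (ξ w w' : Euc (i + 1)) (h : ∀ k : Fin (i + 1), k ≠ Fin.last i → w k = w' k) :
    fderiv ℝ (zf μ i) ξ w = fderiv ℝ (zf μ i) ξ w' + (w (Fin.last i) - w' (Fin.last i)) := by
  cases i with
  | zero =>
    have h1 : HasFDerivAt (zf μ 0) (EuclideanSpace.proj (0 : Fin 1) : Euc 1 →L[ℝ] ℝ) ξ :=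
      (EuclideanSpace.proj (0 : Fin 1) : Euc 1 →L[ℝ] ℝ).hasFDerivAt
    rw [h1.fderiv]
    show w 0 = w' 0 + (w 0 - w' 0)
    ring
  | succ i =>
    set G : Euc (i + 1) → ℝ := fun η => μ i η * zf μ i η with hG
    have hGd : Differentiable ℝ G :=
      ((hμ i).mul (zf_contDiff μ hμ i)).differentiable (by simp)
    have h1 : HasFDerivAt (zf μ (i + 1))
        ((EuclideanSpace.proj (Fin.last (i + 1)) : Euc (i + 1 + 1) →L[ℝ] ℝ) +
          (fderiv ℝ G (prefixC (Nat.le_succ _) ξ)).comp (prefixC (Nat.le_succ _))) ξ :=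
      (EuclideanSpace.proj (Fin.last (i + 1)) : Euc (i + 1 + 1) →L[ℝ] ℝ).hasFDerivAt.add
        ((hGd _).hasFDerivAt.comp ξ (prefixC (Nat.le_succ (i + 1))).hasFDerivAt)
    have h2 : prefixC (Nat.le_succ (i + 1)) w = prefixC (Nat.le_succ (i + 1)) w' := by
      ext k
      exact h (Fin.castSucc k) (Fin.castSucc_lt_last k).ne
    rw [h1.fderiv]
    show w (Fin.last (i + 1)) + fderiv ℝ G _ (prefixC (Nat.le_succ (i + 1)) w) =
      w' (Fin.last (i + 1)) + fderiv ℝ G _ (prefixC (Nat.le_succ (i + 1)) w') + _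
    rw [h2]; ring

/-- Lemma B: bounds on the error variables bound the state. -/
theorem zf_bound (μ : (i : ℕ) → Euc (i + 1) → ℝ) (hμ : ∀ j, ContDiff ℝ (⊤ : ℕ∞) (μ j)) (i : ℕ) :
    ∀ R, 0 ≤ R → ∃ b, 0 ≤ b ∧ ∀ S, 0 ≤ S → S ≤ R → ∀ ξ : Euc (i + 1),
      (∀ m, |Zv μ i ξ m| ≤ S) → ‖ξ‖ ≤ b * S := by
  induction i with
  | zero =>
    intro R hR
    refine ⟨1, by norm_num, fun S hS _ ξ h => ?_⟩
    have := aux_norm_le_card ξ S hS (fun k => by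
      have := h 0
      have hk : k = 0 := Fin.ext (by have := k.isLt; simp)
      rw [hk]
      exact this)
    simpa using this
  | succ i ih =>
    intro R hR
    obtain ⟨b, hb0, hb⟩ := ih R hR
    obtain ⟨C, hC0, hC⟩ := aux_ball_bound (μ i) (hμ i).continuous (b * R)
    refine ⟨((i + 1 + 1 : ℕ) : ℝ) * (b + 1 + C), by positivity, fun S hS hSR ξ h => ?_⟩
    have h1 : ‖prefixEuc (i + 1) (Nat.le_succ _) ξ‖ ≤ b * S :=
      hb S hS hSR _ (fun m => h m.castSucc)
    have h2 : |μ i (prefixEuc (i + 1) (Nat.le_succ _) ξ)| ≤ C :=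
      hC _ (h1.trans (by gcongr))
    have h3 : |zf μ i (prefixEuc (i + 1) (Nat.le_succ _) ξ)| ≤ S := h (Fin.last i).castSucc
    have h4 : |zf μ (i + 1) ξ| ≤ S := h (Fin.last (i + 1))
    have h5 : |ξ (Fin.last (i + 1))| ≤ (1 + C) * S := by
      have : ξ (Fin.last (i + 1)) = zf μ (i + 1) ξ - μ i (prefixEuc (i + 1) (Nat.le_succ _) ξ) *
          zf μ i (prefixEuc (i + 1) (Nat.le_succ _) ξ) := by
        simp only [zf]; ring
      rw [this]
      refine (abs_sub _ _).trans ?_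
      rw [abs_mul]
      have := mul_le_mul h2 h3 (abs_nonneg _) hC0
      linarith
    rw [mul_assoc]
    apply aux_norm_le_card ξ _ (by positivity)
    intro k
    refine Fin.lastCases ?_ (fun k => ?_) k
    · refine h5.trans ?_
      gcongr; linarith
    · have := aux_coord_le (prefixEuc (i + 1) (Nat.le_succ _) ξ) k
      have h6 : |ξ k.castSucc| ≤ b * S := this.trans h1
      refine h6.trans ?_
      gcongr; linarith

/-- The pointwise Lyapunov function. -/
def Wf (μ : (i : ℕ) → Euc (i + 1) → ℝ) (n : ℕ) (ξ : Euc (n + 1)) : ℝ :=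
  ∑ j : Fin (n + 1), (Zv μ n ξ j) ^ 2

theorem Zv_contDiff (μ : (i : ℕ) → Euc (i + 1) → ℝ) (hμ : ∀ j, ContDiff ℝ (⊤ : ℕ∞) (μ j)) (n : ℕ)
    (j : Fin (n + 1)) : ContDiff ℝ (⊤ : ℕ∞) (fun ξ => Zv μ n ξ j) :=
  (zf_contDiff μ hμ j.val).comp (prefixC (Nat.succ_le_succ j.is_le)).contDiff

theorem Wf_contDiff (μ : (i : ℕ) → Euc (i + 1) → ℝ) (hμ : ∀ j, ContDiff ℝ (⊤ : ℕ∞) (μ j)) (n : ℕ) :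
    ContDiff ℝ (⊤ : ℕ∞) (Wf μ n) :=
  ContDiff.sum fun j _ => (Zv_contDiff μ hμ n j).pow 2

theorem Wf_nonneg (μ : (i : ℕ) → Euc (i + 1) → ℝ) (n : ℕ) (ξ : Euc (n + 1)) : 0 ≤ Wf μ n ξ :=
  Finset.sum_nonneg fun _ _ => sq_nonneg _

theorem Wf_zero (μ : (i : ℕ) → Euc (i + 1) → ℝ) (n : ℕ) : Wf μ n 0 = 0 :=
  Finset.sum_eq_zero fun j _ => by
    have : Zv μ n 0 j = 0 := zf_zero μ j.val
    rw [this]; simp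

theorem Zv_le_Wf (μ : (i : ℕ) → Euc (i + 1) → ℝ) (n : ℕ) (ξ : Euc (n + 1)) (j : Fin (n + 1)) :
    (Zv μ n ξ j) ^ 2 ≤ Wf μ n ξ :=
  Finset.single_le_sum (f := fun j => (Zv μ n ξ j) ^ 2) (fun _ _ => sq_nonneg _)
    (Finset.mem_univ j)

theorem Wf_proper (μ : (i : ℕ) → Euc (i + 1) → ℝ) (hμ : ∀ j, ContDiff ℝ (⊤ : ℕ∞) (μ j)) (n : ℕ)
    (R : ℝ) : ∃ B, ∀ ξ, Wf μ n ξ ≤ R → ‖ξ‖ ≤ B := by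
  obtain ⟨b, hb0, hb⟩ := zf_bound μ hμ n (Real.sqrt R) (Real.sqrt_nonneg _)
  refine ⟨b * Real.sqrt R, fun ξ h => hb _ (Real.sqrt_nonneg _) le_rfl ξ fun m => ?_⟩
  apply Real.abs_le_sqrt
  exact (Zv_le_Wf μ n ξ m).trans h

theorem Wf_pos (μ : (i : ℕ) → Euc (i + 1) → ℝ) (hμ : ∀ j, ContDiff ℝ (⊤ : ℕ∞) (μ j)) (n : ℕ)
    (ξ : Euc (n + 1)) (h : Wf μ n ξ = 0) : ξ = 0 := by
  obtain ⟨b, hb0, hb⟩ := zf_bound μ hμ n 0 le_rfl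
  have := hb 0 le_rfl le_rfl ξ (fun m => by
    have := Zv_le_Wf μ n ξ m
    rw [h] at this
    rw [pow_eq_zero_iff (two_ne_zero) |>.1 (le_antisymm this (sq_nonneg _))]
    simp)
  rw [mul_zero] at this
  exact norm_le_zero_iff.1 this

theorem Wf_fderiv (μ : (i : ℕ) → Euc (i + 1) → ℝ) (hμ : ∀ j, ContDiff ℝ (⊤ : ℕ∞) (μ j)) (n : ℕ)
    (ξ v : Euc (n + 1)) : fderiv ℝ (Wf μ n) ξ v = 2 * ∑ j : Fin (n + 1), Zv μ n ξ j *
      fderiv ℝ (zf μ j.val) (prefixEuc (j.val + 1) (Nat.succ_le_succ j.is_le) ξ)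
        (prefixEuc (j.val + 1) (Nat.succ_le_succ j.is_le) v) := by
  have h1 : ∀ j : Fin (n + 1), HasFDerivAt (fun ξ => Zv μ n ξ j)
      ((fderiv ℝ (zf μ j.val) (prefixEuc (j.val + 1) (Nat.succ_le_succ j.is_le) ξ)).comp
        (prefixC (Nat.succ_le_succ j.is_le))) ξ := fun j =>
    HasFDerivAt.comp (g := zf μ j.val) ξ
      (((zf_contDiff μ hμ j.val).differentiable (by simp)) _).hasFDerivAt
      (prefixC (Nat.succ_le_succ j.is_le)).hasFDerivAt
  have h2 : HasFDerivAt (Wf μ n) (∑ j : Fin (n + 1), _) ξ :=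
    HasFDerivAt.fun_sum fun j _ => (h1 j).pow 2
  rw [h2.fderiv, _root_.sum_apply, Finset.mul_sum]
  refine Finset.sum_congr rfl fun j _ => ?_
  simp [prefixC_apply]
  ring


/-- The standing hypotheses on the triangular system. -/
structure TriHyp (n : ℕ) {l : ℕ} {r : ℝ} (D : Set (Euc l))
    (f g : (i : ℕ) → ℝ → Euc l → Hist (i + 1) r → ℝ) (φf : ℝ → ℝ) : Prop where
  f_cont : ∀ i, i ≤ n → ContinuousOn
      (fun p : ℝ × Euc l × Hist (i + 1) r => f i p.1 p.2.1 p.2.2) (Ici 0 ×ˢ D ×ˢ univ)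
  g_cont : ∀ i, i ≤ n → ContinuousOn
      (fun p : ℝ × Euc l × Hist (i + 1) r => g i p.1 p.2.1 p.2.2) (Ici 0 ×ˢ D ×ˢ univ)
  f0 : ∀ i, i ≤ n → ∀ t : ℝ, 0 ≤ t → ∀ d ∈ D, f i t d 0 = 0
  g_lip : ∀ i, i ≤ n → ∀ T, 0 ≤ T → ∀ R, 0 ≤ R → ∃ L, ∀ t ∈ Icc (0:ℝ) T, ∀ d ∈ D,
      ∀ x y : Hist (i + 1) r, ‖x‖ ≤ R → ‖y‖ ≤ R → |g i t d x - g i t d y| ≤ L * ‖x - y‖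
  φ_mono : MonotoneOn φf (Ici 0)
  φ_pos : ∀ s, 0 ≤ s → 0 < φf s
  g_bound : ∀ i, i ≤ n → ∀ t : ℝ, 0 ≤ t → ∀ d ∈ D, ∀ x : Hist (i + 1) r,
      1 / φf ‖x‖ ≤ g i t d x ∧ g i t d x ≤ φf ‖x‖
  f_lip : ∀ i, i ≤ n → ∀ R, 0 ≤ R → ∃ L, ∀ t : ℝ, 0 ≤ t → ∀ d ∈ D,
      ∀ x y : Hist (i + 1) r, ‖x‖ ≤ R → ‖y‖ ≤ R → |f i t d x - f i t d y| ≤ L * ‖x - y‖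

section tri
variable {n l : ℕ} {r : ℝ} (hr : 0 < r) {D : Set (Euc l)}
    {f g : (i : ℕ) → ℝ → Euc l → Hist (i + 1) r → ℝ} {φf : ℝ → ℝ}

theorem TriHyp.g_pos (H : TriHyp n D f g φf) {i : ℕ} (hi : i ≤ n) {t : ℝ} (ht : 0 ≤ t) {d : Euc l}
    (hd : d ∈ D) (x : Hist (i + 1) r) : 0 < g i t d x :=
  lt_of_lt_of_le (one_div_pos.2 (H.φ_pos _ (norm_nonneg _))) (H.g_bound i hi t ht d hd x).1

theorem tri_bound (H : TriHyp n D f g φf) (i : ℕ) (hi : i ≤ n) (R : ℝ) (hR : 0 ≤ R) :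
    ∃ C, 0 ≤ C ∧ ∀ t, 0 ≤ t → ∀ d ∈ D, ∀ S, 0 ≤ S → S ≤ R → ∀ x : Hist (i + 1) r, ∀ w : ℝ,
      ‖x‖ ≤ S → |w| ≤ S → ‖triVec i hr f g t d x w‖ ≤ C * S := by
  have h1 : ∀ k : Fin (i + 1), ∃ L, ∀ t : ℝ, 0 ≤ t → ∀ d ∈ D,
      ∀ x y : Hist (k.val + 1) r, ‖x‖ ≤ R → ‖y‖ ≤ R →
        |f k.val t d x - f k.val t d y| ≤ L * ‖x - y‖ :=
    fun k => H.f_lip k.val (k.is_le.trans hi) R hR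
  choose L hL using h1
  have hφ := (H.φ_pos R hR).le
  have hs0 : 0 ≤ ∑ k, |L k| := Finset.sum_nonneg fun k _ => abs_nonneg _
  refine ⟨((i + 1 : ℕ) : ℝ) * ((∑ k, |L k|) + φf R), by positivity, ?_⟩
  intro t ht d hd S hS hSR x w hx hw
  rw [mul_assoc]
  apply aux_norm_le_card _ _ (by positivity)
  intro k
  simp only [triVec]
  set y := prefixHist (k.val + 1) (Nat.succ_le_succ k.is_le) x with hy
  have hyS : ‖y‖ ≤ S := (prefixHist_norm _ x).trans hx
  have a1 : |f k.val t d y| ≤ (∑ k, |L k|) * S := by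
    have := hL k t ht d hd y 0 (hyS.trans hSR) (by simpa using hR)
    rw [H.f0 k.val (k.is_le.trans hi) t ht d hd, sub_zero, sub_zero] at this
    refine this.trans ?_
    have b1 : L k ≤ ∑ k, |L k| := (le_abs_self _).trans
      (Finset.single_le_sum (f := fun k => |L k|) (fun _ _ => abs_nonneg _) (Finset.mem_univ k))
    exact mul_le_mul b1 hyS (norm_nonneg _) hs0
  have a2 : |g k.val t d y| ≤ φf R := by
    rw [abs_of_pos (H.g_pos (k.is_le.trans hi) ht hd y)]
    exact (H.g_bound k.val (k.is_le.trans hi) t ht d hd y).2.trans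
      (H.φ_mono (mem_Ici.2 (norm_nonneg _)) (mem_Ici.2 hR) (hyS.trans hSR))
  have a3 : |(if h : k.val + 1 < i + 1 then x (zeroIcc hr) ⟨k.val + 1, h⟩ else w)| ≤ S := by
    split_ifs with h
    · exact (aux_coord_le _ _).trans ((x.norm_coe_le_norm _).trans hx)
    · exact hw
  refine (abs_add_le _ _).trans ?_
  rw [abs_mul, add_mul]
  have := mul_le_mul a2 a3 (abs_nonneg _) hφ
  linarith

/-- The bounds used in the backstepping construction at level j. -/
def Abd (hr : 0 < r) (D : Set (Euc l)) (f g : (i : ℕ) → ℝ → Euc l → Hist (i + 1) r → ℝ)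
    (μ : (i : ℕ) → Euc (i + 1) → ℝ) (j : ℕ) (R C : ℝ) : Prop :=
  1 ≤ C ∧ ∀ t, 0 ≤ t → ∀ d ∈ D, ∀ S, 0 ≤ S → S ≤ R → ∀ x : Hist (j + 1) r, ∀ e : ℝ, |e| ≤ S →
    (∀ θ m, |Zv μ j (x θ) m| ≤ S) →
    1 / C ≤ g j t d x ∧
      |fderiv ℝ (zf μ j) (x (zeroIcc hr)) (triVec j hr f g t d x e)| ≤ C * S

theorem Abd_mono (μ : (i : ℕ) → Euc (i + 1) → ℝ) (j : ℕ) (R R' C C' : ℝ) (hR : R' ≤ R)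
    (hC : C ≤ C') (h : Abd hr D f g μ j R C) : Abd hr D f g μ j R' C' := by
  refine ⟨h.1.trans hC, fun t ht d hd S hS hSR x e he hx => ?_⟩
  have := h.2 t ht d hd S hS (hSR.trans hR) x e he hx
  have hC1 := h.1
  exact ⟨(one_div_le_one_div_of_le (by linarith) hC).trans this.1, this.2.trans (by gcongr)⟩

theorem Abd_congr (μ μ' : (i : ℕ) → Euc (i + 1) → ℝ) (j : ℕ) (R C : ℝ)
    (h : ∀ k, k < j → μ k = μ' k) (hA : Abd hr D f g μ j R C) : Abd hr D f g μ' j R C := by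
  unfold Abd at hA ⊢
  rw [← Zv_congr μ μ' j h, ← zf_congr μ μ' j h]
  exact hA

theorem Abd_exists (H : TriHyp n D f g φf) (μ : (i : ℕ) → Euc (i + 1) → ℝ)
    (hμ : ∀ j, ContDiff ℝ (⊤ : ℕ∞) (μ j)) (j : ℕ) (hj : j ≤ n) (R : ℝ) (hR : 0 ≤ R) :
    ∃ C, Abd hr D f g μ j R C := by
  obtain ⟨b, hb0, hb⟩ := zf_bound μ hμ j R hR
  have hR1 : 0 ≤ (b + 1) * R := by positivity
  obtain ⟨C2, hC20, hC2⟩ := tri_bound hr H j hj ((b + 1) * R) hR1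
  obtain ⟨C3, hC30, hC3⟩ := aux_ball_bound (fun ξ => fderiv ℝ (zf μ j) ξ)
    ((zf_contDiff μ hμ j).continuous_fderiv (by simp)) ((b + 1) * R)
  have hφ := H.φ_pos _ hR1
  refine ⟨1 + φf ((b + 1) * R) + C3 * (C2 * (b + 1)), ?_, ?_⟩
  · have : 0 ≤ C3 * (C2 * (b + 1)) := by positivity
    linarith
  intro t ht d hd S hS hSR x e he hx
  have h0 : 0 ≤ C3 * (C2 * (b + 1)) := by positivity
  have hxS : ‖x‖ ≤ (b + 1) * S := by
    rw [ContinuousMap.norm_le _ (by positivity)]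
    intro θ
    refine (hb S hS hSR (x θ) (hx θ)).trans ?_
    gcongr; linarith
  have hS1 : 0 ≤ (b + 1) * S := by positivity
  have hS2 : (b + 1) * S ≤ (b + 1) * R := by gcongr
  constructor
  · refine le_trans ?_ (H.g_bound j hj t ht d hd x).1
    apply one_div_le_one_div_of_le (H.φ_pos _ (norm_nonneg _))
    have := H.φ_mono (mem_Ici.2 (norm_nonneg x)) (mem_Ici.2 hR1) (hxS.trans hS2)
    linarith
  · have a1 := hC2 t ht d hd ((b + 1) * S) hS1 hS2 x e hxS (he.trans (by nlinarith))
    have a2 := hC3 (x (zeroIcc hr)) ((x.norm_coe_le_norm _).trans (hxS.trans hS2))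
    have a3 := (fderiv ℝ (zf μ j) (x (zeroIcc hr))).le_opNorm (triVec j hr f g t d x e)
    rw [Real.norm_eq_abs] at a3
    refine a3.trans ?_
    calc _ ≤ C3 * (C2 * ((b + 1) * S)) := by gcongr
      _ = (C3 * (C2 * (b + 1))) * S := by ring
      _ ≤ _ := by gcongr; linarith

/-- The property required from μ at level i. -/
def PPr (hr : 0 < r) (D : Set (Euc l)) (f g : (i : ℕ) → ℝ → Euc l → Hist (i + 1) r → ℝ)
    (c N σ : ℝ) (μ : (i : ℕ) → Euc (i + 1) → ℝ) (i : ℕ) : Prop :=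
  ∃ Γ : ℝ → ℝ, (∀ s, 1 ≤ Γ s) ∧ (∀ R, 0 ≤ R → ∀ j, j ≤ i → Abd hr D f g μ j R (Γ R)) ∧
    ∀ ξ m, Γ (c * |Zv μ i ξ m|) * (N * c * Γ (c * |Zv μ i ξ m|) + N + N * σ +
      c ^ 2 * Γ (c * |Zv μ i ξ m|) ^ 2) ≤ μ i ξ

theorem PPr_congr (c N σ : ℝ) (μ μ' : (i : ℕ) → Euc (i + 1) → ℝ) (i : ℕ)
    (h : ∀ k, k ≤ i → μ k = μ' k) (hP : PPr hr D f g c N σ μ i) : PPr hr D f g c N σ μ' i := by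
  obtain ⟨Γ, h1, h2, h3⟩ := hP
  refine ⟨Γ, h1, fun R hR j hj => Abd_congr hr μ μ' j R _ (fun k hk => h k (by omega)) (h2 R hR j hj),
    ?_⟩
  rw [← Zv_congr μ μ' i (fun k hk => h k hk.le), ← h i le_rfl]
  exact h3

theorem mu_exists (H : TriHyp n D f g φf) (c N σ : ℝ) (hc : 0 ≤ c) (hN : 0 ≤ N) (hσ : 0 ≤ σ) :
    ∃ μ : (i : ℕ) → Euc (i + 1) → ℝ, (∀ j, ContDiff ℝ (⊤ : ℕ∞) (μ j)) ∧ (∀ j ξ, 0 < μ j ξ) ∧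
      ∀ j, j ≤ n → PPr hr D f g c N σ μ j := by
  suffices h : ∀ i, i ≤ n + 1 → ∃ μ : (i : ℕ) → Euc (i + 1) → ℝ,
      (∀ j, ContDiff ℝ (⊤ : ℕ∞) (μ j)) ∧ (∀ j ξ, 0 < μ j ξ) ∧
      ∀ j, j < i → PPr hr D f g c N σ μ j by
    obtain ⟨μ, h1, h2, h3⟩ := h (n + 1) le_rfl
    exact ⟨μ, h1, h2, fun j hj => h3 j (by omega)⟩
  intro i
  induction i with
  | zero => exact fun _ => ⟨fun _ _ => 1, fun _ => contDiff_const, fun _ _ => one_pos,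
      fun j hj => absurd hj (by omega)⟩
  | succ i ih =>
    intro hi
    obtain ⟨μ, h1, h2, h3⟩ := ih (by omega)
    obtain ⟨Γ, hΓm, hΓ1, hΓ⟩ := aux_exists_mono_bound
      (P := fun R C => ∀ j, j ≤ i → Abd hr D f g μ j R C) (by
        intro R hR
        have : ∀ j : Fin (i + 1), ∃ C, Abd hr D f g μ j.val R C := fun j =>
          Abd_exists hr H μ h1 j.val (by have := j.is_le; omega) R hR
        choose C hC using this
        refine ⟨∑ j, C j, fun j hj => ?_⟩
        refine Abd_mono hr μ j R R (C ⟨j, by omega⟩) _ le_rfl ?_ (hC ⟨j, by omega⟩)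
        exact Finset.single_le_sum (f := C) (fun k _ => by have := (hC k).1; linarith)
          (Finset.mem_univ _))
      (fun R R' C C' _ hR hC h j hj => Abd_mono hr μ j R R' C C' hR hC (h j hj))
    set q : ℝ → ℝ := fun s => Γ s * (N * c * Γ s + N + N * σ + c ^ 2 * Γ s ^ 2) with hq
    have hΓ0 : ∀ s, 0 ≤ Γ s := fun s => by linarith [hΓ1 s]
    have hqm : Monotone q := by
      intro s s' hs
      have := hΓm hs
      have := hΓ0 s
      have := hΓ0 s'
      simp only [hq]
      gcongr
    have hq0 : ∀ s, 0 ≤ q s := fun s => by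
      have := hΓ0 s
      simp only [hq]; positivity
    obtain ⟨ν, hν1, hν2⟩ := aux_smooth_majorant
      (fun ξ : Euc (i + 1) => ∑ m, q (c * |Zv μ i ξ m|)) (by
        intro ξ
        refine ⟨∑ m, q (c * (|Zv μ i ξ m| + 1)), ?_⟩
        have hm : ∀ m, ∀ᶠ y in 𝓝 ξ, |Zv μ i y m| < |Zv μ i ξ m| + 1 := fun m =>
          (((Zv_contDiff μ h1 i m).continuous.abs).tendsto ξ).eventually_lt_const (by linarith)
        filter_upwards [eventually_all.2 hm] with y hy
        refine Finset.sum_le_sum fun m _ => hqm ?_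
        have := (hy m).le
        gcongr)
    refine ⟨Function.update μ i ν, ?_, ?_, ?_⟩
    · intro j
      by_cases hj : j = i
      · subst hj; rw [Function.update_self]; exact hν1
      · rw [Function.update_of_ne hj]; exact h1 j
    · intro j ξ
      by_cases hj : j = i
      · subst hj; rw [Function.update_self]
        exact lt_of_le_of_lt (Finset.sum_nonneg fun m _ => hq0 _) (hν2 ξ)
      · rw [Function.update_of_ne hj]; exact h2 j ξ
    · have hlt : ∀ k, k < i → μ k = Function.update μ i ν k := fun k hk => by
        rw [Function.update_of_ne (by omega)]
      intro j hj
      rcases Nat.lt_or_ge j i with hji | hji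
      · exact PPr_congr hr c N σ μ _ j (fun k hk => hlt k (by omega)) (h3 j hji)
      · obtain rfl : j = i := by omega
        refine ⟨Γ, hΓ1, fun R hR k hk => Abd_congr hr μ _ k R _ (fun p hp => hlt p (by omega))
          (hΓ R hR k hk), ?_⟩
        rw [← Zv_congr μ _ j hlt, Function.update_self]
        intro ξ m
        refine le_trans ?_ (hν2 ξ).le
        exact Finset.single_le_sum (f := fun m => q (c * |Zv μ j ξ m|)) (fun _ _ => hq0 _)
          (Finset.mem_univ m)
end tri


/-- The feedbacks. -/
def kf (μ : (i : ℕ) → Euc (i + 1) → ℝ) (i : ℕ) (ξ : Euc (i + 1)) : ℝ := -(μ i ξ) * zf μ i ξ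

section tri2
variable {n l : ℕ} {r : ℝ} (hr : 0 < r) {D : Set (Euc l)}
    {f g : (i : ℕ) → ℝ → Euc l → Hist (i + 1) r → ℝ} {φf : ℝ → ℝ}

theorem prefix_triVec (t : ℝ) (d : Euc l) (x : Hist (n + 1) r) (u : ℝ) (j : Fin (n + 1)) :
    prefixEuc (j.val + 1) (Nat.succ_le_succ j.is_le) (triVec n hr f g t d x u) =
      triVec j.val hr f g t d (prefixHist (j.val + 1) (Nat.succ_le_succ j.is_le) x)
        (if h : j.val + 1 < n + 1 then x (zeroIcc hr) ⟨j.val + 1, h⟩ else u) := by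
  ext k
  simp only [prefixEuc, triVec]
  have e1 : ∀ h h', prefixHist (k.val + 1) h (prefixHist (j.val + 1) h' x) =
    prefixHist (k.val + 1) (Nat.succ_le_succ (Fin.castLE (Nat.succ_le_succ j.is_le) k).is_le) x :=
    fun _ _ => rfl
  rw [e1]
  show f k.val t d _ + g k.val t d _ * _ = f k.val t d _ + g k.val t d _ * _
  refine congrArg₂ (· + ·) rfl (congrArg₂ (· * ·) rfl ?_)
  simp only [Fin.val_castLE]
  by_cases hB : k.val + 1 < j.val + 1
  · have hA : k.val + 1 < n + 1 := by have := j.isLt; omega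
    rw [dif_pos hA, dif_pos hB]
    rfl
  · have hk : k.val = j.val := by have := k.isLt; omega
    rw [dif_neg hB]
    by_cases hA : j.val + 1 < n + 1
    · have hA' : k.val + 1 < n + 1 := by omega
      rw [dif_pos hA, dif_pos hA']
      exact congrArg (x (zeroIcc hr)) (Fin.ext (by simp [hk]))
    · rw [dif_neg hA, dif_neg (by omega)]

theorem triVec_fderiv_split (μ : (i : ℕ) → Euc (i + 1) → ℝ) (hμ : ∀ j, ContDiff ℝ (⊤ : ℕ∞) (μ j))
    (t : ℝ) (d : Euc l) (j : ℕ) (y : Hist (j + 1) r) (ξ : Euc (j + 1)) (κ e : ℝ) :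
    fderiv ℝ (zf μ j) ξ (triVec j hr f g t d y (κ + e)) =
      fderiv ℝ (zf μ j) ξ (triVec j hr f g t d y e) + g j t d y * κ := by
  rw [zf_fderiv_diff μ hμ j ξ (triVec j hr f g t d y (κ + e)) (triVec j hr f g t d y e)]
  · congr 1
    have hl : ∀ w : ℝ, (triVec j hr f g t d y w) (Fin.last j) = f j t d y + g j t d y * w := by
      intro w
      simp only [triVec]
      rw [dif_neg (by simp)]
      rfl
    rw [hl, hl]; ring
  · intro k hk
    have : k.val + 1 < j + 1 := by
      have h1 := k.isLt
      have h2 : k.val ≠ j := fun h => hk (Fin.ext h)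
      omega
    simp only [triVec]
    rw [dif_pos this, dif_pos this]

theorem ctrl_split (μ : (i : ℕ) → Euc (i + 1) → ℝ) (ξ : Euc (n + 1)) (j : Fin (n + 1)) :
    (if h : j.val + 1 < n + 1 then ξ ⟨j.val + 1, h⟩ else kf μ n ξ) =
      -(μ j.val (prefixEuc (j.val + 1) (Nat.succ_le_succ j.is_le) ξ) * Zv μ n ξ j) +
        (if h : j.val + 1 < n + 1 then Zv μ n ξ ⟨j.val + 1, h⟩ else 0) := by
  by_cases h : j.val + 1 < n + 1
  · rw [dif_pos h, dif_pos h]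
    have : Zv μ n ξ ⟨j.val + 1, h⟩ = ξ ⟨j.val + 1, h⟩ +
      μ j.val (prefixEuc (j.val + 1) (Nat.succ_le_succ j.is_le) ξ) * Zv μ n ξ j := rfl
    rw [this]; ring
  · rw [dif_neg h, dif_neg h]
    obtain rfl : j = Fin.last n := Fin.ext (by have := j.isLt; simp; omega)
    show -(μ n ξ) * zf μ n ξ = -(μ n ξ * zf μ n ξ) + 0
    ring

theorem star_closed (H : TriHyp n D f g φf) {σ : ℝ} (hσ : 0 < σ)
    (μ : (i : ℕ) → Euc (i + 1) → ℝ) (hμ : ∀ j, ContDiff ℝ (⊤ : ℕ∞) (μ j)) (hpos : ∀ j ξ, 0 < μ j ξ)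
    (hP : ∀ j, j ≤ n → PPr hr D f g (Real.exp (σ * r) * ((n + 1 : ℕ) : ℝ)) ((n + 1 : ℕ) : ℝ) σ μ j)
    (t : ℝ) (ht : 0 ≤ t) (d : Euc l) (hd : d ∈ D) (x : Hist (n + 1) r)
    (hmax : Wf μ n (x (zeroIcc hr)) = Vw σ (Wf μ n) x) :
    fderiv ℝ (Wf μ n) (x (zeroIcc hr)) (triVec n hr f g t d x (kf μ n (x (zeroIcc hr)))) ≤
      -(2 * σ) * Wf μ n (x (zeroIcc hr)) := by
  set ξ := x (zeroIcc hr) with hξ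
  set N : ℝ := ((n + 1 : ℕ) : ℝ) with hN
  have hN1 : 1 ≤ N := by rw [hN]; exact_mod_cast Nat.succ_le_succ (Nat.zero_le n)
  set c := Real.exp (σ * r) * N with hc
  have hexp1 : 1 ≤ Real.exp (σ * r) := Real.one_le_exp (by positivity)
  have hc1 : 1 ≤ c := by rw [hc]; nlinarith
  set z : Fin (n + 1) → ℝ := Zv μ n ξ with hz
  obtain ⟨m, -, hm⟩ := Finset.exists_max_image (Finset.univ : Finset (Fin (n + 1)))
    (fun j => |z j|) Finset.univ_nonempty
  set a := |z m| with ha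
  have ha0 : 0 ≤ a := abs_nonneg _
  have hza : ∀ j, |z j| ≤ a := fun j => hm j (Finset.mem_univ j)
  have hzsq : ∀ j, z j ^ 2 ≤ a ^ 2 := fun j => by
    rw [← sq_abs (z j)]; have := hza j; gcongr
  have hW : Wf μ n ξ ≤ N * a ^ 2 := by
    refine (Finset.sum_le_sum fun j _ => hzsq j).trans ?_
    rw [Finset.sum_const, Finset.card_univ, Fintype.card_fin, nsmul_eq_mul]
  have hWc := (Wf_contDiff μ hμ n).continuous
  have hca : 0 ≤ c * a := by positivity
  have hac : a ≤ c * a := by nlinarith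
  -- bounds on the history
  have hZθ : ∀ (θ : Icc (-r) (0:ℝ)) (j : Fin (n + 1)), |Zv μ n (x θ) j| ≤ c * a := by
    intro θ j
    have h1 := Vw_le_apply σ (Wf μ n) hWc x θ
    rw [← hmax] at h1
    have h2 : Wf μ n (x θ) ≤ Real.exp (2 * σ * r) * Wf μ n ξ := by
      have e1 : Wf μ n (x θ) = Real.exp (-(2 * σ * (θ : ℝ))) *
          (Real.exp (2 * σ * (θ : ℝ)) * Wf μ n (x θ)) := by
        rw [← mul_assoc, ← Real.exp_add]; simp
      rw [e1]
      have e2 : Real.exp (-(2 * σ * (θ : ℝ))) ≤ Real.exp (2 * σ * r) := by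
        rw [Real.exp_le_exp]
        have := θ.2.1
        nlinarith
      exact mul_le_mul e2 h1 (mul_nonneg (Real.exp_pos _).le (Wf_nonneg μ n _)) (Real.exp_pos _).le
    apply abs_le_of_sq_le_sq _ hca
    refine (Zv_le_Wf μ n (x θ) j).trans (h2.trans ?_)
    have e3 : Real.exp (2 * σ * r) = Real.exp (σ * r) ^ 2 := by
      rw [← Real.exp_nat_mul]; congr 1; push_cast; ring
    rw [e3, hc]
    calc Real.exp (σ * r) ^ 2 * Wf μ n ξ ≤ Real.exp (σ * r) ^ 2 * (N * a ^ 2) := by gcongr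
      _ ≤ Real.exp (σ * r) ^ 2 * (N ^ 2 * a ^ 2) := by
        gcongr; nlinarith
      _ = _ := by ring
  set e : Fin (n + 1) → ℝ := fun j => if h : j.val + 1 < n + 1 then z ⟨j.val + 1, h⟩ else 0 with he
  have heb : ∀ j, |e j| ≤ c * a := by
    intro j
    simp only [he]
    split_ifs with h
    · exact (hza _).trans hac
    · simpa using hca
  choose! Γ hΓ1 hΓA hΓμ using hP
  set A : Fin (n + 1) → ℝ := fun j => fderiv ℝ (zf μ j.val)
    (prefixEuc (j.val + 1) (Nat.succ_le_succ j.is_le) ξ)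
    (triVec j.val hr f g t d (prefixHist (j.val + 1) (Nat.succ_le_succ j.is_le) x) (e j)) with hA
  set G : Fin (n + 1) → ℝ := fun j =>
    g j.val t d (prefixHist (j.val + 1) (Nat.succ_le_succ j.is_le) x) with hG
  set M : Fin (n + 1) → ℝ := fun j =>
    μ j.val (prefixEuc (j.val + 1) (Nat.succ_le_succ j.is_le) ξ) with hM
  have hGpos : ∀ j, 0 < G j := fun j => H.g_pos j.is_le ht hd _
  have hMpos : ∀ j, 0 < M j := fun j => hpos _ _
  have hbounds : ∀ i j : Fin (n + 1), j ≤ i →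
      1 / Γ i.val (c * a) ≤ G j ∧ |A j| ≤ Γ i.val (c * a) * (c * a) := by
    intro i j hji
    exact (hΓA i.val i.is_le (c * a) hca j.val hji).2 t ht d hd (c * a) hca le_rfl
      (prefixHist (j.val + 1) (Nat.succ_le_succ j.is_le) x) (e j) (heb j)
      (fun θ p => hZθ θ ⟨p.val, lt_of_lt_of_le p.isLt (Nat.succ_le_succ j.is_le)⟩)
  have hMlow : ∀ i : Fin (n + 1), m ≤ i → Γ i.val (c * a) * (N * c * Γ i.val (c * a) + N + N * σ +
      c ^ 2 * Γ i.val (c * a) ^ 2) ≤ M i := by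
    intro i hmi
    exact hΓμ i.val i.is_le (prefixEuc (i.val + 1) (Nat.succ_le_succ i.is_le) ξ)
      ⟨m.val, Nat.lt_succ_of_le hmi⟩
  have hfd : ∀ j, fderiv ℝ (zf μ j.val) (prefixEuc (j.val + 1) (Nat.succ_le_succ j.is_le) ξ)
      (prefixEuc (j.val + 1) (Nat.succ_le_succ j.is_le) (triVec n hr f g t d x (kf μ n ξ))) =
      A j + G j * (-(M j * z j)) := by
    intro j
    rw [prefix_triVec hr t d x _ j, ← hξ, ctrl_split μ ξ j,
      triVec_fderiv_split hr μ hμ t d j.val _ _ _ _]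
  rw [Wf_fderiv μ hμ n]
  set Γm := Γ m.val (c * a) with hΓm
  have hΓm1 : 1 ≤ Γm := hΓ1 m.val m.is_le _
  have hterm : ∀ j, z j * (A j + G j * (-(M j * z j))) ≤ (c * Γm + 1) * a ^ 2 +
      (if j = m then -(N * (c * Γm + 1 + σ) * a ^ 2) else 0) := by
    intro j
    have hGM : 0 ≤ G j * M j * z j ^ 2 := by
      have := hGpos j; have := hMpos j; positivity
    have hexpand : z j * (A j + G j * (-(M j * z j))) = z j * A j - G j * M j * z j ^ 2 := by ring
    rw [hexpand]
    have hzA : z j * A j ≤ |z j| * |A j| := by rw [← abs_mul]; exact le_abs_self _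
    have hlow : ∀ i : Fin (n + 1), m ≤ i → j = i →
        (N * c * Γ i.val (c * a) + N + N * σ + c ^ 2 * Γ i.val (c * a) ^ 2) ≤ G j * M j := by
      rintro i hmi rfl
      have g1 := (hbounds j j le_rfl).1
      have g2 := hMlow j hmi
      have g3 := hΓ1 j.val j.is_le (c * a)
      have g4 : 0 < Γ j.val (c * a) := by linarith
      have g5 := mul_le_mul g1 g2 (by positivity) (hGpos j).le
      rwa [← mul_assoc, one_div, inv_mul_cancel₀ g4.ne', one_mul] at g5
    rcases lt_trichotomy j m with hlt | heq | hgt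
    · rw [if_neg hlt.ne]
      have b1 := (hbounds m j hlt.le).2
      have b2 := mul_le_mul (hza j) b1 (abs_nonneg _) ha0
      nlinarith
    · rw [if_pos heq]
      have b1 := (hbounds m j heq.le).2
      have b2 := mul_le_mul (hza j) b1 (abs_nonneg _) ha0
      have b3 := hlow m le_rfl heq
      have b4 : z j ^ 2 = a ^ 2 := by rw [heq, ha, sq_abs]
      rw [b4]
      have b5 := mul_le_mul_of_nonneg_right b3 (sq_nonneg a)
      have b6 : 0 ≤ c ^ 2 * Γm ^ 2 * a ^ 2 := by positivity
      nlinarith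
    · rw [if_neg hgt.ne']
      have b1 := (hbounds j j le_rfl).2
      have b2 := mul_le_mul_of_nonneg_left b1 (abs_nonneg (z j))
      have b3 := hlow j hgt.le rfl
      set Γj := Γ j.val (c * a) with hΓj
      have hΓj1 : 1 ≤ Γj := hΓ1 j.val j.is_le _
      have b5 := mul_le_mul_of_nonneg_right b3 (sq_nonneg (z j))
      have b6 : 0 ≤ (N * c * Γj + N + N * σ) * z j ^ 2 := by positivity
      have b7 : c ^ 2 * Γj ^ 2 * z j ^ 2 = (c * Γj * |z j|) ^ 2 := by
        rw [show (c * Γj * |z j|) ^ 2 = c ^ 2 * Γj ^ 2 * |z j| ^ 2 by ring, sq_abs]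
      have b8 : |z j| * (Γj * (c * a)) = (c * Γj * |z j|) * a := by ring
      have b9 : 0 ≤ c * Γm * a ^ 2 := by positivity
      nlinarith [sq_nonneg (c * Γj * |z j| - a / 2)]
  have hsum := Finset.sum_le_sum fun j (_ : j ∈ (Finset.univ : Finset (Fin (n + 1)))) => hterm j
  rw [Finset.sum_add_distrib, Finset.sum_const, Finset.card_univ, Fintype.card_fin, nsmul_eq_mul,
    Finset.sum_ite_eq' Finset.univ m, if_pos (Finset.mem_univ m), ← hN] at hsum
  have hfin : ∑ j : Fin (n + 1), Zv μ n ξ j *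
      fderiv ℝ (zf μ j.val) (prefixEuc (j.val + 1) (Nat.succ_le_succ j.is_le) ξ)
        (prefixEuc (j.val + 1) (Nat.succ_le_succ j.is_le) (triVec n hr f g t d x (kf μ n ξ))) =
      ∑ j, z j * (A j + G j * (-(M j * z j))) :=
    Finset.sum_congr rfl fun j _ => by rw [hfd j]
  rw [hfin]
  nlinarith

theorem star_open (H : TriHyp n D f g φf) {σ : ℝ} (hσ : 0 < σ)
    (μ : (i : ℕ) → Euc (i + 1) → ℝ) (hμ : ∀ j, ContDiff ℝ (⊤ : ℕ∞) (μ j)) (hpos : ∀ j ξ, 0 < μ j ξ)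
    (hP : ∀ j, j ≤ n → PPr hr D f g (Real.exp (σ * r) * ((n + 1 : ℕ) : ℝ)) ((n + 1 : ℕ) : ℝ) σ μ j)
    (t : ℝ) (ht : 0 ≤ t) (d : Euc l) (hd : d ∈ D) (x : Hist (n + 1) r)
    (hmax : Wf μ n (x (zeroIcc hr)) = Vw σ (Wf μ n) x) (u : ℝ) :
    fderiv ℝ (Wf μ n) (x (zeroIcc hr)) (triVec n hr f g t d x u) ≤
      -(2 * σ) * Wf μ n (x (zeroIcc hr)) +
        φf ‖x‖ * ‖fderiv ℝ (Wf μ n) (x (zeroIcc hr))‖ * |u - kf μ n (x (zeroIcc hr))| := by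
  set ξ := x (zeroIcc hr) with hξ
  have h1 := star_closed hr H hσ μ hμ hpos hP t ht d hd x hmax
  rw [← hξ] at h1
  set E : Euc (n + 1) := EuclideanSpace.single (Fin.last n) (1:ℝ) with hE
  have hgx := H.g_bound n le_rfl t ht d hd x
  have hg0 := H.g_pos le_rfl ht hd x
  have h2 : triVec n hr f g t d x u = triVec n hr f g t d x (kf μ n ξ) +
      (g n t d x * (u - kf μ n ξ)) • E := by
    ext k
    simp only [triVec, PiLp.add_apply, PiLp.smul_apply, smul_eq_mul, hE, EuclideanSpace.single_apply]
    by_cases h : k.val + 1 < n + 1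
    · rw [dif_pos h, dif_pos h, if_neg (fun hk => by rw [hk] at h; simp at h)]
      ring
    · obtain rfl : k = Fin.last n := Fin.ext (by have := k.isLt; simp; omega)
      rw [dif_neg h, dif_neg h, if_pos rfl]
      have : prefixHist ((Fin.last n).val + 1) (Nat.succ_le_succ (Fin.last n).is_le) x = x := rfl
      rw [this]
      show f n t d x + g n t d x * u = f n t d x + g n t d x * _ + g n t d x * _ * 1
      ring
  rw [h2, map_add, map_smul, smul_eq_mul]
  have h3 : |fderiv ℝ (Wf μ n) ξ E| ≤ ‖fderiv ℝ (Wf μ n) ξ‖ := by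
    have := (fderiv ℝ (Wf μ n) ξ).le_opNorm E
    rwa [hE, EuclideanSpace.norm_single, norm_one, mul_one, Real.norm_eq_abs] at this
  have h4 : g n t d x * (u - kf μ n ξ) * fderiv ℝ (Wf μ n) ξ E ≤
      φf ‖x‖ * ‖fderiv ℝ (Wf μ n) ξ‖ * |u - kf μ n ξ| := by
    refine (le_abs_self _).trans ?_
    rw [abs_mul, abs_mul, abs_of_pos hg0]
    calc _ ≤ φf ‖x‖ * |u - kf μ n ξ| * ‖fderiv ℝ (Wf μ n) ξ‖ := by
          exact mul_le_mul (mul_le_mul_of_nonneg_right hgx.2 (abs_nonneg _)) h3 (abs_nonneg _)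
            (mul_nonneg (H.φ_pos ‖x‖ (norm_nonneg x)).le (abs_nonneg _))
      _ = _ := by ring
  linarith
end tri2


theorem kf_contDiff (μ : (i : ℕ) → Euc (i + 1) → ℝ) (hμ : ∀ j, ContDiff ℝ (⊤ : ℕ∞) (μ j)) (i : ℕ) :
    ContDiff ℝ (⊤ : ℕ∞) (kf μ i) :=
  ((hμ i).neg).mul (zf_contDiff μ hμ i)

theorem kf_zero (μ : (i : ℕ) → Euc (i + 1) → ℝ) (i : ℕ) : kf μ i 0 = 0 := by
  simp [kf, zf_zero]

section tri3
variable {n l : ℕ} {r : ℝ} (hr : 0 < r) {D : Set (Euc l)}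
    {f g : (i : ℕ) → ℝ → Euc l → Hist (i + 1) r → ℝ} {φf : ℝ → ℝ}

theorem closed_cont (H : TriHyp n D f g φf) (κ : Euc (n + 1) → ℝ) (hκ : Continuous κ) :
    ContinuousOn (fun p : ℝ × Euc l × Hist (n + 1) r =>
      triVec n hr f g p.1 p.2.1 p.2.2 (κ (p.2.2 (zeroIcc hr)))) (Ici 0 ×ˢ D ×ˢ univ) := by
  have hev : Continuous (fun p : ℝ × Euc l × Hist (n + 1) r => p.2.2 (zeroIcc hr)) :=
    (continuous_eval_const (zeroIcc hr)).comp (continuous_snd.comp continuous_snd)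
  refine (PiLp.continuous_toLp 2 _).comp_continuousOn (continuousOn_pi.2 fun i => ?_)
  have hp : Continuous (fun p : ℝ × Euc l × Hist (n + 1) r => ((p.1, p.2.1,
      prefixHist (i.val + 1) (Nat.succ_le_succ i.is_le) p.2.2) : ℝ × Euc l × Hist (i.val + 1) r)) :=
    continuous_fst.prodMk ((continuous_fst.comp continuous_snd).prodMk
      ((prefixHist_continuous _).comp (continuous_snd.comp continuous_snd)))
  have hm : MapsTo (fun p : ℝ × Euc l × Hist (n + 1) r => ((p.1, p.2.1,
      prefixHist (i.val + 1) (Nat.succ_le_succ i.is_le) p.2.2) : ℝ × Euc l × Hist (i.val + 1) r))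
      (Ici 0 ×ˢ D ×ˢ univ) (Ici 0 ×ˢ D ×ˢ univ) := fun p hp => ⟨hp.1, hp.2.1, mem_univ _⟩
  have h1 := (H.f_cont i.val i.is_le).comp hp.continuousOn hm
  have h2 := (H.g_cont i.val i.is_le).comp hp.continuousOn hm
  refine h1.add (h2.mul ?_)
  by_cases h : i.val + 1 < n + 1
  · simp only [dif_pos h]
    exact ((EuclideanSpace.proj (𝕜 := ℝ) (⟨i.val + 1, h⟩ : Fin (n + 1))).continuous.comp
      hev).continuousOn
  · simp only [dif_neg h]
    exact (hκ.comp hev).continuousOn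

theorem closed_lip (H : TriHyp n D f g φf) (κ : Euc (n + 1) → ℝ)
    (hκ : ContDiff ℝ (⊤ : ℕ∞) κ) :
    ∀ T, 0 ≤ T → ∀ R, 0 ≤ R → ∃ L, ∀ t ∈ Icc (0:ℝ) T, ∀ d ∈ D, ∀ x y : Hist (n + 1) r,
      ‖x‖ ≤ R → ‖y‖ ≤ R → ‖triVec n hr f g t d x (κ (x (zeroIcc hr))) -
        triVec n hr f g t d y (κ (y (zeroIcc hr)))‖ ≤ L * ‖x - y‖ := by
  intro T hT R hR
  obtain ⟨Lk, hLk0, hLk⟩ := aux_lip_ball κ hκ R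
  obtain ⟨Ck, hCk0, hCk⟩ := aux_ball_bound κ hκ.continuous R
  have hφ := (H.φ_pos R hR).le
  have key : ∀ i : Fin (n + 1), ∃ L, 0 ≤ L ∧ ∀ t ∈ Icc (0:ℝ) T, ∀ d ∈ D,
      ∀ x y : Hist (n + 1) r, ‖x‖ ≤ R → ‖y‖ ≤ R →
      |triVec n hr f g t d x (κ (x (zeroIcc hr))) i -
        triVec n hr f g t d y (κ (y (zeroIcc hr))) i| ≤ L * ‖x - y‖ := by
    intro i
    obtain ⟨Lf, hLf⟩ := H.f_lip i.val i.is_le R hR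
    obtain ⟨Lg, hLg⟩ := H.g_lip i.val i.is_le T hT R hR
    refine ⟨|Lf| + (φf R * (1 + Lk) + |Lg| * (R + Ck)), by positivity, ?_⟩
    intro t ht d hd x y hx hy
    have hi : i.val + 1 ≤ n + 1 := Nat.succ_le_succ i.is_le
    have px := (prefixHist_norm hi x).trans hx
    have py := (prefixHist_norm hi y).trans hy
    have pxy : ‖prefixHist (i.val + 1) hi x - prefixHist (i.val + 1) hi y‖ ≤ ‖x - y‖ := by
      rw [prefixHist_sub]; exact prefixHist_norm hi _
    have x0 := (x.norm_coe_le_norm (zeroIcc hr)).trans hx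
    have y0 := (y.norm_coe_le_norm (zeroIcc hr)).trans hy
    have xy0 : ‖x (zeroIcc hr) - y (zeroIcc hr)‖ ≤ ‖x - y‖ := (x - y).norm_coe_le_norm (zeroIcc hr)
    have e1 : |f i.val t d (prefixHist (i.val + 1) hi x) - f i.val t d (prefixHist (i.val + 1) hi y)|
        ≤ |Lf| * ‖x - y‖ :=
      (hLf t ht.1 d hd _ _ px py).trans (mul_le_mul (le_abs_self _) pxy (norm_nonneg _)
        (abs_nonneg _))
    have e2 : |g i.val t d (prefixHist (i.val + 1) hi x) - g i.val t d (prefixHist (i.val + 1) hi y)|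
        ≤ |Lg| * ‖x - y‖ :=
      (hLg t ht d hd _ _ px py).trans (mul_le_mul (le_abs_self _) pxy (norm_nonneg _)
        (abs_nonneg _))
    have e3 : |g i.val t d (prefixHist (i.val + 1) hi x)| ≤ φf R := by
      rw [abs_of_pos (H.g_pos i.is_le ht.1 hd _)]
      exact (H.g_bound i.val i.is_le t ht.1 d hd _).2.trans
        (H.φ_mono (mem_Ici.2 (norm_nonneg _)) (mem_Ici.2 hR) px)
    set cx := (if h : i.val + 1 < n + 1 then x (zeroIcc hr) ⟨i.val + 1, h⟩
      else κ (x (zeroIcc hr))) with hcx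
    set cy := (if h : i.val + 1 < n + 1 then y (zeroIcc hr) ⟨i.val + 1, h⟩
      else κ (y (zeroIcc hr))) with hcy
    have e4 : |cx - cy| ≤ (1 + Lk) * ‖x - y‖ := by
      by_cases h : i.val + 1 < n + 1
      · rw [hcx, hcy, dif_pos h, dif_pos h]
        have := aux_coord_le (x (zeroIcc hr) - y (zeroIcc hr)) ⟨i.val + 1, h⟩
        rw [PiLp.sub_apply] at this
        have := this.trans xy0
        nlinarith [norm_nonneg (x - y)]
      · rw [hcx, hcy, dif_neg h, dif_neg h]
        have := hLk _ _ x0 y0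
        rw [Real.norm_eq_abs] at this
        nlinarith [norm_nonneg (x - y), mul_le_mul_of_nonneg_left xy0 hLk0]
    have e5 : |cy| ≤ R + Ck := by
      by_cases h : i.val + 1 < n + 1
      · rw [hcy, dif_pos h]
        have := aux_coord_le (y (zeroIcc hr)) ⟨i.val + 1, h⟩
        linarith
      · rw [hcy, dif_neg h]
        have := hCk _ y0
        rw [Real.norm_eq_abs] at this
        linarith
    have hx' : triVec n hr f g t d x (κ (x (zeroIcc hr))) i =
      f i.val t d (prefixHist (i.val + 1) hi x) + g i.val t d (prefixHist (i.val + 1) hi x) * cx := rfl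
    have hy' : triVec n hr f g t d y (κ (y (zeroIcc hr))) i =
      f i.val t d (prefixHist (i.val + 1) hi y) + g i.val t d (prefixHist (i.val + 1) hi y) * cy := rfl
    rw [hx', hy']
    generalize f i.val t d (prefixHist (i.val + 1) hi x) = fx at *
    generalize f i.val t d (prefixHist (i.val + 1) hi y) = fy at *
    generalize g i.val t d (prefixHist (i.val + 1) hi x) = gx at *
    generalize g i.val t d (prefixHist (i.val + 1) hi y) = gy at *
    have e6 : fx + gx * cx - (fy + gy * cy) = (fx - fy) + (gx * (cx - cy) + (gx - gy) * cy) := by ring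
    rw [e6]
    refine (abs_add_le _ _).trans ?_
    have e7 := abs_add_le (gx * (cx - cy)) ((gx - gy) * cy)
    rw [abs_mul, abs_mul] at e7
    have e8 : |gx| * |cx - cy| ≤ φf R * ((1 + Lk) * ‖x - y‖) :=
      mul_le_mul e3 e4 (abs_nonneg _) hφ
    have e9 : |gx - gy| * |cy| ≤ |Lg| * ‖x - y‖ * (R + Ck) :=
      mul_le_mul e2 e5 (abs_nonneg _) (by positivity)
    nlinarith
  choose L hL0 hL using key
  refine ⟨((n + 1 : ℕ) : ℝ) * ∑ i, L i, fun t ht d hd x y hx hy => ?_⟩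
  have h0 : 0 ≤ ∑ i, L i := Finset.sum_nonneg fun i _ => hL0 i
  rw [mul_assoc]
  refine aux_norm_le_card _ _ (by positivity) fun i => ?_
  rw [PiLp.sub_apply]
  refine (hL i t ht d hd x y hx hy).trans (mul_le_mul_of_nonneg_right ?_ (norm_nonneg _))
  exact Finset.single_le_sum (f := L) (fun i _ => hL0 i) (Finset.mem_univ i)

end tri3

theorem Vw_upper {N : ℕ} {r σ : ℝ} (hr : 0 < r) (hσ : 0 < σ) (W : Euc N → ℝ) (hc : Continuous W)
    (h0 : W 0 = 0) (hn : ∀ ξ, 0 ≤ W ξ) :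
    ∃ a, IsKinf a ∧ ∀ x : Hist N r, Vw σ W x ≤ a ‖x‖ := by
  obtain ⟨a, ha, hle⟩ := aux_Kup W hc h0
  refine ⟨a, ha, fun x => Vw_le hr σ W x _ fun θ => ?_⟩
  have h1 := aux_exp_le_one hσ θ
  have h2 : a ‖x θ‖ ≤ a ‖x‖ := ha.2.1.monotoneOn (mem_Ici.2 (norm_nonneg _))
    (mem_Ici.2 (norm_nonneg _)) (x.norm_coe_le_norm θ)
  have h3 := mul_le_mul_of_nonneg_right h1 (hn (x θ))
  linarith [hle (x θ)]

theorem Vw_point {N : ℕ} {r σ : ℝ} (hσ : 0 < σ) (W : Euc N → ℝ) (hc : Continuous W)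
    (hn : ∀ ξ, 0 ≤ W ξ) (x : Hist N r) (θ : Icc (-r) (0:ℝ)) :
    Real.exp (-(2 * σ * r)) * W (x θ) ≤ Vw σ W x := by
  refine le_trans ?_ (Vw_le_apply σ W hc x θ)
  refine mul_le_mul_of_nonneg_right (Real.exp_le_exp.2 ?_) (hn _)
  have := θ.2.1
  nlinarith

theorem Vw_lower {N : ℕ} {r σ : ℝ} (hr : 0 < r) (hσ : 0 < σ) (W : Euc N → ℝ) (hc : Continuous W)
    (h0 : W 0 = 0) (hn : ∀ ξ, 0 ≤ W ξ) (hpos : ∀ ξ, W ξ = 0 → ξ = 0)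
    (hprop : ∀ R, ∃ B, ∀ ξ, W ξ ≤ R → ‖ξ‖ ≤ B) :
    ∃ a, IsKinf a ∧ ∀ x : Hist N r, a ‖x‖ ≤ Vw σ W x := by
  obtain ⟨a, ha, hle⟩ := aux_Klow W hc h0 hn hpos hprop
  have he := Real.exp_pos (-(2 * σ * r))
  refine ⟨fun s => Real.exp (-(2 * σ * r)) * a s, ⟨continuousOn_const.mul ha.1, ?_, ?_, ?_⟩,
    fun x => ?_⟩
  · exact fun s hs t ht hst => mul_lt_mul_of_pos_left (ha.2.1 hs ht hst) he
  · simp [ha.2.2.1]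
  · exact ha.2.2.2.const_mul_atTop he
  · haveI : Nonempty (Icc (-r) (0:ℝ)) := ⟨zeroIcc hr⟩
    obtain ⟨θ, hθ⟩ : ∃ θ, ‖x‖ = ‖x θ‖ := by
      obtain ⟨θ, -, hθ⟩ := isCompact_univ.exists_isMaxOn (univ_nonempty)
        (x.continuous.norm.continuousOn (s := univ))
      exact ⟨θ, le_antisymm ((ContinuousMap.norm_le _ (norm_nonneg _)).2
        fun η => hθ (mem_univ η)) (x.norm_coe_le_norm θ)⟩
    rw [hθ]
    refine le_trans ?_ (Vw_point hσ W hc hn x θ)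
    exact mul_le_mul_of_nonneg_left (hle _) he.le


theorem aux_convex_far {N : ℕ} (u lam : Fin N → ℝ) (k : ℝ) (h0 : ∀ i, 0 ≤ lam i)
    (h1 : ∑ i, lam i = 1) : ∃ i, |(∑ i, lam i * u i) - k| ≤ |u i - k| := by
  by_contra hcon
  push Not at hcon
  set S := |(∑ i, lam i * u i) - k| with hS
  have e1 : (∑ i, lam i * u i) - k = ∑ i, lam i * (u i - k) := by
    simp only [mul_sub, Finset.sum_sub_distrib, ← Finset.sum_mul, h1, one_mul]
  have e2 : S ≤ ∑ i, lam i * |u i - k| := by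
    rw [hS, e1]
    refine (Finset.abs_sum_le_sum_abs _ _).trans (le_of_eq ?_)
    exact Finset.sum_congr rfl fun i _ => by rw [abs_mul, abs_of_nonneg (h0 i)]
  obtain ⟨i, -, hi⟩ : ∃ i ∈ (Finset.univ : Finset (Fin N)), lam i ≠ 0 := by
    apply Finset.exists_ne_zero_of_sum_ne_zero
    rw [h1]; exact one_ne_zero
  have e3 : ∑ i, lam i * |u i - k| < ∑ i, lam i * S := by
    refine Finset.sum_lt_sum (fun j _ => mul_le_mul_of_nonneg_left (hcon j).le (h0 j))
      ⟨i, Finset.mem_univ i, ?_⟩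
    exact mul_lt_mul_of_pos_left (hcon i) (lt_of_le_of_ne (h0 i) (Ne.symm hi))
  rw [← Finset.sum_mul, h1, one_mul] at e3
  linarith

theorem aux_gain {N : ℕ} {r σ : ℝ} (hr : 0 < r) (hσ : 0 < σ) (W : Euc N → ℝ) (hc : Continuous W)
    (hn : ∀ ξ, 0 ≤ W ξ) (hprop : ∀ R, ∃ B, ∀ ξ, W ξ ≤ R → ‖ξ‖ ≤ B) (φf : ℝ → ℝ)
    (hφ : MonotoneOn φf (Ici 0)) :
    ∃ G : Euc N → ℝ, Continuous G ∧ ∀ x : Hist N r, W (x (zeroIcc hr)) = Vw σ W x →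
      φf ‖x‖ ≤ G (x (zeroIcc hr)) := by
  obtain ⟨Γ, hΓm, hΓ1, hΓ⟩ := aux_exists_mono_bound (P := fun R B => ∀ ξ, W ξ ≤ R → ‖ξ‖ ≤ B)
    (fun R _ => hprop R)
    (fun R R' C C' _ hR hC h ξ hξ => (h ξ (hξ.trans hR)).trans hC)
  obtain ⟨G, hG, hQ⟩ := aux_smooth_majorant
    (fun ξ => φf (Γ (Real.exp (2 * σ * r) * W ξ))) (fun ξ => by
      refine ⟨φf (Γ (Real.exp (2 * σ * r) * (W ξ + 1))), ?_⟩
      filter_upwards [hc.continuousAt.eventually (Iio_mem_nhds (lt_add_one (W ξ)))] with η hη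
      refine hφ (mem_Ici.2 (zero_le_one.trans (hΓ1 _))) (mem_Ici.2 (zero_le_one.trans (hΓ1 _)))
        (hΓm (mul_le_mul_of_nonneg_left (le_of_lt hη) (Real.exp_pos _).le)))
  refine ⟨G, hG.continuous, fun x hx => le_trans ?_ (hQ _).le⟩
  refine hφ (mem_Ici.2 (norm_nonneg _)) (mem_Ici.2 (zero_le_one.trans (hΓ1 _))) ?_
  refine (ContinuousMap.norm_le _ (zero_le_one.trans (hΓ1 _))).2 fun θ => ?_
  refine hΓ _ (mul_nonneg (Real.exp_pos _).le (hn _)) _ ?_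
  have h := Vw_point hσ W hc hn x θ
  rw [← hx] at h
  have h2 := mul_le_mul_of_nonneg_left h (Real.exp_pos (2 * σ * r)).le
  rwa [← mul_assoc, ← Real.exp_add, add_neg_cancel, Real.exp_zero, one_mul] at h2

section tri4
variable {n l : ℕ} {r : ℝ} (hr : 0 < r) {D : Set (Euc l)}
    {f g : (i : ℕ) → ℝ → Euc l → Hist (i + 1) r → ℝ} {φf : ℝ → ℝ}

theorem tri_orclf (H : TriHyp n D f g φf) {σ : ℝ} (hσ : 0 < σ)
    (μ : (i : ℕ) → Euc (i + 1) → ℝ) (hμ : ∀ j, ContDiff ℝ (⊤ : ℕ∞) (μ j)) (hpos : ∀ j ξ, 0 < μ j ξ)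
    (hP : ∀ j, j ≤ n → PPr hr D f g (Real.exp (σ * r) * ((n + 1 : ℕ) : ℝ)) ((n + 1 : ℕ) : ℝ) σ μ j)
    (a₁ a₂ : ℝ → ℝ) (ha₁ : IsKinf a₁) (ha₂ : IsKinf a₂)
    (hV₁ : ∀ y : Hist (n + 1) r, a₁ ‖y‖ ≤ Vw σ (Wf μ n) y)
    (hV₂ : ∀ y : Hist (n + 1) r, Vw σ (Wf μ n) y ≤ a₂ ‖y‖) :
    ∃ (a₁ a₂ β μc : ℝ → ℝ) (p : ℕ) (Ψ : ℝ → Euc p → Euc 1 → EReal)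
      (Φ : ℝ → Hist (n + 1) r → Euc p) (q ρ : ℝ → ℝ) (a γ : ℝ → ℝ),
      ORCLFrfde r D (univ : Set (Euc 1))
        (fun t d x u => triVec n hr f g t d x (u 0))
        (fun _ x => x) (fun _ x => Vw σ (Wf μ n) x) a₁ a₂ β μc Ψ Φ q ρ ∧
      SmallControlRFDE (univ : Set (Euc 1)) Ψ q a γ := by
  have hWs := Wf_contDiff μ hμ n
  have hWc : Continuous (Wf μ n) := hWs.continuous
  have hWn : ∀ ξ, 0 ≤ Wf μ n ξ := fun ξ => Wf_nonneg μ n ξ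
  have hk := (kf_contDiff μ hμ n).continuous
  obtain ⟨G, hGc, hG⟩ := aux_gain (r := r) hr hσ (Wf μ n) hWc hWn (Wf_proper μ hμ n) φf H.φ_mono
  set C : Euc (n + 1) → ℝ := fun ξ => |G ξ| * ‖fderiv ℝ (Wf μ n) ξ‖ with hC
  have hCc : Continuous C := hGc.abs.mul (hWs.continuous_fderiv (by simp)).norm
  have hC0 : ∀ ξ, 0 ≤ C ξ := fun ξ => by positivity
  obtain ⟨a, ha, hak⟩ := aux_Kup (fun ξ => |kf μ n ξ|) hk.abs (by simp [kf_zero])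
  have hone : IsKplus (fun _ => (1:ℝ)) := ⟨continuousOn_const, fun _ _ => one_pos⟩
  have hΨk : ∀ (ξ : Euc (n + 1)),
      (((C ξ * |(EuclideanSpace.single (0 : Fin 1) (kf μ n ξ) : Euc 1) 0 - kf μ n ξ| : ℝ)) : EReal)
        = ((0:ℝ) : EReal) := by
    intro ξ
    simp
  refine ⟨a₁, a₂, fun _ => 1, fun _ => 1, n + 1,
    fun _ ξ u => ((C ξ * |u 0 - kf μ n ξ| : ℝ) : EReal), fun _ x => x (zeroIcc hr),
    fun _ => 0, fun s => 2 * σ * s, a, fun _ => 1, ⟨?_, ?_, ha₁, ha₂, hone, hone, ?_, ?_, ?_, ?_, ?_,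
      ?_, ?_, ?_, ?_, ?_, ?_⟩, ⟨ha, hone, ?_⟩⟩
  · exact Vw_almostLipschitz hr hσ _ hWs
  · exact fun _ x => Vw_nonneg hr σ _ hWc hWn x
  · intro t _ x
    simp only [one_mul, max_self]
    exact ⟨hV₁ x, hV₂ x⟩
  · exact ⟨continuousOn_const, fun _ _ => le_rfl, integrableOn_zero, tendsto_const_nhds⟩
  · refine ⟨by fun_prop, by simp, fun s hs => by positivity, fun s hs => by positivity⟩
  · exact fun t φ u => EReal.coe_ne_bot _
  · intro t _
    simp [kf_zero]
  · intro u _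
    refine Continuous.continuousOn ?_ |>.upperSemicontinuousOn
    refine continuous_coe_real_ereal.comp ?_
    exact (hCc.comp continuous_snd).mul (continuous_const.sub (hk.comp continuous_snd)).abs
  · exact ((continuous_eval_const (zeroIcc hr)).comp continuous_snd).continuousOn
  · intro T _ R _
    refine ⟨1, fun t _ x y _ _ => ?_⟩
    rw [one_mul]
    exact (x - y).norm_coe_le_norm (zeroIcc hr)
  · exact fun _ _ => rfl
  · intro t _ ξ
    exact (iInf_le _ ⟨EuclideanSpace.single (0 : Fin 1) (kf μ n ξ), mem_univ _⟩).trans (hΨk ξ).le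
  · intro t ht x N u _ lam hl0 hl1 d hd
    have hsum : (∑ i, lam i • u i) 0 = ∑ i, lam i * (u i) 0 := by
      simp
    beta_reduce
    rw [hsum]
    set ub := ∑ i, lam i * (u i) 0 with hub
    set ξ := x (zeroIcc hr) with hξ
    obtain ⟨i, hi⟩ := aux_convex_far (fun i => (u i) 0) lam (kf μ n ξ) hl0 hl1
    refine (Vw_dini hr hσ (Wf μ n) hWs hWn x _ (C ξ * |ub - kf μ n ξ|)
      (mul_nonneg (hC0 _) (abs_nonneg _)) (fun hmax => ?_) t).trans ?_
    · refine (star_open hr H hσ μ hμ hpos hP t ht d hd x hmax ub).trans ?_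
      refine add_le_add le_rfl (mul_le_mul_of_nonneg_right
        (mul_le_mul_of_nonneg_right ((hG x hmax).trans (le_abs_self _)) (norm_nonneg _))
        (abs_nonneg _))
    · rw [EReal.coe_add, neg_mul]
      refine add_le_add le_rfl ?_
      refine le_trans ?_ (le_iSup (fun i => (((C ξ * |(u i) 0 - kf μ n ξ| : ℝ)) : EReal)) i)
      exact EReal.coe_le_coe_iff.2 (mul_le_mul_of_nonneg_left hi (hC0 _))
  · intro t _ ξ
    refine ⟨EuclideanSpace.single (0 : Fin 1) (kf μ n ξ), mem_univ _, ?_, (hΨk ξ).le⟩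
    rw [one_mul, EuclideanSpace.norm_single, Real.norm_eq_abs]
    exact hak ξ

end tri4


theorem kf_succ (μ : (i : ℕ) → Euc (i + 1) → ℝ) (i : ℕ) (ξ : Euc (i + 1 + 1)) :
    kf μ (i + 1) ξ = -(μ (i + 1) ξ) * (ξ (Fin.last (i + 1)) -
      kf μ i (WithLp.toLp 2 fun j : Fin (i + 1) => ξ j.castSucc)) := by
  have h : zf μ (i + 1) ξ = ξ (Fin.last (i + 1)) -
      kf μ i (WithLp.toLp 2 fun j : Fin (i + 1) => ξ j.castSucc) := by
    have e : (WithLp.toLp 2 fun j : Fin (i + 1) => ξ j.castSucc : Euc (i + 1)) =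
      prefixEuc (i + 1) (Nat.le_succ _) ξ := rfl
    rw [e]
    simp only [kf, zf]
    ring
  rw [← h]
  rfl

theorem Vtri_eq {n : ℕ} {r : ℝ} (σ : ℝ) (μ : (i : ℕ) → Euc (i + 1) → ℝ) (x : Hist (n + 1) r) :
    Vtri n σ (kf μ) x = Vw σ (Wf μ n) x := by
  unfold Vtri Vw
  congr 1
  funext θ
  congr 1
  rw [Wf, Fin.sum_univ_succ]
  congr 1
  refine Finset.sum_congr rfl fun j _ => ?_
  congr 1
  have h : Zv μ n (x θ) j.succ = x θ j.succ + μ j.val (prefixEuc (j.val + 1)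
      (Nat.succ_le_succ (le_of_lt j.isLt)) (x θ)) * zf μ j.val (prefixEuc (j.val + 1)
      (Nat.succ_le_succ (le_of_lt j.isLt)) (x θ)) := rfl
  rw [h, kf]
  ring

/-- Theorem 5.1: backstepping design of a delay-free stabilizing feedback and of a State
Robust Control Lyapunov Functional for the triangular time-delay system (1.4) (here with
n+1 states x₁,…,x_{n+1}). -/
theorem stmt15 {n l : ℕ} (r : ℝ) (hr : 0 < r)
    (D : Set (Euc l)) (hD : IsCompact D) (hDne : D.Nonempty)
    (f g : (i : ℕ) → ℝ → Euc l → Hist (i + 1) r → ℝ)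
    (hf_cont : ∀ i, i ≤ n → ContinuousOn
      (fun p : ℝ × Euc l × Hist (i + 1) r => f i p.1 p.2.1 p.2.2) (Ici 0 ×ˢ D ×ˢ univ))
    (hg_cont : ∀ i, i ≤ n → ContinuousOn
      (fun p : ℝ × Euc l × Hist (i + 1) r => g i p.1 p.2.1 p.2.2) (Ici 0 ×ˢ D ×ˢ univ))
    (hf0 : ∀ i, i ≤ n → ∀ t : ℝ, 0 ≤ t → ∀ d ∈ D, f i t d 0 = 0)
    -- each gᵢ is completely locally Lipschitz with respect to x
    (hg_lip : ∀ i, i ≤ n → ∀ T, 0 ≤ T → ∀ R, 0 ≤ R → ∃ L, ∀ t ∈ Icc (0:ℝ) T, ∀ d ∈ D,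
      ∀ x y : Hist (i + 1) r, ‖x‖ ≤ R → ‖y‖ ≤ R → |g i t d x - g i t d y| ≤ L * ‖x - y‖)
    -- the smooth nondecreasing positive gauge φ and inequality (5.1)
    (φf : ℝ → ℝ) (hφ_smooth : ContDiffOn ℝ (⊤ : ℕ∞) φf (Ici 0))
    (hφ_mono : MonotoneOn φf (Ici 0)) (hφ_pos : ∀ s, 0 ≤ s → 0 < φf s)
    (hg_bound : ∀ i, i ≤ n → ∀ t : ℝ, 0 ≤ t → ∀ d ∈ D, ∀ x : Hist (i + 1) r,
      1 / φf ‖x‖ ≤ g i t d x ∧ g i t d x ≤ φf ‖x‖)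
    -- inequality (5.2): each fᵢ is Lipschitz on bounded sets, uniformly in (t,d)
    (hf_lip : ∀ i, i ≤ n → ∀ R, 0 ≤ R → ∃ L, ∀ t : ℝ, 0 ≤ t → ∀ d ∈ D,
      ∀ x y : Hist (i + 1) r, ‖x‖ ≤ R → ‖y‖ ≤ R → |f i t d x - f i t d y| ≤ L * ‖x - y‖) :
    ∀ σ : ℝ, 0 < σ →
    ∃ μ : (i : ℕ) → Euc (i + 1) → ℝ,
      (∀ i, i ≤ n → ContDiff ℝ (⊤ : ℕ∞) (μ i) ∧ ∀ ξ, 0 < μ i ξ) ∧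
      ∃ k : (i : ℕ) → Euc (i + 1) → ℝ,
        -- the recursive definition (5.3a), (5.3b) of the feedbacks kⱼ
        (∀ ξ : Euc 1, k 0 ξ = -(μ 0 ξ) * ξ 0) ∧
        (∀ i : ℕ, ∀ ξ : Euc (i + 1 + 1), k (i + 1) ξ =
          -(μ (i + 1) ξ) * (ξ (Fin.last (i + 1)) -
            k i (WithLp.toLp 2 fun j : Fin (i + 1) => ξ j.castSucc))) ∧
        -- (i): the decrease inequality V⁰(x;v) ≤ −2σV(x) along the closed loop
        (∀ t : ℝ, 0 ≤ t → ∀ d ∈ D, ∀ x : Hist (n + 1) r,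
          diniH0 (Vtri n σ k) x (triVec n hr f g t d x (k n (x (zeroIcc hr)))) ≤
            ((-(2 * σ) * Vtri n σ k x : ℝ) : EReal)) ∧
        -- (ii): the closed-loop system with u(t) = k_{n+1}(x(t)) is URGAS
        URGAOSrfde r D (fun t d x => triVec n hr f g t d x (k n (x (zeroIcc hr))))
          (fun _ x => x) ∧
        -- (iii): V is a State Robust Control Lyapunov Functional for (1.4)
        -- satisfying the small-control property
        (∃ (a₁ a₂ β μc : ℝ → ℝ) (p : ℕ) (Ψ : ℝ → Euc p → Euc 1 → EReal)
            (Φ : ℝ → Hist (n + 1) r → Euc p) (q ρ : ℝ → ℝ) (a γ : ℝ → ℝ),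
          ORCLFrfde r D (univ : Set (Euc 1))
            (fun t d x u => triVec n hr f g t d x (u 0))
            (fun _ x => x) (fun _ x => Vtri n σ k x) a₁ a₂ β μc Ψ Φ q ρ ∧
          SmallControlRFDE (univ : Set (Euc 1)) Ψ q a γ) := by
  intro σ hσ
  have H : TriHyp n D f g φf := ⟨hf_cont, hg_cont, hf0, hg_lip, hφ_mono, hφ_pos, hg_bound, hf_lip⟩
  obtain ⟨μ, hμ, hpos, hP⟩ := mu_exists hr H (Real.exp (σ * r) * ((n + 1 : ℕ) : ℝ))
    ((n + 1 : ℕ) : ℝ) σ (by positivity) (by positivity) hσ.le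
  have hWs := Wf_contDiff μ hμ n
  have hWc : Continuous (Wf μ n) := hWs.continuous
  have hWn : ∀ ξ, 0 ≤ Wf μ n ξ := fun ξ => Wf_nonneg μ n ξ
  obtain ⟨a₁, ha₁, hV₁⟩ := Vw_lower (r := r) hr hσ (Wf μ n) hWc (Wf_zero μ n) hWn
    (fun ξ h => Wf_pos μ hμ n ξ h) (Wf_proper μ hμ n)
  obtain ⟨a₂, ha₂, hV₂⟩ := Vw_upper (r := r) hr hσ (Wf μ n) hWc (Wf_zero μ n) hWn
  have hVt : ∀ x : Hist (n + 1) r, Vtri n σ (kf μ) x = Vw σ (Wf μ n) x :=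
    fun x => Vtri_eq σ μ x
  have hVt' : (Vtri n σ (kf μ) : Hist (n + 1) r → ℝ) = fun x => Vw σ (Wf μ n) x := funext hVt
  refine ⟨μ, fun i _ => ⟨hμ i, hpos i⟩, kf μ, fun ξ => rfl, kf_succ μ, ?_, ?_, ?_⟩
  · intro t ht d hd x
    rw [hVt']
    exact Vw_dini0 hr hσ (Wf μ n) hWs hWn x _
      (fun hmax => star_closed hr H hσ μ hμ hpos hP t ht d hd x hmax)
  · exact aux_urgas hr hσ hD _ (closed_cont hr H (kf μ n) (kf_contDiff μ hμ n).continuous)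
      (closed_lip hr H (kf μ n) (kf_contDiff μ hμ n)) (Wf μ n) (hWs.differentiable (by simp)) hWn
      a₁ a₂ ha₁ ha₂ hV₁ hV₂
      (fun t ht e he y hmax => star_closed hr H hσ μ hμ hpos hP t ht e he y hmax)
  · simp only [hVt]
    exact tri_orclf hr H hσ μ hμ hpos hP a₁ a₂ ha₁ ha₂ hV₁ hV₂
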